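/- arXiv:2212.09557 — 19 statements merged into one kernel-verified Lean document; each statement's English description precedes it below -/
import Mathlib

section
/- Let S = !![0,-1;1,0] and R = !![0,-1;1,1] be elements of SL(2,ℤ). Then S has order 4, R has order 6, and S^2 = R^3 = -1. Moreover, writing C₄ = ⟨S⟩, C₆ = ⟨R⟩ and C₂ = ⟨-1⟩ for the cyclic subgroups of SL(2,ℤ) generated by these elements, the group homomorphism from the amalgamated free product C₄ ∗_{C₂} C₆ (the pushout of the two subgroup inclusions C₂ ↪ C₄ and C₂ ↪ C₆) to SL(2,ℤ) induced by the inclusions C₄ ↪ SL(2,ℤ) and C₆ ↪ SL(2,ℤ) is an isomorphism (i.e., bijective). -/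
namespace Statement0

abbrev SL2Z := Matrix.SpecialLinearGroup (Fin 2) ℤ

/-- The matrix S = [[0,-1],[1,0]] as an element of SL(2,ℤ). -/
def S : SL2Z := ⟨!![0, -1; 1, 0], by decide⟩

/-- The matrix R = [[0,-1],[1,1]] as an element of SL(2,ℤ). -/
def R : SL2Z := ⟨!![0, -1; 1, 1], by decide⟩

/-- C₄ = ⟨S⟩ -/
def C4 : Subgroup SL2Z := Subgroup.zpowers S

/-- C₆ = ⟨R⟩ -/
def C6 : Subgroup SL2Z := Subgroup.zpowers R

/-- C₂ = ⟨-1⟩ -/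
def C2 : Subgroup SL2Z := Subgroup.zpowers (-1)

/-- The pair of inclusion homomorphisms C ↪ A, C ↪ B, indexed by `Bool`. -/
def incl {G : Type*} [Group G] (A B C : Subgroup G) (hA : C ≤ A) (hB : C ≤ B) :
    ∀ b : Bool, C →* ↥(bif b then A else B)
  | true => Subgroup.inclusion hA
  | false => Subgroup.inclusion hB

/-- The canonical homomorphism from the amalgamated free product A ∗_C B
(the pushout of the two subgroup inclusions) to the ambient group G,
induced by the inclusions A ↪ G and B ↪ G. -/
def amalgamHom {G : Type*} [Group G] (A B C : Subgroup G) (hA : C ≤ A) (hB : C ≤ B) :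
    Monoid.PushoutI (incl A B C hA hB) →* G :=
  Monoid.PushoutI.lift (fun b => (bif b then A else B).subtype) C.subtype
    (fun b => by cases b <;> rfl)

theorem S_sq : S ^ 2 = -1 := by decide

theorem R_cube : R ^ 3 = -1 := by decide

theorem orderOf_S : orderOf S = 4 := by
  refine (orderOf_eq_iff (by norm_num)).2 ⟨by decide, fun m hm hpos => ?_⟩
  interval_cases m <;> decide

theorem orderOf_R : orderOf R = 6 := by
  refine (orderOf_eq_iff (by norm_num)).2 ⟨by decide, fun m hm hpos => ?_⟩
  interval_cases m <;> decide

theorem closure_S_R : Subgroup.closure {S, R} = ⊤ := by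
  rw [eq_top_iff, ← SpecialLinearGroup.SL2Z_generators, Subgroup.closure_le]
  have hS : S ∈ Subgroup.closure {S, R} := Subgroup.subset_closure (by simp)
  have hR : R ∈ Subgroup.closure {S, R} := Subgroup.subset_closure (by simp)
  rintro _ (rfl | rfl)
  · exact hS
  · have hT : ModularGroup.T = S⁻¹ * R := by decide
    rw [hT]
    exact mul_mem (inv_mem hS) hR

section NormalForm

variable {P : Type*} [Group P] {s r : P}

/-- The elements `(s ^ 2) ^ a * r ^ i * m * s ^ j` with `i < 3`, `j < 2` and `m` in the monoid
generated by `s⁻¹ * r` and `s * r⁻¹`. -/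
def HasNormalForm (s r g : P) : Prop :=
  ∃ a i j : ℕ, ∃ m ∈ Submonoid.closure {s⁻¹ * r, s * r⁻¹},
    i < 3 ∧ j < 2 ∧ g = (s ^ 2) ^ a * (r ^ i * (m * s ^ j))

theorem HasNormalForm.sq_mul {g : P} (hg : HasNormalForm s r g) :
    HasNormalForm s r (s ^ 2 * g) := by
  obtain ⟨a, i, j, m, hm, hi, hj, rfl⟩ := hg
  exact ⟨a + 1, i, j, m, hm, hi, hj, by rw [pow_succ' _ a, mul_assoc]⟩

theorem HasNormalForm.sq_pow_mul {g : P} (hg : HasNormalForm s r g) (a : ℕ) :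
    HasNormalForm s r ((s ^ 2) ^ a * g) := by
  induction a with
  | zero => simpa using hg
  | succ a ih => rw [pow_succ', mul_assoc]; exact ih.sq_mul

theorem HasNormalForm.r_mul (hsr : s ^ 2 = r ^ 3) {g : P} (hg : HasNormalForm s r g) :
    HasNormalForm s r (r * g) := by
  obtain ⟨a, i, j, m, hm, hi, hj, rfl⟩ := hg
  have hc : Commute r ((s ^ 2) ^ a) := by
    rw [hsr]; exact ((Commute.refl r).pow_right 3).pow_right a
  rw [← mul_assoc, hc.eq, mul_assoc]
  refine HasNormalForm.sq_pow_mul ?_ a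
  rw [← mul_assoc, ← pow_succ']
  rcases (by omega : i + 1 < 3 ∨ i = 2) with h | rfl
  · exact ⟨0, i + 1, j, m, hm, h, hj, by simp⟩
  · exact ⟨1, 0, j, m, hm, by norm_num, hj, by simp [hsr]⟩

theorem HasNormalForm.s_mul (hsr : s ^ 2 = r ^ 3) {g : P} (hg : HasNormalForm s r g) :
    HasNormalForm s r (s * g) := by
  obtain ⟨a, i, j, m, hm, hi, hj, rfl⟩ := hg
  have hc : Commute s ((s ^ 2) ^ a) := ((Commute.refl s).pow_right 2).pow_right a
  rw [← mul_assoc, hc.eq, mul_assoc]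
  refine HasNormalForm.sq_pow_mul ?_ a
  have hx : s⁻¹ * r ∈ Submonoid.closure {s⁻¹ * r, s * r⁻¹} := Submonoid.subset_closure (by simp)
  have hy : s * r⁻¹ ∈ Submonoid.closure {s⁻¹ * r, s * r⁻¹} := Submonoid.subset_closure (by simp)
  interval_cases i
  · induction hm using Submonoid.closure_induction_left with
    | one =>
      interval_cases j
      · exact ⟨0, 0, 1, 1, one_mem _, by norm_num, by norm_num, by simp⟩
      · exact ⟨1, 0, 0, 1, one_mem _, by norm_num, by norm_num, by simp [pow_two]⟩
    | mul_left x hx m hm _ =>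
      rcases hx with rfl | rfl
      · exact ⟨0, 1, j, m, hm, by norm_num, hj, by simp [mul_assoc]⟩
      · refine ⟨0, 2, j, m, hm, by norm_num, hj, ?_⟩
        have h : s * s * r⁻¹ = r ^ 2 := by rw [← pow_two, hsr]; group
        rw [← h]; simp [mul_assoc]
  · exact ⟨1, 0, j, _, mul_mem hx hm, by norm_num, hj, by simp [mul_assoc, pow_two]⟩
  · refine ⟨1, 0, j, _, mul_mem hy hm, by norm_num, hj, ?_⟩
    have hc : s * r ^ 3 = r ^ 3 * s := by rw [← hsr]; group
    have h : s * r ^ 2 = s ^ 2 * (s * r⁻¹) := by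
      rw [hsr, ← mul_assoc, ← hc]; group
    rw [pow_one, pow_zero, one_mul, ← mul_assoc, h]; simp only [mul_assoc]

theorem hasNormalForm (hs : s ^ 4 = 1) (hsr : s ^ 2 = r ^ 3) {g : P}
    (hg : g ∈ Subgroup.closure {s, r}) : HasNormalForm s r g := by
  have hs_inv : s⁻¹ = s * s ^ 2 := by
    rw [inv_eq_iff_mul_eq_one, ← hs]; group
  have hr_inv : r⁻¹ = s ^ 2 * r ^ 2 := by
    have h : r ^ 6 = 1 := by rw [← hs, pow_mul r 3 2, ← hsr, ← pow_mul]
    rw [inv_eq_iff_mul_eq_one, hsr, ← h]; group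
  induction hg using Subgroup.closure_induction_left with
  | one => exact ⟨0, 0, 0, 1, one_mem _, by norm_num, by norm_num, by simp⟩
  | mul_left x hx y _ ih =>
    rcases hx with rfl | rfl
    · exact ih.s_mul hsr
    · exact ih.r_mul hsr
  | inv_mul_cancel x hx y _ ih =>
    rcases hx with rfl | rfl
    · rw [hs_inv, mul_assoc]
      exact ih.sq_mul.s_mul hsr
    · rw [hr_inv, pow_two x, mul_assoc, mul_assoc]
      exact ((ih.r_mul hsr).r_mul hsr).sq_mul

/-- The monoid generated by `s⁻¹ * r` and `s * r⁻¹` maps to matrices with nonnegative entries and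
positive diagonal, and only its identity maps to a diagonal matrix. -/
theorem entries_of_mem_closure {f : P →* SL2Z} (hfs : f s = S) (hfr : f r = R) {m : P}
    (hm : m ∈ Submonoid.closure {s⁻¹ * r, s * r⁻¹}) :
    0 < f m 0 0 ∧ 0 ≤ f m 0 1 ∧ 0 ≤ f m 1 0 ∧ 0 < f m 1 1 ∧
      (m = 1 ∨ 0 < f m 0 1 + f m 1 0) := by
  induction hm using Submonoid.closure_induction_left with
  | one => simp
  | mul_left x hx m _ ih =>
    obtain ⟨h00, h01, h10, h11, -⟩ := ih
    rcases hx with rfl | rfl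
    · have h : (f (s⁻¹ * r)).1 = !![1, 1; 0, 1] := by
        rw [map_mul, map_inv, hfs, hfr]; decide
      rw [map_mul, Matrix.SpecialLinearGroup.coe_mul, h]
      simp only [Matrix.mul_apply, Fin.sum_univ_two, Matrix.of_apply, Matrix.cons_val',
        Matrix.cons_val_zero, Matrix.cons_val_one, Matrix.cons_val_fin_one]
      refine ⟨?_, ?_, ?_, ?_, Or.inr ?_⟩ <;> linarith
    · have h : (f (s * r⁻¹)).1 = !![1, 0; 1, 1] := by
        rw [map_mul, map_inv, hfs, hfr]; decide
      rw [map_mul, Matrix.SpecialLinearGroup.coe_mul, h]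
      simp only [Matrix.mul_apply, Fin.sum_univ_two, Matrix.of_apply, Matrix.cons_val',
        Matrix.cons_val_zero, Matrix.cons_val_one, Matrix.cons_val_fin_one]
      refine ⟨?_, ?_, ?_, ?_, Or.inr ?_⟩ <;> linarith

theorem injective_of_normalForm (hs : s ^ 4 = 1) (hsr : s ^ 2 = r ^ 3)
    (hgen : Subgroup.closure {s, r} = ⊤) {f : P →* SL2Z} (hfs : f s = S) (hfr : f r = R) :
    Function.Injective f := by
  rw [injective_iff_map_eq_one]
  intro g hg
  obtain ⟨a, i, j, m, hm, hi, hj, rfl⟩ :=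
    hasNormalForm hs hsr (hgen ▸ Subgroup.mem_top g)
  obtain ⟨h00, h01, h10, h11, hoff⟩ := entries_of_mem_closure hfs hfr hm
  have hz : (s ^ 2) ^ a = (s ^ 2) ^ (a % 2) := by
    conv_lhs => rw [← Nat.mod_add_div a 2]
    rw [pow_add, pow_mul (s ^ 2) 2, ← pow_mul s 2 2, hs, one_pow, mul_one]
  rw [hz] at hg ⊢
  have ha : a % 2 < 2 := Nat.mod_lt _ (by norm_num)
  generalize a % 2 = b at ha hg ⊢
  simp only [map_mul, map_pow, hfs, hfr] at hg
  have hfm : f m = (R ^ i)⁻¹ * ((S ^ 2) ^ b)⁻¹ * (S ^ j)⁻¹ := by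
    rw [← mul_one ((R ^ i)⁻¹ * ((S ^ 2) ^ b)⁻¹), ← hg]
    group
  rw [hfm] at h00 h01 h10 h11 hoff
  have hm1 : m = 1 ∧ i = 0 ∧ j = 0 ∧ b = 0 := by
    clear hg hz hfm
    interval_cases i <;> interval_cases j <;> interval_cases b <;> first
      | exact absurd h00 (by decide)
      | exact absurd h01 (by decide)
      | exact absurd h10 (by decide)
      | exact absurd h11 (by decide)
      | exact ⟨hoff.resolve_right (by decide), rfl, rfl, rfl⟩
  obtain ⟨rfl, rfl, rfl, rfl⟩ := hm1
  simp

end NormalForm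

theorem map_mem_of_mem_zpowers {G Q : Type*} [Group G] [Group Q] {g : G}
    (o : Subgroup.zpowers g →* Q) {K : Subgroup Q}
    (hK : o ⟨g, Subgroup.mem_zpowers g⟩ ∈ K) (x : Subgroup.zpowers g) : o x ∈ K := by
  obtain ⟨n, hn⟩ := x.2
  have hx : x = ⟨g, Subgroup.mem_zpowers g⟩ ^ n := Subtype.ext hn.symm
  rw [hx, map_zpow]
  exact zpow_mem hK n

theorem amalgamHom_bijective (h4 : C2 ≤ C4) (h6 : C2 ≤ C6) :
    Function.Bijective (amalgamHom C4 C6 C2 h4 h6) := by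
  let φ := incl C4 C6 C2 h4 h6
  let ofS : C4 →* Monoid.PushoutI φ := Monoid.PushoutI.of (φ := φ) true
  let ofR : C6 →* Monoid.PushoutI φ := Monoid.PushoutI.of (φ := φ) false
  let s := ofS ⟨S, Subgroup.mem_zpowers S⟩
  let r := ofR ⟨R, Subgroup.mem_zpowers R⟩
  have hfs : amalgamHom C4 C6 C2 h4 h6 s = S := Monoid.PushoutI.lift_of _ _ _ _
  have hfr : amalgamHom C4 C6 C2 h4 h6 r = R := Monoid.PushoutI.lift_of _ _ _ _
  have hs : s ^ 4 = 1 := by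
    have h : (⟨S, Subgroup.mem_zpowers S⟩ : C4) ^ 4 = 1 :=
      Subtype.ext (show S ^ 4 = 1 by decide)
    rw [← map_pow, h, map_one]
  have hsr : s ^ 2 = r ^ 3 := by
    have hS : (⟨S, Subgroup.mem_zpowers S⟩ : C4) ^ 2 =
        φ true ⟨-1, Subgroup.mem_zpowers _⟩ := Subtype.ext S_sq
    have hR : (⟨R, Subgroup.mem_zpowers R⟩ : C6) ^ 3 =
        φ false ⟨-1, Subgroup.mem_zpowers _⟩ := Subtype.ext R_cube
    rw [← map_pow, ← map_pow, hS, hR]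
    exact (Monoid.PushoutI.of_apply_eq_base φ true _).trans
      (Monoid.PushoutI.of_apply_eq_base φ false _).symm
  have hmemS : ∀ g : C4, ofS g ∈ Subgroup.closure {s, r} :=
    map_mem_of_mem_zpowers ofS (Subgroup.subset_closure (Set.mem_insert s {r}))
  have hmemR : ∀ g : C6, ofR g ∈ Subgroup.closure {s, r} :=
    map_mem_of_mem_zpowers ofR (Subgroup.subset_closure (Set.mem_insert_of_mem s rfl))
  have hgen : Subgroup.closure {s, r} = ⊤ := by
    refine eq_top_iff.2 fun x _ => ?_
    induction x using Monoid.PushoutI.induction_on with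
    | of b g =>
      cases b
      · exact hmemR g
      · exact hmemS g
    | base h =>
      rw [← Monoid.PushoutI.of_apply_eq_base φ true h]
      exact hmemS _
    | mul x y hx hy => exact mul_mem (hx trivial) (hy trivial)
  refine ⟨injective_of_normalForm hs hsr hgen hfs hfr, ?_⟩
  rw [← MonoidHom.range_eq_top, eq_top_iff, ← closure_S_R, Subgroup.closure_le]
  rintro _ (rfl | rfl)
  · exact ⟨s, hfs⟩
  · exact ⟨r, hfr⟩

theorem statement0 :
    orderOf S = 4 ∧ orderOf R = 6 ∧ S ^ 2 = -1 ∧ R ^ 3 = -1 ∧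
    ∃ (h4 : C2 ≤ C4) (h6 : C2 ≤ C6),
      Function.Bijective (amalgamHom C4 C6 C2 h4 h6) := by
  have h4 : C2 ≤ C4 := by
    rw [C2, Subgroup.zpowers_le, ← S_sq]
    exact pow_mem (Subgroup.mem_zpowers S) 2
  have h6 : C2 ≤ C6 := by
    rw [C2, Subgroup.zpowers_le, ← R_cube]
    exact pow_mem (Subgroup.mem_zpowers R) 3
  exact ⟨orderOf_S, orderOf_R, S_sq, R_cube, h4, h6, amalgamHom_bijective h4 h6⟩

end Statement0
end

section
/- Let σ = !![0,1;1,0] ∈ GL(2,ℤ). Let D₄ ≤ GL(2,ℤ) be the subgroup generated by !![0,1;-1,0] and σ, let D₆ ≤ GL(2,ℤ) be the subgroup generated by !![0,1;-1,1] and σ, and let D₂ ≤ GL(2,ℤ) be the subgroup generated by -1 and σ. Then D₂ is contained in both D₄ and D₆, the groups D₂, D₄, D₆ are dihedral of orders 4, 8, 12 respectively, and the homomorphism from the amalgamated free product D₄ ∗_{D₂} D₆ (the pushout of the two subgroup inclusions D₂ ↪ D₄ and D₂ ↪ D₆) to GL(2,ℤ) induced by the inclusions D₄ ↪ GL(2,ℤ)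 and D₆ ↪ GL(2,ℤ) is an isomorphism. -/
namespace Statement1

abbrev GL2Z := GL (Fin 2) ℤ

/-- σ = [[0,1],[1,0]] as an element of GL(2,ℤ) (it is its own inverse). -/
def σ : GL2Z := ⟨!![0, 1; 1, 0], !![0, 1; 1, 0], by decide, by decide⟩

/-- The rotation of order 4, [[0,1],[-1,0]]. -/
def r4 : GL2Z := ⟨!![0, 1; -1, 0], !![0, -1; 1, 0], by decide, by decide⟩

/-- The rotation of order 6, [[0,1],[-1,1]]. -/
def r6 : GL2Z := ⟨!![0, 1; -1, 1], !![1, -1; 1, 0], by decide, by decide⟩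

/-- D₄ ≤ GL(2,ℤ), the subgroup generated by [[0,1],[-1,0]] and σ. -/
def D4 : Subgroup GL2Z := Subgroup.closure {r4, σ}

/-- D₆ ≤ GL(2,ℤ), the subgroup generated by [[0,1],[-1,1]] and σ. -/
def D6 : Subgroup GL2Z := Subgroup.closure {r6, σ}

/-- D₂ ≤ GL(2,ℤ), the subgroup generated by -1 and σ. -/
def D2 : Subgroup GL2Z := Subgroup.closure {-1, σ}

/-- The pair of inclusion homomorphisms C ↪ A, C ↪ B, indexed by `Bool`. -/
def incl {G : Type*} [Group G] (A B C : Subgroup G) (hA : C ≤ A) (hB : C ≤ B) :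
    ∀ b : Bool, C →* ↥(bif b then A else B)
  | true => Subgroup.inclusion hA
  | false => Subgroup.inclusion hB

/-- The canonical homomorphism from the amalgamated free product A ∗_C B
(the pushout of the two subgroup inclusions) to the ambient group G,
induced by the inclusions A ↪ G and B ↪ G. -/
def amalgamHom {G : Type*} [Group G] (A B C : Subgroup G) (hA : C ≤ A) (hB : C ≤ B) :
    Monoid.PushoutI (incl A B C hA hB) →* G :=
  Monoid.PushoutI.lift (fun b => (bif b then A else B).subtype) C.subtype
    (fun b => by cases b <;> rfl)

/-- The homomorphism from a dihedral group determined by a rotation `x` and a reflection `y`. -/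
def dihedralHom {G : Type*} [Group G] (n : ℕ) [NeZero n] (x y : G) (hx : x ^ n = 1)
    (hy : y * y = 1) (hxy : y * x * y = x⁻¹) : DihedralGroup n →* G :=
  have hadd (i j : ZMod n) : x ^ (i + j).val = x ^ i.val * x ^ j.val := by
    rw [ZMod.val_add, ← pow_add, ← pow_eq_pow_mod _ hx]
  have hsub (i j : ZMod n) : x ^ (j - i).val = (x ^ i.val)⁻¹ * x ^ j.val := by
    rw [eq_inv_mul_iff_mul_eq, ← hadd, add_sub_cancel]
  have hconj (k : ℕ) : x ^ k * y = y * (x ^ k)⁻¹ := by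
    have hy' : y⁻¹ = y := inv_eq_of_mul_eq_one_left hy
    have h := conj_pow (i := k) (a := y) (b := x)
    rw [hy', hxy, inv_pow] at h
    rw [h, ← mul_assoc, ← mul_assoc, hy, one_mul]
  { toFun := fun
      | .r i => x ^ i.val
      | .sr i => y * x ^ i.val
    map_one' := by
      change x ^ (0 : ZMod n).val = 1
      rw [ZMod.val_zero, pow_zero]
    map_mul' := by
      rintro (i | i) (j | j)
      · simp [hadd]
      · simp only [DihedralGroup.r_mul_sr, hsub]
        rw [← mul_assoc, ← mul_assoc, hconj]
      · simp [hadd, mul_assoc]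
      · simp only [DihedralGroup.sr_mul_sr, hsub]
        rw [mul_assoc, ← mul_assoc _ y, hconj, ← mul_assoc, ← mul_assoc, hy, one_mul] }

theorem range_dihedralHom {G : Type*} [Group G] (n : ℕ) [NeZero n] (x y : G) (hx : x ^ n = 1)
    (hy : y * y = 1) (hxy : y * x * y = x⁻¹) :
    (dihedralHom n x y hx hy hxy).range = Subgroup.closure {x, y} := by
  have hxm : x ∈ Subgroup.closure {x, y} := Subgroup.subset_closure (by simp)
  have hym : y ∈ Subgroup.closure {x, y} := Subgroup.subset_closure (by simp)
  apply le_antisymm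
  · rintro _ ⟨i | i, rfl⟩
    · exact pow_mem hxm _
    · exact mul_mem hym (pow_mem hxm _)
  · rw [Subgroup.closure_le]
    refine Set.insert_subset ?_ (Set.singleton_subset_iff.2 ?_)
    · refine ⟨.r ((1 : ℕ) : ZMod n), ?_⟩
      change x ^ ((1 : ℕ) : ZMod n).val = x
      rw [ZMod.val_natCast, ← pow_eq_pow_mod _ hx, pow_one]
    · refine ⟨.sr 0, ?_⟩
      change y * x ^ (0 : ZMod n).val = y
      rw [ZMod.val_zero, pow_zero, mul_one]

theorem nonempty_mulEquiv_dihedralGroup {G : Type*} [Group G] (n : ℕ) [NeZero n] (x y : G)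
    (hx : x ^ n = 1) (hy : y * y = 1) (hxy : y * x * y = x⁻¹)
    (hinj : ∀ a, dihedralHom n x y hx hy hxy a = 1 → a = 1) :
    Nonempty (Subgroup.closure {x, y} ≃* DihedralGroup n) := by
  rw [← range_dihedralHom n x y hx hy hxy]
  exact ⟨(MonoidHom.ofInjective ((injective_iff_map_eq_one _).2 hinj)).symm⟩

/-- Elements of a group generated by `s`, `r`, `t` subject to the relations of `GL(2,ℤ)` have
the form `m * y` or `s * m * y`, with `m` a positive word in `r * s` and `r ^ 2 * s`, and `y` in the
dihedral subgroup generated by `s` and `t`. -/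
theorem exists_factorization {P : Type*} [Group P] {s r t : P} (hs : s ^ 4 = 1)
    (hsr : r ^ 3 = s ^ 2) (ht : t * t = 1) (hts : t * s * t = s⁻¹) (htr : t * r * t = r⁻¹)
    {g : P} (hg : g ∈ Subgroup.closure {s, r, t}) :
    ∃ m ∈ Submonoid.closure {r * s, r ^ 2 * s}, ∃ y ∈ Subgroup.closure {s, t},
      g = m * y ∨ g = s * m * y := by
  have hsm : s ∈ Subgroup.closure {s, t} := Subgroup.subset_closure (by simp)
  have htm : t ∈ Subgroup.closure {s, t} := Subgroup.subset_closure (by simp)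
  have hzs : Commute (s ^ 2) s := (Commute.refl s).pow_left 2
  have hzr : Commute (s ^ 2) r := hsr ▸ (Commute.refl r).pow_left 3
  have hzz : s ^ 2 * s ^ 2 = 1 := by rw [← pow_add, hs]
  have hsinv : s⁻¹ = s ^ 3 := inv_eq_of_mul_eq_one_right (by rw [← pow_succ', hs])
  have hrinv : r⁻¹ = r ^ 5 := inv_eq_of_mul_eq_one_right (by
    rw [← pow_succ', show 5 + 1 = 3 * 2 from rfl, pow_mul, hsr, ← pow_mul, hs])
  have htinv : t⁻¹ = t := inv_eq_of_mul_eq_one_left ht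
  have hzm : ∀ m ∈ Submonoid.closure {r * s, r ^ 2 * s}, s ^ 2 * m = m * s ^ 2 := by
    intro m hm
    induction hm using Submonoid.closure_induction with
    | mem x hx =>
      rcases hx with rfl | rfl
      · exact hzr.mul_right hzs
      · exact (hzr.pow_right 2).mul_right hzs
    | one => simp
    | mul x y _ _ hx hy => exact Commute.mul_right hx hy
  have htrs : t * (r * s) * t = r ^ 2 * s := by
    have h : t * (r * s) * t = (t * r * t) * (t * s * t) := by
      simp only [mul_assoc]
      rw [← mul_assoc t t, ht, one_mul]
    rw [h, hts, htr, hrinv, hsinv, show 5 = 2 + 3 from rfl, pow_add, hsr, pow_succ s 2,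
      mul_assoc, ← mul_assoc (s ^ 2), hzz, one_mul]
  have htm' : ∀ m ∈ Submonoid.closure {r * s, r ^ 2 * s},
      t * m * t ∈ Submonoid.closure {r * s, r ^ 2 * s} := by
    intro m hm
    induction hm using Submonoid.closure_induction with
    | mem x hx =>
      rcases hx with rfl | rfl
      · exact htrs ▸ Submonoid.subset_closure (by simp)
      · have h : t * (r ^ 2 * s) * t = r * s := by
          rw [← htrs]
          simp only [mul_assoc, ht, mul_one]
          rw [← mul_assoc t t, ht, one_mul]
        exact h ▸ Submonoid.subset_closure (by simp)
    | one => simp [ht]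
    | mul x y _ _ hx hy =>
      have h : t * (x * y) * t = (t * x * t) * (t * y * t) := by
        simp only [mul_assoc]
        rw [← mul_assoc t t, ht, one_mul]
      exact h ▸ mul_mem hx hy
  have hswap : ∀ m, t * m = (t * m * t) * t := fun m => by rw [mul_assoc (t * m), ht, mul_one]
  let T : Set P := {g | ∃ m ∈ Submonoid.closure {r * s, r ^ 2 * s},
    ∃ y ∈ Subgroup.closure {s, t}, g = m * y ∨ g = s * m * y}
  have hTs : ∀ g ∈ T, s * g ∈ T := by
    rintro _ ⟨m, hm, y, hy, rfl | rfl⟩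
    · exact ⟨m, hm, y, hy, .inr (by simp only [mul_assoc])⟩
    · refine ⟨m, hm, s ^ 2 * y, mul_mem (pow_mem hsm 2) hy, .inl ?_⟩
      rw [← mul_assoc m, ← hzm m hm]
      simp only [pow_two, mul_assoc]
  have hTt : ∀ g ∈ T, t * g ∈ T := by
    rintro _ ⟨m, hm, y, hy, rfl | rfl⟩
    · refine ⟨t * m * t, htm' m hm, t * y, mul_mem htm hy, .inl ?_⟩
      rw [← mul_assoc, ← mul_assoc, ← hswap]
    · refine ⟨t * m * t, htm' m hm, s ^ 2 * (t * y),
        mul_mem (pow_mem hsm 2) (mul_mem htm hy), .inr ?_⟩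
      have h : t * (s * m * y) = (t * s * t) * ((t * m * t) * (t * y)) := by
        simp only [mul_assoc]
        simp only [← mul_assoc t t, ht, one_mul]
      rw [h, hts, hsinv, mul_assoc s, ← mul_assoc (t * m * t) (s ^ 2), ← hzm _ (htm' m hm),
        pow_succ' s 2]
      simp only [mul_assoc]
  have hTr : ∀ g ∈ T, r * g ∈ T := by
    rintro _ ⟨m, hm, y, hy, rfl | rfl⟩
    · induction hm using Submonoid.closure_induction_left with
      | one =>
        exact ⟨r * s, Submonoid.subset_closure (by simp), s⁻¹ * y, mul_mem (inv_mem hsm) hy,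
          .inl (by group)⟩
      | mul_left x hx m hm _ =>
        rcases hx with rfl | rfl
        · exact ⟨r ^ 2 * s * m, mul_mem (Submonoid.subset_closure (by simp)) hm, y, hy,
            .inl (by simp only [pow_two, mul_assoc])⟩
        · refine ⟨m, hm, s ^ 2 * y, mul_mem (pow_mem hsm 2) hy, .inr ?_⟩
          have h : r * (r ^ 2 * s * m * y) = r ^ 3 * s * m * y := by
            rw [pow_succ' r 2]; simp only [mul_assoc]
          rw [h, hsr, hzs.eq, mul_assoc s, hzm m hm]
          simp only [mul_assoc]
    · exact ⟨r * s * m, mul_mem (Submonoid.subset_closure (by simp)) hm, y, hy,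
        .inl (by simp only [mul_assoc])⟩
  have hpow (x : P) (hx : ∀ g ∈ T, x * g ∈ T) (k : ℕ) : ∀ g ∈ T, x ^ k * g ∈ T := by
    induction k with
    | zero => simp
    | succ k ih =>
      intro g hg
      rw [pow_succ, mul_assoc]
      exact ih _ (hx g hg)
  change g ∈ T
  induction hg using Subgroup.closure_induction_left with
  | one => exact ⟨1, one_mem _, 1, one_mem _, .inl (by simp)⟩
  | mul_left x hx y _ hy =>
    rcases hx with rfl | rfl | rfl
    exacts [hTs y hy, hTr y hy, hTt y hy]
  | inv_mul_cancel x hx y _ hy =>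
    rcases hx with rfl | rfl | rfl
    · exact hsinv ▸ hpow _ hTs 3 y hy
    · exact hrinv ▸ hpow _ hTr 5 y hy
    · exact htinv.symm ▸ hTt y hy

theorem r4_mem_D4 : r4 ∈ D4 := Subgroup.subset_closure (by simp)

theorem σ_mem_D4 : σ ∈ D4 := Subgroup.subset_closure (by simp)

theorem r6_mem_D6 : r6 ∈ D6 := Subgroup.subset_closure (by simp)

theorem σ_mem_D6 : σ ∈ D6 := Subgroup.subset_closure (by simp)

theorem D2_le_D4 : D2 ≤ D4 := by
  rw [D2, Subgroup.closure_le]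
  rintro _ (rfl | rfl)
  · exact (by decide : r4 ^ 2 = -1) ▸ pow_mem r4_mem_D4 2
  · exact σ_mem_D4

theorem D2_le_D6 : D2 ≤ D6 := by
  rw [D2, Subgroup.closure_le]
  rintro _ (rfl | rfl)
  · exact (by decide : r6 ^ 3 = -1) ▸ pow_mem r6_mem_D6 3
  · exact σ_mem_D6

theorem D2_equiv : Nonempty (D2 ≃* DihedralGroup 2) :=
  nonempty_mulEquiv_dihedralGroup 2 (-1) σ (by decide) (by decide) (by decide) (by decide)

theorem D4_equiv : Nonempty (D4 ≃* DihedralGroup 4) :=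
  nonempty_mulEquiv_dihedralGroup 4 r4 σ (by decide) (by decide) (by decide) (by decide)

theorem D6_equiv : Nonempty (D6 ≃* DihedralGroup 6) :=
  nonempty_mulEquiv_dihedralGroup 6 r6 σ (by decide) (by decide) (by decide) (by decide)

theorem natCard_of_equiv_dihedralGroup {G : Type*} [Group G] {n : ℕ}
    (h : Nonempty (G ≃* DihedralGroup n)) : Nat.card G = 2 * n := by
  obtain ⟨e⟩ := h
  rw [Nat.card_congr e.toEquiv, DihedralGroup.nat_card]

theorem sum_abs_entries_of_mem_D4 {g : GL2Z} (hg : g ∈ D4) :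
    |g.1 0 0| + |g.1 0 1| + |g.1 1 0| + |g.1 1 1| = 2 := by
  rw [D4, ← range_dihedralHom 4 r4 σ (by decide) (by decide) (by decide)] at hg
  obtain ⟨a, rfl⟩ := hg
  revert a
  decide

/-- A nontrivial positive word in `r6 * r4` and `r6 ^ 2 * r4` is, up to sign, a matrix with
nonnegative entries whose sum is at least three. -/
theorem entries_of_mem_closure {P : Type*} [Group P] (f : P →* GL2Z) {s r : P} (hs : f s = r4)
    (hr : f r = r6) {m : P} (hm : m ∈ Submonoid.closure {r * s, r ^ 2 * s}) :
    ∃ e : ℤ, |e| = 1 ∧ ∃ a b c d : ℤ, 0 ≤ a ∧ 0 ≤ b ∧ 0 ≤ c ∧ 0 ≤ d ∧ 1 ≤ a + b ∧ 1 ≤ c + d ∧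
      (m = 1 ∨ 3 ≤ a + b + c + d) ∧ (f m).1 = !![e * a, e * b; e * c, e * d] := by
  induction hm using Submonoid.closure_induction_left with
  | one =>
    refine ⟨1, by simp, 1, 0, 0, 1, by simp, by simp, by simp, by simp, by simp, by simp,
      .inl rfl, ?_⟩
    simp [Matrix.one_fin_two]
  | mul_left x hx y _ ih =>
    obtain ⟨e, he, a, b, c, d, ha, hb, hc, hd, hab, hcd, -, hf⟩ := ih
    rcases hx with rfl | rfl
    · refine ⟨-e, by simpa using he, a, b, a + c, b + d, ha, hb, by lia, by lia, by lia, by lia,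
        .inr (by lia), ?_⟩
      have h : (r6 * r4).1 = !![-1, 0; -1, -1] := by decide
      rw [map_mul, map_mul, hs, hr, Units.val_mul, h, hf]
      ext i j
      fin_cases i <;> fin_cases j <;> simp <;> ring
    · refine ⟨-e, by simpa using he, a + c, b + d, c, d, by lia, by lia, hc, hd, by lia, by lia,
        .inr (by lia), ?_⟩
      have h : (r6 ^ 2 * r4).1 = !![-1, -1; 0, -1] := by decide
      rw [map_mul, map_mul, map_pow, hs, hr, Units.val_mul, h, hf]
      ext i j
      fin_cases i <;> fin_cases j <;> simp <;> ring

theorem eq_one_of_mem_closure {P : Type*} [Group P] (f : P →* GL2Z) {s r : P} (hs : f s = r4)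
    (hr : f r = r6) {m : P} (hm : m ∈ Submonoid.closure {r * s, r ^ 2 * s}) (h4 : f m ∈ D4) :
    m = 1 := by
  obtain ⟨e, he, a, b, c, d, ha, hb, hc, hd, -, -, h | h, hf⟩ := entries_of_mem_closure f hs hr hm
  · exact h
  · have := sum_abs_entries_of_mem_D4 h4
    simp only [hf, Matrix.of_apply, Matrix.cons_val', Matrix.cons_val_zero, Matrix.cons_val_one,
      Matrix.cons_val_fin_one, abs_mul, he, one_mul, abs_of_nonneg, ha, hb, hc, hd] at this
    lia

theorem map_mem_closure_pair {G P : Type*} [Group G] [Group P] {x y : G}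
    (i : Subgroup.closure {x, y} →* P) (g : Subgroup.closure {x, y}) :
    i g ∈ Subgroup.closure {i ⟨x, Subgroup.subset_closure (by simp)⟩,
      i ⟨y, Subgroup.subset_closure (by simp)⟩} := by
  obtain ⟨g, hg⟩ := g
  induction hg using Subgroup.closure_induction with
  | mem z hz =>
    rcases hz with rfl | rfl <;> exact Subgroup.subset_closure (by simp)
  | one => exact (map_one i).symm ▸ one_mem _
  | mul a b ha hb iha ihb => exact (map_mul i ⟨a, ha⟩ ⟨b, hb⟩).symm ▸ mul_mem iha ihb
  | inv a ha iha => exact (map_inv i ⟨a, ha⟩).symm ▸ inv_mem iha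

/-- A homomorphism to `GL(2,ℤ)` from a group generated by compatible copies of `D4` and `D6`
is injective if it restricts to the inclusions of these subgroups. -/
theorem injective_of_generated {P : Type*} [Group P] (f : P →* GL2Z) (i4 : D4 →* P) (i6 : D6 →* P)
    (hf4 : ∀ x, f (i4 x) = x) (hf6 : ∀ x, f (i6 x) = x)
    (hcompat : ∀ x : D2, i4 (Subgroup.inclusion D2_le_D4 x) = i6 (Subgroup.inclusion D2_le_D6 x))
    (hgen : i4.range ⊔ i6.range = ⊤) : Function.Injective f := by
  set s := i4 ⟨r4, r4_mem_D4⟩ with hs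
  set r := i6 ⟨r6, r6_mem_D6⟩ with hr
  set t := i4 ⟨σ, σ_mem_D4⟩ with ht
  have htt : t = i6 ⟨σ, σ_mem_D6⟩ := hcompat ⟨σ, Subgroup.subset_closure (by simp)⟩
  have hsr : r ^ 3 = s ^ 2 := by
    have h := hcompat ⟨-1, Subgroup.subset_closure (by simp)⟩
    rw [hs, hr, ← map_pow, ← map_pow]
    convert h.symm using 2
    · exact Subtype.ext (by decide : r6 ^ 3 = -1)
    · exact Subtype.ext (by decide : r4 ^ 2 = -1)
  have hs4 : s ^ 4 = 1 := by
    rw [hs, ← map_pow, ← map_one i4]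
    exact congrArg i4 (Subtype.ext (by decide : r4 ^ 4 = 1))
  have ht2 : t * t = 1 := by
    rw [ht, ← map_mul, ← map_one i4]
    exact congrArg i4 (Subtype.ext (by decide : σ * σ = 1))
  have hts : t * s * t = s⁻¹ := by
    rw [ht, hs, ← map_mul, ← map_mul, ← map_inv]
    exact congrArg i4 (Subtype.ext (by decide : σ * r4 * σ = r4⁻¹))
  have htr : t * r * t = r⁻¹ := by
    rw [htt, hr, ← map_mul, ← map_mul, ← map_inv]
    exact congrArg i6 (Subtype.ext (by decide : σ * r6 * σ = r6⁻¹))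
  have htop : Subgroup.closure {s, r, t} = ⊤ := by
    rw [eq_top_iff, ← hgen, sup_le_iff]
    constructor
    · rintro _ ⟨x, rfl⟩
      exact Subgroup.closure_mono (Set.insert_subset_insert (Set.subset_insert _ _))
        (map_mem_closure_pair i4 x)
    · rintro _ ⟨x, rfl⟩
      refine Subgroup.closure_mono ?_ (map_mem_closure_pair i6 x)
      rintro _ (rfl | rfl)
      · exact .inr (.inl rfl)
      · exact .inr (.inr htt.symm)
  have hrange : Subgroup.closure {s, t} ≤ i4.range := by
    rw [Subgroup.closure_le]
    rintro _ (rfl | rfl) <;> exact ⟨_, rfl⟩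
  have hfs : f s = r4 := hf4 _
  have hfr : f r = r6 := hf6 _
  rw [injective_iff_map_eq_one]
  intro g hg
  obtain ⟨m, hm, y, hy, h⟩ := exists_factorization hs4 hsr ht2 hts htr (htop ▸ Subgroup.mem_top g)
  obtain ⟨y, rfl⟩ := hrange hy
  have hmem : f m ∈ D4 := by
    rcases h with rfl | rfl
    · rw [map_mul, hf4, mul_eq_one_iff_eq_inv] at hg
      exact hg ▸ inv_mem y.2
    · rw [map_mul, map_mul, hfs, hf4, mul_eq_one_iff_eq_inv, ← eq_inv_mul_iff_mul_eq] at hg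
      exact hg ▸ mul_mem (inv_mem r4_mem_D4) (inv_mem y.2)
  obtain rfl := eq_one_of_mem_closure f hfs hfr hm hmem
  have hg4 : ∃ x, g = i4 x := by
    rcases h with rfl | rfl
    · exact ⟨y, one_mul _⟩
    · exact ⟨⟨r4, r4_mem_D4⟩ * y, by rw [map_mul, mul_one]⟩
  obtain ⟨x, rfl⟩ := hg4
  rw [hf4] at hg
  rw [(Subtype.ext hg : x = 1), map_one]

theorem D4_sup_D6 : D4 ⊔ D6 = ⊤ := by
  have h4 : D4 ≤ D4 ⊔ D6 := le_sup_left
  have h6 : D6 ≤ D4 ⊔ D6 := le_sup_right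
  have hSL : ∀ A : Matrix.SpecialLinearGroup (Fin 2) ℤ,
      Matrix.SpecialLinearGroup.toGL A ∈ D4 ⊔ D6 := by
    intro A
    have hA : A ∈ Subgroup.closure {ModularGroup.S, ModularGroup.T} := by
      simp [SpecialLinearGroup.SL2Z_generators]
    have hle : Subgroup.closure {ModularGroup.S, ModularGroup.T} ≤
        (D4 ⊔ D6).comap Matrix.SpecialLinearGroup.toGL := by
      rw [Subgroup.closure_le]
      rintro _ (rfl | rfl)
      · have h : Matrix.SpecialLinearGroup.toGL ModularGroup.S = r4⁻¹ := by decide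
        exact Subgroup.mem_comap.2 (h ▸ inv_mem (h4 r4_mem_D4))
      · have h : Matrix.SpecialLinearGroup.toGL ModularGroup.T = r4 ^ 2 * (r6 ^ 2 * r4) := by
          decide
        exact Subgroup.mem_comap.2 (h ▸ mul_mem (pow_mem (h4 r4_mem_D4) 2)
          (mul_mem (pow_mem (h6 r6_mem_D6) 2) (h4 r4_mem_D4)))
    exact hle hA
  have hdet : ∀ g : GL2Z, g.1.det = 1 → g ∈ D4 ⊔ D6 := by
    intro g hg
    have h : Matrix.SpecialLinearGroup.toGL ⟨g.1, hg⟩ = g := Units.ext rfl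
    exact h ▸ hSL ⟨g.1, hg⟩
  rw [eq_top_iff]
  intro g _
  rcases Int.isUnit_iff.1 ((Matrix.isUnit_iff_isUnit_det _).1 g.isUnit) with h | h
  · exact hdet g h
  · have hσ : σ.1.det = -1 := by decide
    have := hdet (σ * g) (by rw [Units.val_mul, Matrix.det_mul, hσ, h]; rfl)
    exact ((D4 ⊔ D6).mul_mem_cancel_left (h4 σ_mem_D4)).1 this

theorem amalgamHom_of {G : Type*} [Group G] (A B C : Subgroup G) (hA : C ≤ A) (hB : C ≤ B)
    (b : Bool) (x : ↥(bif b then A else B)) :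
    amalgamHom A B C hA hB (Monoid.PushoutI.of b x) = x :=
  Monoid.PushoutI.lift_of (φ := incl A B C hA hB) (fun b => (bif b then A else B).subtype)
    C.subtype _ x


theorem statement1 :
    ∃ (h4 : D2 ≤ D4) (h6 : D2 ≤ D6),
      Nat.card D2 = 4 ∧ Nonempty (D2 ≃* DihedralGroup 2) ∧
      Nat.card D4 = 8 ∧ Nonempty (D4 ≃* DihedralGroup 4) ∧
      Nat.card D6 = 12 ∧ Nonempty (D6 ≃* DihedralGroup 6) ∧
      Function.Bijective (amalgamHom D4 D6 D2 h4 h6) := by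
  let i4 : D4 →* Monoid.PushoutI (incl D4 D6 D2 D2_le_D4 D2_le_D6) :=
    Monoid.PushoutI.of (φ := incl D4 D6 D2 D2_le_D4 D2_le_D6) true
  let i6 : D6 →* Monoid.PushoutI (incl D4 D6 D2 D2_le_D4 D2_le_D6) :=
    Monoid.PushoutI.of (φ := incl D4 D6 D2 D2_le_D4 D2_le_D6) false
  have hf4 (x : D4) : amalgamHom D4 D6 D2 D2_le_D4 D2_le_D6 (i4 x) = x :=
    amalgamHom_of D4 D6 D2 _ _ true x
  have hf6 (x : D6) : amalgamHom D4 D6 D2 D2_le_D4 D2_le_D6 (i6 x) = x :=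
    amalgamHom_of D4 D6 D2 _ _ false x
  have hb4 (x : D2) : i4 (Subgroup.inclusion D2_le_D4 x) = Monoid.PushoutI.base _ x :=
    Monoid.PushoutI.of_apply_eq_base (incl D4 D6 D2 D2_le_D4 D2_le_D6) true x
  have hb6 (x : D2) : i6 (Subgroup.inclusion D2_le_D6 x) = Monoid.PushoutI.base _ x :=
    Monoid.PushoutI.of_apply_eq_base (incl D4 D6 D2 D2_le_D4 D2_le_D6) false x
  have hgen : i4.range ⊔ i6.range = ⊤ := by
    rw [eq_top_iff]
    intro g _
    have h4 : ∀ x, i4 x ∈ i4.range ⊔ i6.range := fun x => Subgroup.mem_sup_left ⟨x, rfl⟩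
    induction g using Monoid.PushoutI.induction_on with
    | of b x =>
      cases b
      · exact Subgroup.mem_sup_right ⟨x, rfl⟩
      · exact h4 x
    | base x => exact hb4 x ▸ h4 _
    | mul x y hx hy => exact mul_mem (hx trivial) (hy trivial)
  refine ⟨D2_le_D4, D2_le_D6, natCard_of_equiv_dihedralGroup D2_equiv, D2_equiv,
    natCard_of_equiv_dihedralGroup D4_equiv, D4_equiv,
    natCard_of_equiv_dihedralGroup D6_equiv, D6_equiv,
    injective_of_generated _ i4 i6 hf4 hf6 (fun x => (hb4 x).trans (hb6 x).symm) hgen, ?_⟩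
  rw [← MonoidHom.range_eq_top, eq_top_iff, ← D4_sup_D6, sup_le_iff]
  exact ⟨fun x hx => ⟨i4 ⟨x, hx⟩, hf4 _⟩, fun x hx => ⟨i6 ⟨x, hx⟩, hf6 _⟩⟩

end Statement1
end

section
/- Let SA = ℤ² ⋊ SL(2,ℤ) be the semidirect product for the natural (matrix-times-column-vector) action of SL(2,ℤ) on ℤ². Let S = !![0,-1;1,0] and R = !![0,-1;1,1] in SL(2,ℤ), and inside SA consider the subgroups p2 = ℤ² ⋊ ⟨-1⟩, p4 = ℤ² ⋊ ⟨S⟩ and p6 = ℤ² ⋊ ⟨R⟩ (i.e., the preimages in SA of the cyclic subgroups ⟨-1⟩, ⟨S⟩, ⟨R⟩ of SL(2,ℤ)). Then p2 = p4 ∩ p6, and the homomorphism from the amalgamated free product p4 ∗_{p2} p6 (the pushout of the subgroup inclusions p2 ↪ p4 and p2 ↪ p6) to SA induced by the inclusions p4 ↪ SA and p6 ↪ SA is an isomorphism. -/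
namespace Statement2

abbrev SL2Z := Matrix.SpecialLinearGroup (Fin 2) ℤ

/-- ℤ², written multiplicatively so that it can be used in `SemidirectProduct`. -/
abbrev Z2 := Multiplicative (Fin 2 → ℤ)

/-- A linear automorphism of ℤ² gives an automorphism of the (multiplicatively written)
group ℤ². -/
def linToMulAut : ((Fin 2 → ℤ) ≃ₗ[ℤ] (Fin 2 → ℤ)) →* MulAut Z2 where
  toFun e := AddEquiv.toMultiplicative e.toAddEquiv
  map_one' := by ext x; rfl
  map_mul' e f := by ext x; rfl

/-- The natural (matrix-times-column-vector) action of SL(2,ℤ) on ℤ². -/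
def φ : SL2Z →* MulAut Z2 :=
  linToMulAut.comp Matrix.SpecialLinearGroup.toLin'

/-- SA = ℤ² ⋊ SL(2,ℤ), the special affine group of ℤ². -/
abbrev SA := Z2 ⋊[φ] SL2Z

/-- S = [[0,-1],[1,0]] in SL(2,ℤ). -/
def S : SL2Z := ⟨!![0, -1; 1, 0], by decide⟩

/-- R = [[0,-1],[1,1]] in SL(2,ℤ). -/
def R : SL2Z := ⟨!![0, -1; 1, 1], by decide⟩

/-- p2 = ℤ² ⋊ ⟨-1⟩, the preimage in SA of the subgroup ⟨-1⟩ of SL(2,ℤ). -/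
def p2 : Subgroup SA := Subgroup.comap SemidirectProduct.rightHom (Subgroup.zpowers (-1))

/-- p4 = ℤ² ⋊ ⟨S⟩, the preimage in SA of the subgroup ⟨S⟩ of SL(2,ℤ). -/
def p4 : Subgroup SA := Subgroup.comap SemidirectProduct.rightHom (Subgroup.zpowers S)

/-- p6 = ℤ² ⋊ ⟨R⟩, the preimage in SA of the subgroup ⟨R⟩ of SL(2,ℤ). -/
def p6 : Subgroup SA := Subgroup.comap SemidirectProduct.rightHom (Subgroup.zpowers R)

/-- The pair of inclusion homomorphisms C ↪ A, C ↪ B, indexed by `Bool`. -/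
def incl {G : Type*} [Group G] (A B C : Subgroup G) (hA : C ≤ A) (hB : C ≤ B) :
    ∀ b : Bool, C →* ↥(bif b then A else B)
  | true => Subgroup.inclusion hA
  | false => Subgroup.inclusion hB

/-- The canonical homomorphism from the amalgamated free product A ∗_C B
(the pushout of the two subgroup inclusions) to the ambient group G,
induced by the inclusions A ↪ G and B ↪ G. -/
def amalgamHom {G : Type*} [Group G] (A B C : Subgroup G) (hA : C ≤ A) (hB : C ≤ B) :
    Monoid.PushoutI (incl A B C hA hB) →* G :=
  Monoid.PushoutI.lift (fun b => (bif b then A else B).subtype) C.subtype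
    (fun b => by cases b <;> rfl)

/-- `IsReduced φ i x` says that `x` is a nonempty product of elements of the factors, none of them
in the base group, with adjacent letters in different factors and first letter in factor `i`. -/
inductive IsReduced {ι H : Type*} {G : ι → Type*} [∀ i, Group (G i)] [Group H]
    (f : ∀ i, H →* G i) : ι → Monoid.PushoutI f → Prop
  | of {i : ι} {g : G i} (hg : g ∉ (f i).range) : IsReduced f i (Monoid.PushoutI.of i g)
  | cons {i j : ι} {g : G i} {x : Monoid.PushoutI f} (hg : g ∉ (f i).range) (hij : i ≠ j)
      (hx : IsReduced f j x) : IsReduced f i (Monoid.PushoutI.of i g * x)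

section Reduced

open Monoid.PushoutI

variable {ι H : Type*} {G : ι → Type*} [∀ i, Group (G i)] [Group H] {f : ∀ i, H →* G i}

theorem IsReduced.base_mul {i : ι} {x : Monoid.PushoutI f} (hx : IsReduced f i x) (h : H) :
    IsReduced f i (base f h * x) := by
  have key : ∀ {i : ι} {g : G i}, g ∉ (f i).range → f i h * g ∉ (f i).range := fun {i g} hg hg' =>
    hg (((f i).range.mul_mem_cancel_left ⟨h, rfl⟩).1 hg')
  cases hx with
  | of hg =>
    rw [← of_apply_eq_base f i, ← map_mul]
    exact .of (key hg)
  | cons hg hij hx =>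
    rw [← of_apply_eq_base f i, ← mul_assoc, ← map_mul]
    exact .cons (key hg) hij hx

theorem IsReduced.of_mul {i j : ι} {x : Monoid.PushoutI f} (hx : IsReduced f j x) (g : G i) :
    Monoid.PushoutI.of i g * x ∈ (base f).range ∨
      ∃ k, IsReduced f k (Monoid.PushoutI.of i g * x) := by
  by_cases hg : g ∈ (f i).range
  · obtain ⟨h, rfl⟩ := hg
    rw [of_apply_eq_base]
    exact .inr ⟨j, hx.base_mul h⟩
  by_cases hij : i = j
  · subst hij
    cases hx with
    | @of _ g' hg' =>
      rw [← map_mul]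
      by_cases hgg : g * g' ∈ (f i).range
      · obtain ⟨h, hh⟩ := hgg
        exact .inl ⟨h, by rw [← hh, of_apply_eq_base]⟩
      · exact .inr ⟨i, .of hgg⟩
    | @cons _ k g' y hg' hik hy =>
      rw [← mul_assoc, ← map_mul]
      by_cases hgg : g * g' ∈ (f i).range
      · obtain ⟨h, hh⟩ := hgg
        rw [← hh, of_apply_eq_base]
        exact .inr ⟨k, hy.base_mul h⟩
      · exact .inr ⟨i, .cons hgg hik hy⟩
  · exact .inr ⟨i, .cons hg hij hx⟩

/-- Every element of an amalgamated product lies in the base group or is a reduced product. -/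
theorem mem_range_base_or_isReduced (x : Monoid.PushoutI f) :
    x ∈ (base f).range ∨ ∃ i, IsReduced f i x := by
  suffices ∀ x y : Monoid.PushoutI f, (y ∈ (base f).range ∨ ∃ i, IsReduced f i y) →
      (x * y ∈ (base f).range ∨ ∃ i, IsReduced f i (x * y)) by
    simpa using this x 1 (.inl (one_mem _))
  intro x
  induction x using Monoid.PushoutI.induction_on with
  | of i g =>
    rintro y (⟨h, rfl⟩ | ⟨j, hy⟩)
    · rw [← of_apply_eq_base f i, ← map_mul]
      by_cases hg : g * f i h ∈ (f i).range
      · obtain ⟨h', hh⟩ := hg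
        exact .inl ⟨h', by rw [← hh, of_apply_eq_base]⟩
      · exact .inr ⟨i, .of hg⟩
    · exact hy.of_mul g
  | base h =>
    rintro y (hy | ⟨j, hy⟩)
    · exact .inl (mul_mem ⟨h, rfl⟩ hy)
    · exact .inr ⟨j, hy.base_mul h⟩
  | mul x y hx hy =>
    intro z hz
    rw [mul_assoc]
    exact hx _ (hy _ hz)

end Reduced

theorem S_sq : S ^ 2 = -1 := by decide

theorem S_pow_four : S ^ 4 = 1 := by decide

theorem R_cube : R ^ 3 = -1 := by decide

theorem R_pow_six : R ^ 6 = 1 := by decide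

theorem mem_zpowers_S {g : SL2Z} (hg : g ∈ Subgroup.zpowers S) :
    g ∈ Subgroup.zpowers (-1 : SL2Z) ∨ g = S ∨ g = -S := by
  obtain ⟨n, rfl⟩ := hg
  have h1 : (1 : SL2Z) ∈ Subgroup.zpowers (-1 : SL2Z) := one_mem _
  have h2 : (-1 : SL2Z) ∈ Subgroup.zpowers (-1 : SL2Z) := Subgroup.mem_zpowers _
  have h := zpow_eq_zpow_emod' n S_pow_four
  have h0 := Int.emod_nonneg n (show ((4 : ℕ) : ℤ) ≠ 0 by norm_num)
  have h4 := Int.emod_lt_of_pos n (show (0 : ℤ) < (4 : ℕ) by norm_num)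
  simp only [h]
  generalize n % ((4 : ℕ) : ℤ) = m at *
  push_cast at h4
  interval_cases m
  · exact .inl (by simp)
  · exact .inr (.inl (zpow_one _))
  · exact .inl (by rw [show S ^ (2 : ℤ) = -1 by decide]; exact h2)
  · exact .inr (.inr (by decide))

theorem mem_zpowers_R {g : SL2Z} (hg : g ∈ Subgroup.zpowers R) :
    g ∈ Subgroup.zpowers (-1 : SL2Z) ∨ g = R ∨ g = -R ∨ g = R ^ 2 ∨ g = -R ^ 2 := by
  obtain ⟨n, rfl⟩ := hg
  have h2 : (-1 : SL2Z) ∈ Subgroup.zpowers (-1 : SL2Z) := Subgroup.mem_zpowers _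
  have h := zpow_eq_zpow_emod' n R_pow_six
  have h0 := Int.emod_nonneg n (show ((6 : ℕ) : ℤ) ≠ 0 by norm_num)
  have h4 := Int.emod_lt_of_pos n (show (0 : ℤ) < (6 : ℕ) by norm_num)
  simp only [h]
  generalize n % ((6 : ℕ) : ℤ) = m at *
  push_cast at h4
  interval_cases m
  · exact .inl (by simp)
  · exact .inr (.inl (zpow_one _))
  · exact .inr (.inr (.inr (.inl (by decide))))
  · exact .inl (by rw [show R ^ (3 : ℤ) = -1 by decide]; exact h2)
  · exact .inr (.inr (.inl (by decide)))
  · exact .inr (.inr (.inr (.inr (by decide))))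

theorem p2_le_p4 : p2 ≤ p4 :=
  Subgroup.comap_mono ((Subgroup.zpowers_le).2 ⟨2, S_sq⟩)

theorem p2_le_p6 : p2 ≤ p6 :=
  Subgroup.comap_mono ((Subgroup.zpowers_le).2 ⟨3, R_cube⟩)

theorem right_of_mem_p4 {g : SA} (hg : g ∈ p4) (hg2 : g ∉ p2) : g.right = S ∨ g.right = -S :=
  (mem_zpowers_S hg).resolve_left hg2

theorem right_of_mem_p6 {g : SA} (hg : g ∈ p6) (hg2 : g ∉ p2) :
    g.right = R ∨ g.right = -R ∨ g.right = R ^ 2 ∨ g.right = -R ^ 2 :=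
  (mem_zpowers_R hg).resolve_left hg2

theorem p2_eq_inf : p2 = p4 ⊓ p6 := by
  refine le_antisymm (le_inf p2_le_p4 p2_le_p6) fun g hg => ?_
  by_contra h
  rcases right_of_mem_p4 hg.1 h with h4 | h4 <;>
  rcases right_of_mem_p6 hg.2 h with h6 | h6 | h6 | h6 <;>
  · rw [h4] at h6
    revert h6
    decide

/-- The linear part of an element of the amalgam, as an element of `SL(2,ℤ)`. -/
def linearPart : Monoid.PushoutI (incl p4 p6 p2 p2_le_p4 p2_le_p6) →* SL2Z :=
  SemidirectProduct.rightHom.comp (amalgamHom p4 p6 p2 p2_le_p4 p2_le_p6)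

theorem S_mulVec (v : Fin 2 → ℤ) : S.1.mulVec v = ![-v 1, v 0] := by
  ext i; fin_cases i <;> simp [S, Matrix.mulVec, dotProduct, Fin.sum_univ_two]

theorem R_mulVec (v : Fin 2 → ℤ) : R.1.mulVec v = ![-v 1, v 0 + v 1] := by
  ext i; fin_cases i <;> simp [R, Matrix.mulVec, dotProduct, Fin.sum_univ_two]

theorem linearPart_of_true (g : p4) (hg : (g : SA) ∉ p2) (v : Fin 2 → ℤ) :
    (linearPart (Monoid.PushoutI.of true g)).1.mulVec v = ![-v 1, v 0] ∨
    (linearPart (Monoid.PushoutI.of true g)).1.mulVec v = ![v 1, -v 0] := by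
  have : linearPart (Monoid.PushoutI.of true g) = (g : SA).right := rfl
  rw [this]
  rcases right_of_mem_p4 g.2 hg with h | h <;> rw [h]
  · exact .inl (S_mulVec v)
  · right
    rw [Matrix.SpecialLinearGroup.coe_neg, Matrix.neg_mulVec, S_mulVec]
    simp

theorem linearPart_of_false (g : p6) (hg : (g : SA) ∉ p2) (v : Fin 2 → ℤ) :
    ∃ w : Fin 2 → ℤ, (w = ![-v 1, v 0 + v 1] ∨ w = ![-(v 0 + v 1), v 0]) ∧
    ((linearPart (Monoid.PushoutI.of false g)).1.mulVec v = w ∨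
     (linearPart (Monoid.PushoutI.of false g)).1.mulVec v = -w) := by
  have : linearPart (Monoid.PushoutI.of false g) = (g : SA).right := rfl
  rw [this]
  have hsq : (R ^ 2).1.mulVec v = ![-(v 0 + v 1), v 0] := by
    rw [sq, Matrix.SpecialLinearGroup.coe_mul, ← Matrix.mulVec_mulVec, R_mulVec, R_mulVec]
    simp
  rcases right_of_mem_p6 g.2 hg with h | h | h | h <;> rw [h]
  · exact ⟨_, .inl rfl, .inl (R_mulVec v)⟩
  · refine ⟨_, .inl rfl, .inr ?_⟩
    rw [Matrix.SpecialLinearGroup.coe_neg, Matrix.neg_mulVec, R_mulVec]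
  · exact ⟨_, .inr rfl, .inl hsq⟩
  · refine ⟨_, .inr rfl, .inr ?_⟩
    rw [Matrix.SpecialLinearGroup.coe_neg, Matrix.neg_mulVec, hsq]

theorem notMem_p2_of_notMem_range {A B C : Subgroup SA} {hA : C ≤ A} {hB : C ≤ B} {b : Bool}
    {g : ↥(bif b then A else B)} (hg : g ∉ (incl A B C hA hB b).range) : (g : SA) ∉ C := by
  intro h
  refine hg ⟨⟨g, h⟩, ?_⟩
  cases b <;> rfl

theorem pingpong_step {v w w' : Fin 2 → ℤ} (hv : 0 < v 0 * v 1)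
    (hw : w = ![-v 1, v 0 + v 1] ∨ w = ![-(v 0 + v 1), v 0]) (hw' : w' = w ∨ w' = -w) :
    w' 0 * w' 1 < 0 ∧ 2 < |w' 0| + |w' 1| := by
  have key : w 0 * w 1 < 0 ∧ 2 < |w 0| + |w 1| := by
    rcases pos_and_pos_or_neg_and_neg_of_mul_pos hv with ⟨h0, h1⟩ | ⟨h0, h1⟩ <;>
    rcases hw with rfl | rfl <;>
    simp only [Matrix.cons_val_zero, Matrix.cons_val_one] <;>
    constructor <;> first | nlinarith | grind
  rcases hw' with rfl | rfl
  · exact key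
  · simpa using key

/-- Ping-pong for the linear action on `ℤ²`: the players are the open quadrants with `0 < x * y`
and with `x * y < 0`. The norm `|x| + |y|` is preserved by `p4 \ p2` and is strictly increased
by the elements of `p6 \ p2` on the first player. -/
theorem IsReduced.exists_mulVec {b : Bool}
    {x : Monoid.PushoutI (incl p4 p6 p2 p2_le_p4 p2_le_p6)}
    (hx : IsReduced (incl p4 p6 p2 p2_le_p4 p2_le_p6) b x) :
    ∃ v w : Fin 2 → ℤ, |v 0| + |v 1| = 2 ∧ (linearPart x).1.mulVec v = w ∧
      (b = true → 0 < w 0 * w 1 ∧ (v 0 * v 1 < 0 ∨ 2 < |w 0| + |w 1|)) ∧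
      (b = false → w 0 * w 1 < 0 ∧ 2 < |w 0| + |w 1|) := by
  induction hx with
  | @of b g hg =>
    have hg := notMem_p2_of_notMem_range hg
    cases b
    · obtain ⟨w, hw, hgw⟩ := linearPart_of_false g hg ![1, 1]
      exact ⟨![1, 1], _, by simp, rfl, by simp, fun _ => pingpong_step (by simp) hw hgw⟩
    · refine ⟨![1, -1], _, by simp, rfl, fun _ => ?_, by simp⟩
      rcases linearPart_of_true g hg ![1, -1] with h | h <;> simp [h]
  | @cons b c g x hg hbc _ ih =>
    have hg := notMem_p2_of_notMem_range hg
    obtain ⟨v, w, hv, hw, ht, hf⟩ := ih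
    refine ⟨v, _, hv, rfl, ?_⟩
    rw [map_mul, Matrix.SpecialLinearGroup.coe_mul, ← Matrix.mulVec_mulVec, hw]
    cases b
    · obtain ⟨w', hw', hgw⟩ := linearPart_of_false g hg w
      have hc : c = true := by simpa using hbc.symm
      exact ⟨by simp, fun _ => pingpong_step (ht hc).1 hw' hgw⟩
    · have hc : c = false := by simpa using hbc.symm
      obtain ⟨h1, h2⟩ := hf hc
      refine ⟨fun _ => ?_, by simp⟩
      rcases linearPart_of_true g hg w with h | h <;> rw [h] <;>
      simp only [Matrix.cons_val_zero, Matrix.cons_val_one, abs_neg] <;>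
      exact ⟨by linarith, .inr (by linarith)⟩

theorem amalgamHom_injective :
    Function.Injective (amalgamHom p4 p6 p2 p2_le_p4 p2_le_p6) := by
  rw [injective_iff_map_eq_one]
  intro x hx
  rcases mem_range_base_or_isReduced x with ⟨c, rfl⟩ | ⟨b, hb⟩
  · have : (c : SA) = 1 := by simpa [amalgamHom] using hx
    rw [Subtype.ext (a2 := (1 : p2)) this, map_one]
  · exfalso
    obtain ⟨v, w, hv, hw, ht, hf⟩ := hb.exists_mulVec
    have h1 : linearPart x = 1 := by simp [linearPart, hx]
    rw [h1, Matrix.SpecialLinearGroup.coe_one, Matrix.one_mulVec] at hw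
    subst hw
    cases b
    · have := (hf rfl).2
      omega
    · obtain ⟨h, h' | h'⟩ := ht rfl <;> omega

theorem amalgamHom_surjective :
    Function.Surjective (amalgamHom p4 p6 p2 p2_le_p4 p2_le_p6) := by
  rw [← MonoidHom.range_eq_top, eq_top_iff]
  set K := (amalgamHom p4 p6 p2 p2_le_p4 p2_le_p6).range
  have h4 : p4 ≤ K := fun g hg =>
    ⟨Monoid.PushoutI.of true ⟨g, hg⟩, by simp [amalgamHom]⟩
  have h6 : p6 ≤ K := fun g hg =>
    ⟨Monoid.PushoutI.of false ⟨g, hg⟩, by simp [amalgamHom]⟩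
  have hS : SemidirectProduct.inr S ∈ K := h4 (Subgroup.mem_zpowers S)
  have hR : SemidirectProduct.inr R ∈ K := h6 (Subgroup.mem_zpowers R)
  have hSL : K.comap SemidirectProduct.inr = ⊤ := by
    rw [eq_top_iff, ← SpecialLinearGroup.SL2Z_generators, Subgroup.closure_le]
    rintro _ (rfl | rfl)
    · exact hS
    · rw [show ModularGroup.T = S * S * S * R by decide]
      simp only [SetLike.mem_coe, Subgroup.mem_comap, map_mul]
      exact mul_mem (mul_mem (mul_mem hS hS) hS) hR
  intro g _
  rw [← SemidirectProduct.inl_left_mul_inr_right g]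
  refine mul_mem (h4 (one_mem (Subgroup.zpowers S))) ?_
  exact hSL.ge (Subgroup.mem_top g.right)

theorem statement2 :
    p2 = p4 ⊓ p6 ∧
    ∃ (h4 : p2 ≤ p4) (h6 : p2 ≤ p6),
      Function.Bijective (amalgamHom p4 p6 p2 h4 h6) := by
  exact ⟨p2_eq_inf, p2_le_p4, p2_le_p6, amalgamHom_injective, amalgamHom_surjective⟩

end Statement2
end

section
/- Let GA = ℤ² ⋊ GL(2,ℤ) be the semidirect product for the natural action of GL(2,ℤ) on ℤ². Let σ = !![0,1;1,0], and let D₄, D₆, D₂ be the subgroups of GL(2,ℤ) generated respectively by {!![0,1;-1,0], σ}, {!![0,1;-1,1], σ}, and {-1, σ}. Inside GA consider the subgroups cmm = ℤ² ⋊ D₂, p4m = ℤ² ⋊ D₄ and p6m = ℤ² ⋊ D₆ (the preimages in GA of D₂, D₄, D₆). Then the homomorphism from the amalgamated free product p4m ∗_{cmm} p6m (the pushout of the subgroup inclusions cmm ↪ p4m and cmm ↪ p6m) to GA induced by the inclusions p4m ↪ GA and p6m ↪ GA is an isomorphism. -/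
namespace Statement3

abbrev GL2Z := GL (Fin 2) ℤ

/-- ℤ², written multiplicatively so that it can be used in `SemidirectProduct`. -/
abbrev Z2 := Multiplicative (Fin 2 → ℤ)

/-- A linear automorphism of ℤ² gives an automorphism of the (multiplicatively written)
group ℤ². -/
def linToMulAut : ((Fin 2 → ℤ) ≃ₗ[ℤ] (Fin 2 → ℤ)) →* MulAut Z2 where
  toFun e := AddEquiv.toMultiplicative e.toAddEquiv
  map_one' := by ext x; rfl
  map_mul' e f := by ext x; rfl

/-- The natural (matrix-times-column-vector) action of GL(2,ℤ) on ℤ². -/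
def φ : GL2Z →* MulAut Z2 :=
  linToMulAut.comp
    (((LinearMap.GeneralLinearGroup.generalLinearEquiv ℤ (Fin 2 → ℤ)).toMonoidHom).comp
      (Matrix.GeneralLinearGroup.toLin : GL2Z ≃* _).toMonoidHom)

/-- GA = ℤ² ⋊ GL(2,ℤ), the general affine group of ℤ². -/
abbrev GA := Z2 ⋊[φ] GL2Z

/-- σ = [[0,1],[1,0]] in GL(2,ℤ). -/
def σ : GL2Z := ⟨!![0, 1; 1, 0], !![0, 1; 1, 0], by decide, by decide⟩

/-- The rotation of order 4, [[0,1],[-1,0]]. -/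
def r4 : GL2Z := ⟨!![0, 1; -1, 0], !![0, -1; 1, 0], by decide, by decide⟩

/-- The rotation of order 6, [[0,1],[-1,1]]. -/
def r6 : GL2Z := ⟨!![0, 1; -1, 1], !![1, -1; 1, 0], by decide, by decide⟩

/-- D₄ ≤ GL(2,ℤ), the subgroup generated by [[0,1],[-1,0]] and σ. -/
def D4 : Subgroup GL2Z := Subgroup.closure {r4, σ}

/-- D₆ ≤ GL(2,ℤ), the subgroup generated by [[0,1],[-1,1]] and σ. -/
def D6 : Subgroup GL2Z := Subgroup.closure {r6, σ}

/-- D₂ ≤ GL(2,ℤ), the subgroup generated by -1 and σ. -/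
def D2 : Subgroup GL2Z := Subgroup.closure {-1, σ}

/-- cmm = ℤ² ⋊ D₂, the preimage in GA of D₂. -/
def cmm : Subgroup GA := Subgroup.comap SemidirectProduct.rightHom D2

/-- p4m = ℤ² ⋊ D₄, the preimage in GA of D₄. -/
def p4m : Subgroup GA := Subgroup.comap SemidirectProduct.rightHom D4

/-- p6m = ℤ² ⋊ D₆, the preimage in GA of D₆. -/
def p6m : Subgroup GA := Subgroup.comap SemidirectProduct.rightHom D6

/-- The pair of inclusion homomorphisms C ↪ A, C ↪ B, indexed by `Bool`. -/
def incl {G : Type*} [Group G] (A B C : Subgroup G) (hA : C ≤ A) (hB : C ≤ B) :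
    ∀ b : Bool, C →* ↥(bif b then A else B)
  | true => Subgroup.inclusion hA
  | false => Subgroup.inclusion hB

/-- The canonical homomorphism from the amalgamated free product A ∗_C B
(the pushout of the two subgroup inclusions) to the ambient group G,
induced by the inclusions A ↪ G and B ↪ G. -/
def amalgamHom {G : Type*} [Group G] (A B C : Subgroup G) (hA : C ≤ A) (hB : C ≤ B) :
    Monoid.PushoutI (incl A B C hA hB) →* G :=
  Monoid.PushoutI.lift (fun b => (bif b then A else B).subtype) C.subtype
    (fun b => by cases b <;> rfl)

open Monoid PushoutI in
/-- A ping-pong criterion: if elements of each factor outside the amalgamated subgroup exchange two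
nonempty sets while strictly increasing a function `m` that the amalgamated subgroup leaves
invariant, then the amalgamated product embeds in the ambient group. -/
theorem amalgamHom_injective_of_pingPong {G Ω α : Type*} [Group G] [Preorder α]
    (A B C : Subgroup G) (hA : C ≤ A) (hB : C ≤ B) (ρ : G →* Equiv.Perm Ω) (m : Ω → α)
    (S : Bool → Set Ω) (hS : ∀ b, (S b).Nonempty) (hC : ∀ c ∈ C, ∀ v, m (ρ c v) = m v)
    (hAB : ∀ b, ∀ a ∈ (bif b then A else B), a ∉ C → ∀ v ∈ S b,
      ρ a v ∈ S (!b) ∧ m v < m (ρ a v)) :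
    Function.Injective (amalgamHom A B C hA hB) := by
  have hinj : ∀ b, Function.Injective (incl A B C hA hB b) := by
    intro b
    cases b
    · exact Subgroup.inclusion_injective hB
    · exact Subgroup.inclusion_injective hA
  have hrange : ∀ b (g : ↥(bif b then A else B)), (g : G) ∈ C →
      g ∈ (incl A B C hA hB b).range := by
    intro b g hg
    cases b
    · exact ⟨⟨g, hg⟩, rfl⟩
    · exact ⟨⟨g, hg⟩, rfl⟩
  have key : ∀ w : CoprodI.Word (fun b : Bool => ↥(bif b then A else B)),
      Reduced (incl A B C hA hB) w → w = .empty ∨ ∃ b v, w.fstIdx = some b ∧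
        ρ (amalgamHom A B C hA hB (ofCoprodI w.prod)) v ∈ S (!b) ∧
        m v < m (ρ (amalgamHom A B C hA hB (ofCoprodI w.prod)) v) := by
    intro w
    induction w using CoprodI.Word.consRecOn with
    | empty => exact fun _ => Or.inl rfl
    | cons b g w hidx hg ih =>
      intro hred
      have hgC : (g : G) ∉ C := fun h =>
        hred ⟨b, g⟩ List.mem_cons_self (hrange b g h)
      have hof : amalgamHom A B C hA hB (of b g) = (g : G) := by
        simp [amalgamHom]
      right
      rcases ih (fun x hx => hred x (List.mem_cons_of_mem _ hx)) with rfl | ⟨b', v, hb', hv, hm⟩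
      · obtain ⟨v, hv⟩ := hS b
        obtain ⟨h1, h2⟩ := hAB b g g.2 hgC v hv
        refine ⟨b, v, by simp [CoprodI.Word.fstIdx, CoprodI.Word.cons], ?_⟩
        simpa [hof] using And.intro h1 h2
      · have hbb : (!b') = b := by
          rw [hb'] at hidx
          revert hidx
          cases b <;> cases b' <;> simp
        rw [hbb] at hv
        obtain ⟨h1, h2⟩ := hAB b g g.2 hgC _ hv
        refine ⟨b, v, by simp [CoprodI.Word.fstIdx, CoprodI.Word.cons], ?_⟩
        simpa [hof] using And.intro h1 (hm.trans h2)
  rw [injective_iff_map_eq_one]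
  intro x hx
  classical
  obtain ⟨d⟩ := NormalWord.transversal_nonempty _ hinj
  obtain ⟨w, rfl⟩ := (NormalWord.equiv (d := d)).symm.surjective x
  change amalgamHom A B C hA hB w.prod = 1 at hx
  change w.prod = 1
  have hbase : amalgamHom A B C hA hB (base _ w.head) = (w.head : G) := by
    simp [amalgamHom]
  have hred : Reduced (incl A B C hA hB) w.toWord := by
    rintro ⟨b, g⟩ hg hgr
    refine w.ne_one _ hg ?_
    have h1 := (Subgroup.IsComplement.equiv_snd_eq_self_iff_mem (d.compl b) (one_mem _)).2
      (w.normalized b g hg)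
    rw [← h1]
    exact (Subgroup.IsComplement.coe_equiv_snd_eq_one_iff_mem (d.compl b) (d.one_mem b)).2 hgr
  rw [NormalWord.prod, map_mul, hbase] at hx
  rcases key _ hred with he | ⟨b, v, -, -, hm⟩
  · rw [he] at hx
    simp only [CoprodI.Word.prod_empty, map_one, mul_one, OneMemClass.coe_eq_one] at hx
    simp [NormalWord.prod, he, hx]
  · rw [eq_inv_of_mul_eq_one_right hx, hC _ (C.inv_mem w.head.2)] at hm
    exact absurd hm (lt_irrefl _)

theorem le_range_amalgamHom_left {G : Type*} [Group G] (A B C : Subgroup G) (hA : C ≤ A)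
    (hB : C ≤ B) : A ≤ (amalgamHom A B C hA hB).range := fun a ha =>
  ⟨Monoid.PushoutI.of (φ := incl A B C hA hB) true ⟨a, ha⟩, by simp [amalgamHom]⟩

theorem le_range_amalgamHom_right {G : Type*} [Group G] (A B C : Subgroup G) (hA : C ≤ A)
    (hB : C ≤ B) : B ≤ (amalgamHom A B C hA hB).range := fun b hb =>
  ⟨Monoid.PushoutI.of (φ := incl A B C hA hB) false ⟨b, hb⟩, by simp [amalgamHom]⟩

theorem neg_one_mem_D2 : (-1 : GL2Z) ∈ D2 := Subgroup.subset_closure (by simp)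

theorem σ_mem_D2 : σ ∈ D2 := Subgroup.subset_closure (by simp)

theorem r4_mem_D4 : r4 ∈ D4 := Subgroup.subset_closure (by simp)

theorem r6_mem_D6 : r6 ∈ D6 := Subgroup.subset_closure (by simp)

theorem D2_le_D4 : D2 ≤ D4 := by
  rw [D2, Subgroup.closure_le]
  rintro x (rfl | rfl)
  · have h : (-1 : GL2Z) = r4 * r4 := by decide
    rw [h]
    exact D4.mul_mem r4_mem_D4 r4_mem_D4
  · exact Subgroup.subset_closure (by simp)

theorem D2_le_D6 : D2 ≤ D6 := by
  rw [D2, Subgroup.closure_le]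
  rintro x (rfl | rfl)
  · have h : (-1 : GL2Z) = r6 * r6 * r6 := by decide
    rw [h]
    exact D6.mul_mem (D6.mul_mem r6_mem_D6 r6_mem_D6) r6_mem_D6
  · exact Subgroup.subset_closure (by simp)

theorem mem_D2_or_of_mem_D4 {g : GL2Z} (hg : g ∈ D4) : g ∈ D2 ∨ ∃ c ∈ D2, g = r4 * c := by
  have hσ := σ_mem_D2
  have hn := neg_one_mem_D2
  induction hg using Subgroup.closure_induction_left with
  | one => exact Or.inl D2.one_mem
  | mul_left x hx y hy ih =>
    rcases hx with rfl | rfl <;> rcases ih with h | ⟨c, hc, rfl⟩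
    · exact Or.inr ⟨y, h, rfl⟩
    · have e : r4 * (r4 * c) = -1 * c := by
        rw [← mul_assoc]; congr 1; decide
      exact Or.inl (e ▸ D2.mul_mem hn hc)
    · exact Or.inl (D2.mul_mem hσ h)
    · have e : σ * (r4 * c) = r4 * (-1 * (σ * c)) := by
        simp only [← mul_assoc]; congr 1; decide
      exact Or.inr ⟨_, D2.mul_mem hn (D2.mul_mem hσ hc), e⟩
  | inv_mul_cancel x hx y hy ih =>
    rcases hx with rfl | rfl <;> rcases ih with h | ⟨c, hc, rfl⟩
    · have e : r4⁻¹ * y = r4 * (-1 * y) := by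
        simp only [← mul_assoc]; congr 1; decide
      exact Or.inr ⟨_, D2.mul_mem hn h, e⟩
    · exact Or.inl (by simpa using hc)
    · exact Or.inl (D2.mul_mem (D2.inv_mem hσ) h)
    · have e : σ⁻¹ * (r4 * c) = r4 * (-1 * (σ * c)) := by
        simp only [← mul_assoc]; congr 1; decide
      exact Or.inr ⟨_, D2.mul_mem hn (D2.mul_mem hσ hc), e⟩

theorem mem_D2_or_of_mem_D6 {g : GL2Z} (hg : g ∈ D6) :
    g ∈ D2 ∨ ∃ c ∈ D2, g = r6 * c ∨ g = r6⁻¹ * c := by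
  have hσ := σ_mem_D2
  have hn := neg_one_mem_D2
  have e1 : r6 * r6 = r6⁻¹ * -1 := by decide
  have e2 : r6⁻¹ * r6⁻¹ = r6 * -1 := by decide
  have e3 : σ * r6 = r6⁻¹ * σ := by decide
  have e4 : σ * r6⁻¹ = r6 * σ := by decide
  have e5 : σ⁻¹ = σ := by decide
  induction hg using Subgroup.closure_induction_left with
  | one => exact Or.inl D2.one_mem
  | mul_left x hx y hy ih =>
    rcases hx with rfl | rfl <;> rcases ih with h | ⟨c, hc, rfl | rfl⟩
    · exact Or.inr ⟨y, h, Or.inl rfl⟩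
    · exact Or.inr ⟨_, D2.mul_mem hn hc, Or.inr (by rw [← mul_assoc, e1, mul_assoc])⟩
    · exact Or.inl (by simpa using hc)
    · exact Or.inl (D2.mul_mem hσ h)
    · exact Or.inr ⟨_, D2.mul_mem hσ hc, Or.inr (by rw [← mul_assoc, e3, mul_assoc])⟩
    · exact Or.inr ⟨_, D2.mul_mem hσ hc, Or.inl (by rw [← mul_assoc, e4, mul_assoc])⟩
  | inv_mul_cancel x hx y hy ih =>
    rcases hx with rfl | rfl <;> rcases ih with h | ⟨c, hc, rfl | rfl⟩
    · exact Or.inr ⟨y, h, Or.inr rfl⟩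
    · exact Or.inl (by simpa using hc)
    · exact Or.inr ⟨_, D2.mul_mem hn hc, Or.inl (by rw [← mul_assoc, e2, mul_assoc])⟩
    · exact Or.inl (D2.mul_mem (D2.inv_mem hσ) h)
    · exact Or.inr ⟨_, D2.mul_mem hσ hc, Or.inr (by rw [e5, ← mul_assoc, e3, mul_assoc])⟩
    · exact Or.inr ⟨_, D2.mul_mem hσ hc, Or.inl (by rw [e5, ← mul_assoc, e4, mul_assoc])⟩

open Matrix.SpecialLinearGroup in
theorem D4_sup_D6 : D4 ⊔ D6 = ⊤ := by
  have hr4 : r4 ∈ D4 ⊔ D6 := Subgroup.mem_sup_left r4_mem_D4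
  have hr6 : r6 ∈ D4 ⊔ D6 := Subgroup.mem_sup_right r6_mem_D6
  have hσ : σ ∈ D4 ⊔ D6 := Subgroup.mem_sup_left (D2_le_D4 σ_mem_D2)
  have hSL : (D4 ⊔ D6).comap (toGL (n := Fin 2) (R := ℤ)) = ⊤ := by
    rw [eq_top_iff, ← SpecialLinearGroup.SL2Z_generators, Subgroup.closure_le]
    rintro x (rfl | rfl)
    · have h : toGL ModularGroup.S = r4⁻¹ := by decide
      simpa [h] using hr4
    · have h : toGL ModularGroup.T = r6⁻¹ * r4 := by decide
      simpa [h] using (D4 ⊔ D6).mul_mem ((D4 ⊔ D6).inv_mem hr6) hr4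
  have hdet : ∀ g : GL2Z, g.1.det = 1 → g ∈ D4 ⊔ D6 := by
    intro g hg
    let A : Matrix.SpecialLinearGroup (Fin 2) ℤ := ⟨g.1, hg⟩
    have h : A ∈ (D4 ⊔ D6).comap toGL := hSL ▸ Subgroup.mem_top _
    have e : toGL A = g := Units.ext rfl
    rwa [Subgroup.mem_comap, e] at h
  rw [eq_top_iff]
  intro g _
  rcases Int.isUnit_iff.1 ((Matrix.isUnit_iff_isUnit_det _).1 g.isUnit) with h | h
  · exact hdet g h
  · have hσg : σ * g ∈ D4 ⊔ D6 := hdet _ (by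
      rw [Units.val_mul, Matrix.det_mul, h]
      simp [σ, Matrix.det_fin_two])
    simpa using (D4 ⊔ D6).mul_mem ((D4 ⊔ D6).inv_mem hσ) hσg

theorem toAdd_φ_apply (g : GL2Z) (v : Z2) (i : Fin 2) :
    (φ g v).toAdd i = g.1 i 0 * v.toAdd 0 + g.1 i 1 * v.toAdd 1 := by
  change g.1.mulVec v.toAdd i = _
  simp [Matrix.mulVec, dotProduct]

/-- The product of the two coordinates of a vector. -/
def coordMul (v : Z2) : ℤ := v.toAdd 0 * v.toAdd 1

/-- A positive definite quadratic form invariant under `D2`. -/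
def height (v : Z2) : ℤ := 2 * (v.toAdd 0 ^ 2 + v.toAdd 1 ^ 2) - v.toAdd 0 * v.toAdd 1

theorem coordMul_and_height_of_mem_D2 {c : GL2Z} (hc : c ∈ D2) :
    ∀ v, coordMul (φ c v) = coordMul v ∧ height (φ c v) = height v := by
  induction hc using Subgroup.closure_induction with
  | mem x hx =>
    intro v
    rcases hx with rfl | rfl
    · constructor <;> simp [toAdd_φ_apply, coordMul, height]
    · constructor <;> simp [toAdd_φ_apply, coordMul, height, σ] <;> ring
  | one => simp
  | mul x y _ _ hx hy => intro v; simp [hx, hy]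
  | inv x _ hx =>
    intro v
    have h := hx (φ x⁻¹ v)
    simp only [map_inv, MulAut.apply_inv_self] at h ⊢
    exact ⟨h.1.symm, h.2.symm⟩

theorem r4_pingPong {v : Z2} (hv : 0 < coordMul v) :
    coordMul (φ r4 v) < 0 ∧ height v < height (φ r4 v) := by
  simp only [coordMul, height, toAdd_φ_apply, r4] at *
  simp
  constructor <;> nlinarith

theorem r6_pingPong {v : Z2} (hv : coordMul v < 0) :
    0 < coordMul (φ r6 v) ∧ height v < height (φ r6 v) := by
  simp only [coordMul, height, toAdd_φ_apply, r6] at *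
  simp
  constructor <;> nlinarith [sq_nonneg (v.toAdd 1)]

theorem r6_inv_pingPong {v : Z2} (hv : coordMul v < 0) :
    0 < coordMul (φ r6⁻¹ v) ∧ height v < height (φ r6⁻¹ v) := by
  have h : r6⁻¹.1 = !![1, -1; 1, 0] := rfl
  simp only [coordMul, height, toAdd_φ_apply, h] at *
  simp
  constructor <;> nlinarith [sq_nonneg (v.toAdd 0)]

theorem statement3 :
    ∃ (h4 : cmm ≤ p4m) (h6 : cmm ≤ p6m),
      Function.Bijective (amalgamHom p4m p6m cmm h4 h6) := by
  refine ⟨Subgroup.comap_mono D2_le_D4, Subgroup.comap_mono D2_le_D6, ?_, ?_⟩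
  · refine amalgamHom_injective_of_pingPong _ _ _ _ _
      ((MulAut.toPerm Z2).comp (φ.comp SemidirectProduct.rightHom)) height
      (fun b => {v | bif b then 0 < coordMul v else coordMul v < 0}) ?_ ?_ ?_
    · rintro (_ | _)
      · exact ⟨Multiplicative.ofAdd ![1, -1], by simp [coordMul]⟩
      · exact ⟨Multiplicative.ofAdd ![1, 1], by simp [coordMul]⟩
    · exact fun c hc v => (coordMul_and_height_of_mem_D2 hc v).2
    · rintro (_ | _) a ha haC v hv
      · change coordMul v < 0 at hv
        change 0 < coordMul (φ a.right v) ∧ height v < height (φ a.right v)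
        rcases mem_D2_or_of_mem_D6 (show a.right ∈ D6 from ha) with h | ⟨c, hc, h⟩
        · exact absurd h haC
        · obtain ⟨h1, h2⟩ := coordMul_and_height_of_mem_D2 hc v
          rw [← h1] at hv
          rw [← h2]
          rcases h with h | h <;> rw [h, map_mul, MulAut.mul_apply]
          · exact r6_pingPong hv
          · exact r6_inv_pingPong hv
      · change 0 < coordMul v at hv
        change coordMul (φ a.right v) < 0 ∧ height v < height (φ a.right v)
        rcases mem_D2_or_of_mem_D4 (show a.right ∈ D4 from ha) with h | ⟨c, hc, h⟩
        · exact absurd h haC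
        · obtain ⟨h1, h2⟩ := coordMul_and_height_of_mem_D2 hc v
          rw [← h1] at hv
          rw [← h2, h, map_mul, MulAut.mul_apply]
          exact r4_pingPong hv
  · rw [← MonoidHom.range_eq_top, eq_top_iff]
    intro x _
    set R := (amalgamHom p4m p6m cmm (Subgroup.comap_mono D2_le_D4)
      (Subgroup.comap_mono D2_le_D6)).range
    have h4 : p4m ≤ R := le_range_amalgamHom_left ..
    have h6 : p6m ≤ R := le_range_amalgamHom_right ..
    have hR : R.comap SemidirectProduct.inr = ⊤ := by
      rw [eq_top_iff, ← D4_sup_D6]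
      exact sup_le (fun g hg => h4 (by simpa [p4m] using hg))
        (fun g hg => h6 (by simpa [p6m] using hg))
    rw [← SemidirectProduct.inl_left_mul_inr_right x]
    refine R.mul_mem (h4 ?_) ?_
    · simp [p4m]
    · exact Subgroup.mem_comap.1 (hR ▸ Subgroup.mem_top x.right)

end Statement3
end

section
/- Let V be a finite-dimensional real normed vector space and let G be a subgroup of the group of affine equivalences of V (so each g ∈ G acts on V by x ↦ ℓ(g)x + b(g), where ℓ(g) is the linear part of g and b(g) = g(0) its translation part). Assume the set B = {b(g) : g ∈ G} is closed and discrete in V. Let X be a topological space equipped with an action of G such that: (i) if ℓ(g) = ℓ(h) then g and h act identically on X, and (ii) for every compact subset L ⊆ X, the set {ℓ(g) : g ∈ G, g·L ∩ L ≠ ∅} is finite. Then for every compact K ⊆ V and every compact L ⊆ X, the set {g ∈ G : g·K ∩ K ≠ ∅ and g·L ∩ L ≠ ∅} is finite; that is, the diagonal action of G on V × X is proper in the sense that only finitely many group elements return a given compact product set to meet itself. -/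
open Pointwise

/-- The intersection of a compact set with a closed discrete set is finite. -/
theorem IsCompact.finite_inter_of_isClosed_of_discreteTopology {α : Type*} [TopologicalSpace α]
    {C B : Set α} (hC : IsCompact C) (hB : IsClosed B) (hd : DiscreteTopology B) :
    (C ∩ B).Finite :=
  (hC.inter_right hB).finite ((isDiscrete_iff_discreteTopology.2 hd).mono Set.inter_subset_right)

/-- An affine equivalence is determined by its linear part and its value at the origin. -/
theorem AffineEquiv.prodMk_linear_apply_zero_injective {k V : Type*} [Ring k] [AddCommGroup V]
    [Module k V] : Function.Injective fun g : V ≃ᵃ[k] V => (g.linear, g 0) := by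
  intro g h hgh
  obtain ⟨hl, h0⟩ := Prod.ext_iff.1 hgh
  ext x
  have hg := g.map_vadd 0 x
  have hh := h.map_vadd 0 x
  simp_all

/-- Let `V` be a finite-dimensional real normed vector space and `G` a subgroup of the
group of affine equivalences of `V`; for `g ∈ G` its linear part is `g.linear` and its
translation part is `g 0`.  Assume the set of translation parts of elements of `G` is
closed and discrete in `V`.  Let `X` be a `G`-space such that elements with the same
linear part act identically on `X`, and such that for every compact `L ⊆ X` only finitely
many linear parts of elements `g` with `g • L ∩ L ≠ ∅` occur.  Then for all compacts
`K ⊆ V`, `L ⊆ X`, only finitely many `g ∈ G` satisfy `g(K) ∩ K ≠ ∅` and `g • L ∩ L ≠ ∅`: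
the diagonal action of `G` on `V × X` is proper. -/
theorem statement4 {V : Type*} [NormedAddCommGroup V] [NormedSpace ℝ V]
    [FiniteDimensional ℝ V]
    (G : Subgroup (V ≃ᵃ[ℝ] V))
    (hBclosed : IsClosed {v : V | ∃ g ∈ G, (g : V ≃ᵃ[ℝ] V) 0 = v})
    (hBdiscrete : DiscreteTopology {v : V | ∃ g ∈ G, (g : V ≃ᵃ[ℝ] V) 0 = v})
    {X : Type*} [TopologicalSpace X] [MulAction G X]
    (hsame : ∀ g h : G, (g : V ≃ᵃ[ℝ] V).linear = (h : V ≃ᵃ[ℝ] V).linear →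
      ∀ x : X, g • x = h • x)
    (hfin : ∀ L : Set X, IsCompact L →
      Set.Finite {A : V ≃ₗ[ℝ] V |
        ∃ g : G, (g : V ≃ᵃ[ℝ] V).linear = A ∧ ((g • L) ∩ L).Nonempty})
    (K : Set V) (hK : IsCompact K) (L : Set X) (hL : IsCompact L) :
    Set.Finite {g : G |
      (((g : V ≃ᵃ[ℝ] V) '' K) ∩ K).Nonempty ∧ ((g • L) ∩ L).Nonempty} := by
  set F := {A : V ≃ₗ[ℝ] V |
    ∃ g : G, (g : V ≃ᵃ[ℝ] V).linear = A ∧ ((g • L) ∩ L).Nonempty}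
  have hF : F.Finite := hfin L hL
  have hC : IsCompact (⋃ A ∈ F, (fun p : V × V => p.1 - A p.2) '' (K ×ˢ K)) :=
    hF.isCompact_biUnion fun A _ => (hK.prod hK).image <|
      continuous_fst.sub ((A : V →ₗ[ℝ] V).continuous_of_finiteDimensional.comp continuous_snd)
  refine Set.Finite.of_finite_image (f := fun g : G =>
    ((g : V ≃ᵃ[ℝ] V).linear, (g : V ≃ᵃ[ℝ] V) 0)) ?_
    (AffineEquiv.prodMk_linear_apply_zero_injective.comp Subtype.val_injective).injOn
  refine (hF.prod (hC.finite_inter_of_isClosed_of_discreteTopology hBclosed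
    hBdiscrete)).subset ?_
  rintro _ ⟨g, ⟨⟨_, ⟨x, hx, rfl⟩, hgx⟩, hgL⟩, rfl⟩
  have hgF : (g : V ≃ᵃ[ℝ] V).linear ∈ F := ⟨g, rfl, hgL⟩
  refine ⟨hgF, Set.mem_iUnion₂.2 ⟨_, hgF, ((g : V ≃ᵃ[ℝ] V) x, x), ⟨hgx, hx⟩, ?_⟩, g, g.2, rfl⟩
  have h := (g : V ≃ᵃ[ℝ] V).map_vadd 0 x
  simp only [vadd_eq_add, add_zero] at h
  simp [h]
end

section
/- The group homomorphism from the free group on two generators to SL(2,ℤ) sending the first generator to T² = !![1,2;0,1] and the second generator to U² = !![1,0;2,1] is injective. Consequently, the subgroup S of SL(2,ℤ) generated by T² and U² (the Sanov subgroup) is a free group of rank 2. -/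
namespace Statement6

abbrev SL2Z := Matrix.SpecialLinearGroup (Fin 2) ℤ

/-- T² = [[1,2],[0,1]] in SL(2,ℤ). -/
def T2 : SL2Z := ⟨!![1, 2; 0, 1], by decide⟩

/-- U² = [[1,0],[2,1]] in SL(2,ℤ). -/
def U2 : SL2Z := ⟨!![1, 0; 2, 1], by decide⟩

open scoped Pointwise Function

/-- The matrices whose first column `(x, y)` satisfies `x / y ≥ 1` or `y = 0`
(index `0`), respectively `0 ≤ x / y < 1` (index `1`). -/
def attracting : Fin 2 → Set SL2Z :=
  ![{g | g.1 1 0 * g.1 1 0 ≤ g.1 0 0 * g.1 1 0},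
    {g | 0 ≤ g.1 0 0 * g.1 1 0 ∧ g.1 0 0 * g.1 1 0 < g.1 1 0 * g.1 1 0}]

/-- The matrices whose first column `(x, y)` satisfies `x / y < -1`
(index `0`), respectively `-1 ≤ x / y < 0` (index `1`). -/
def repelling : Fin 2 → Set SL2Z :=
  ![{g | g.1 0 0 * g.1 1 0 < -(g.1 1 0 * g.1 1 0)},
    {g | -(g.1 1 0 * g.1 1 0) ≤ g.1 0 0 * g.1 1 0 ∧ g.1 0 0 * g.1 1 0 < 0}]

theorem T2_mul_apply_zero (g : SL2Z) : (T2 * g).1 0 0 = g.1 0 0 + 2 * g.1 1 0 := by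
  change (T2.1 * g.1) 0 0 = _
  simp [T2, Matrix.mul_apply, Fin.sum_univ_two]

theorem T2_mul_apply_one (g : SL2Z) : (T2 * g).1 1 0 = g.1 1 0 := by
  change (T2.1 * g.1) 1 0 = _
  simp [T2, Matrix.mul_apply, Fin.sum_univ_two]

theorem U2_mul_apply_zero (g : SL2Z) : (U2 * g).1 0 0 = g.1 0 0 := by
  change (U2.1 * g.1) 0 0 = _
  simp [U2, Matrix.mul_apply, Fin.sum_univ_two]

theorem U2_mul_apply_one (g : SL2Z) : (U2 * g).1 1 0 = 2 * g.1 0 0 + g.1 1 0 := by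
  change (U2.1 * g.1) 1 0 = _
  simp [U2, Matrix.mul_apply, Fin.sum_univ_two]

theorem T2_inv_mul_apply_zero (g : SL2Z) : (T2⁻¹ * g).1 0 0 = g.1 0 0 - 2 * g.1 1 0 := by
  have h := T2_mul_apply_zero (T2⁻¹ * g)
  have h' := T2_mul_apply_one (T2⁻¹ * g)
  rw [mul_inv_cancel_left] at h h'
  lia

theorem T2_inv_mul_apply_one (g : SL2Z) : (T2⁻¹ * g).1 1 0 = g.1 1 0 := by
  simpa using (T2_mul_apply_one (T2⁻¹ * g)).symm

theorem U2_inv_mul_apply_zero (g : SL2Z) : (U2⁻¹ * g).1 0 0 = g.1 0 0 := by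
  simpa using (U2_mul_apply_zero (U2⁻¹ * g)).symm

theorem U2_inv_mul_apply_one (g : SL2Z) : (U2⁻¹ * g).1 1 0 = g.1 1 0 - 2 * g.1 0 0 := by
  have h := U2_mul_apply_zero (U2⁻¹ * g)
  have h' := U2_mul_apply_one (U2⁻¹ * g)
  rw [mul_inv_cancel_left] at h h'
  lia

theorem first_column_ne_zero (g : SL2Z) : g.1 0 0 ≠ 0 ∨ g.1 1 0 ≠ 0 := by
  by_contra! h
  have hdet := g.2
  rw [Matrix.det_fin_two, h.1, h.2] at hdet
  simp at hdet

theorem shear_mem_attracting {x y : ℤ} (hne : x ≠ 0 ∨ y ≠ 0)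
    (h : -(y * y) ≤ x * y → 0 ≤ x * y) :
    0 ≤ x * (2 * x + y) ∧ x * (2 * x + y) < (2 * x + y) * (2 * x + y) := by
  have hsq : 0 < x * x + y * y := by
    rcases hne with h | h <;> nlinarith [mul_self_pos.2 h, mul_self_nonneg x, mul_self_nonneg y]
  rcases lt_or_ge (x * y) (-(y * y)) with hxy | hxy
  · have hy : y ≠ 0 := by rintro rfl; simp at hxy
    rcases lt_or_gt_of_ne hy with hy | hy
    · have : -y < x := by nlinarith
      constructor <;> nlinarith
    · have : x < -y := by nlinarith
      constructor <;> nlinarith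
  · have := h hxy
    constructor <;> nlinarith [mul_self_nonneg x, mul_self_nonneg y]

theorem inv_shear_mem_repelling {x y : ℤ} (hne : x ≠ 0 ∨ y ≠ 0)
    (h : 0 ≤ x * y → y * y ≤ x * y) :
    -((y - 2 * x) * (y - 2 * x)) ≤ x * (y - 2 * x) ∧ x * (y - 2 * x) < 0 := by
  have hx : x ≠ 0 := by
    rintro rfl
    have := mul_self_pos.2 (hne.resolve_left (by simp))
    simp at h
    nlinarith
  have hsq := mul_self_pos.2 hx
  rcases lt_or_ge (x * y) 0 with hxy | hxy
  · constructor <;> nlinarith [mul_self_nonneg y]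
  · have := h hxy
    constructor <;> nlinarith [mul_self_nonneg (x - y), mul_self_nonneg y]

theorem lift_T2_U2_injective :
    Function.Injective (FreeGroup.lift ![T2, U2] : FreeGroup (Fin 2) →* SL2Z) := by
  refine FreeGroup.injective_lift_of_ping_pong _ attracting repelling ?_ ?_ ?_ ?_ ?_ ?_
  · rw [Fin.forall_fin_two]
    refine ⟨⟨1, by simp [attracting]⟩, U2, ?_⟩
    change (0 : ℤ) ≤ 1 * 2 ∧ (1 : ℤ) * 2 < 2 * 2
    decide
  · intro i j hij
    rw [Function.onFun, Set.disjoint_left]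
    fin_cases i <;> fin_cases j <;> simp [attracting] at hij ⊢ <;> grind
  · intro i j hij
    rw [Function.onFun, Set.disjoint_left]
    fin_cases i <;> fin_cases j <;> simp [repelling] at hij ⊢ <;> grind
  · intro i j
    rw [Set.disjoint_left]
    intro g
    have := mul_self_nonneg (g.1 1 0)
    fin_cases i <;> fin_cases j <;> simp [attracting, repelling] <;> grind
  · rw [Fin.forall_fin_two]
    constructor <;> rintro _ ⟨g, hg, rfl⟩
    · change (T2 * g).1 1 0 * (T2 * g).1 1 0 ≤ (T2 * g).1 0 0 * (T2 * g).1 1 0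
      rw [T2_mul_apply_zero, T2_mul_apply_one]
      simp only [repelling, Matrix.cons_val_zero, Set.mem_compl_iff, Set.mem_ofPred_eq] at hg
      linarith
    · change 0 ≤ (U2 * g).1 0 0 * (U2 * g).1 1 0 ∧
        (U2 * g).1 0 0 * (U2 * g).1 1 0 < (U2 * g).1 1 0 * (U2 * g).1 1 0
      rw [U2_mul_apply_zero, U2_mul_apply_one]
      exact shear_mem_attracting (first_column_ne_zero g) fun h =>
        not_lt.1 fun h' => hg ⟨h, h'⟩
  · rw [Fin.forall_fin_two]
    constructor <;> rintro _ ⟨g, hg, rfl⟩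
    · change (T2⁻¹ * g).1 0 0 * (T2⁻¹ * g).1 1 0 < -((T2⁻¹ * g).1 1 0 * (T2⁻¹ * g).1 1 0)
      rw [T2_inv_mul_apply_zero, T2_inv_mul_apply_one]
      simp only [attracting, Matrix.cons_val_zero, Set.mem_compl_iff, Set.mem_ofPred_eq] at hg
      linarith
    · change -((U2⁻¹ * g).1 1 0 * (U2⁻¹ * g).1 1 0) ≤ (U2⁻¹ * g).1 0 0 * (U2⁻¹ * g).1 1 0 ∧
        (U2⁻¹ * g).1 0 0 * (U2⁻¹ * g).1 1 0 < 0
      rw [U2_inv_mul_apply_zero, U2_inv_mul_apply_one]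
      exact inv_shear_mem_repelling (first_column_ne_zero g) fun h =>
        not_lt.1 fun h' => hg ⟨h, h'⟩

/-- The homomorphism from the free group on two generators sending the first generator
to T² and the second to U² is injective; its range is the Sanov subgroup, the subgroup
generated by T² and U², which is therefore free of rank 2. -/
theorem statement6 :
    Function.Injective (FreeGroup.lift ![T2, U2] : FreeGroup (Fin 2) →* SL2Z) ∧
    (FreeGroup.lift ![T2, U2] : FreeGroup (Fin 2) →* SL2Z).range =
      Subgroup.closure {T2, U2} := by
  refine ⟨lift_T2_U2_injective, ?_⟩
  rw [FreeGroup.range_lift_eq_closure, Matrix.range_cons_cons_empty]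

end Statement6
end

section
/- Let Γ(2) denote the kernel of the reduction-mod-2 homomorphism SL(2,ℤ) → SL(2,ℤ/2ℤ). Then: (i) the reduction homomorphism SL(2,ℤ) → SL(2,ℤ/2ℤ) is surjective; (ii) Γ(2) is a normal subgroup of SL(2,ℤ) of index 6; and (iii) Γ(2) is generated by the three matrices -1, T² = !![1,2;0,1], and U² = !![1,0;2,1]. -/
namespace Statement7

abbrev SL2Z := Matrix.SpecialLinearGroup (Fin 2) ℤ

/-- Reduction modulo 2, SL(2,ℤ) → SL(2,ℤ/2ℤ). -/
def redMod2 : SL2Z →* Matrix.SpecialLinearGroup (Fin 2) (ZMod 2) :=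
  Matrix.SpecialLinearGroup.map (Int.castRingHom (ZMod 2))

/-- T² = [[1,2],[0,1]] in SL(2,ℤ). -/
def T2 : SL2Z := ⟨!![1, 2; 0, 1], by decide⟩

/-- U² = [[1,0],[2,1]] in SL(2,ℤ). -/
def U2 : SL2Z := ⟨!![1, 0; 2, 1], by decide⟩

/-- Γ(2), the principal congruence subgroup of level 2: the kernel of reduction mod 2. -/
def Γ2 : Subgroup SL2Z := redMod2.ker

theorem redMod2_apply (g : SL2Z) (i j : Fin 2) : redMod2 g i j = (g i j : ZMod 2) := rfl

theorem redMod2_surjective : Function.Surjective redMod2 := by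
  have lift : ∀ a b c d : ZMod 2, a * d - b * c = 1 →
      ∃ x y z w : Fin 2, (x : ℤ) * w - y * z ∈ ({1, -1} : Set ℤ) ∧
        ((x : ℤ) : ZMod 2) = a ∧ ((y : ℤ) : ZMod 2) = b ∧
        ((z : ℤ) : ZMod 2) = c ∧ ((w : ℤ) : ZMod 2) = d := by
    simp only [Set.mem_insert_iff, Set.mem_singleton_iff]
    decide
  intro g
  have hg := g.det_coe
  rw [Matrix.det_fin_two] at hg
  obtain ⟨x, y, z, w, h, hx, hy, hz, hw⟩ := lift _ _ _ _ hg
  have neg_eq (r : ZMod 2) : -r = r := by revert r; decide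
  rcases h with h | h
  · refine ⟨⟨!![x, y; z, w], by simpa [Matrix.det_fin_two] using h⟩, ?_⟩
    ext i j
    refine (redMod2_apply _ i j).trans ?_
    fin_cases i <;> fin_cases j <;> simp [← hx, ← hy, ← hz, ← hw]
  · refine ⟨⟨!![x, y; -z, -w], by simp [Matrix.det_fin_two] at h ⊢; linarith⟩, ?_⟩
    ext i j
    refine (redMod2_apply _ i j).trans ?_
    fin_cases i <;> fin_cases j <;> simp [neg_eq, ← hx, ← hy, ← hz, ← hw]

theorem card_SL2_zmod_two : Nat.card (Matrix.SpecialLinearGroup (Fin 2) (ZMod 2)) = 6 := by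
  rw [Nat.card_eq_fintype_card]
  decide

theorem mem_Γ2_iff (g : SL2Z) :
    g ∈ Γ2 ↔ Odd (g 0 0) ∧ Even (g 0 1) ∧ Even (g 1 0) ∧ Odd (g 1 1) := by
  simp only [← ZMod.intCast_eq_one_iff_odd, ← ZMod.intCast_eq_zero_iff_even]
  rw [Γ2, MonoidHom.mem_ker, Matrix.SpecialLinearGroup.ext_iff]
  simp [redMod2_apply, Fin.forall_fin_two, and_assoc]

theorem coe_T2_zpow (k : ℤ) : (↑(T2 ^ k) : Matrix (Fin 2) (Fin 2) ℤ) = !![1, 2 * k; 0, 1] := by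
  have h : T2 = ModularGroup.T ^ (2 : ℤ) := by
    apply Subtype.ext
    rw [ModularGroup.coe_T_zpow]
    rfl
  rw [h, ← zpow_mul, ModularGroup.coe_T_zpow]

theorem coe_U2_inv : (↑(U2⁻¹) : Matrix (Fin 2) (Fin 2) ℤ) = !![1, 0; -2, 1] := by
  rw [Matrix.SpecialLinearGroup.SL2_inv_expl]
  simp [U2]
  rfl

theorem T2_mem_closure : T2 ∈ Subgroup.closure {-1, T2, U2} :=
  Subgroup.subset_closure (by simp)

theorem U2_mem_closure : U2 ∈ Subgroup.closure {-1, T2, U2} :=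
  Subgroup.subset_closure (by simp)

theorem closure_le_Γ2 : Subgroup.closure {-1, T2, U2} ≤ Γ2 := by
  rw [Subgroup.closure_le]
  rintro g (rfl | rfl | rfl) <;> rw [SetLike.mem_coe, mem_Γ2_iff] <;> decide

/-- Upper triangular elements of `Γ2` are `± T2 ^ k`. -/
theorem mem_closure_of_lower_left_eq_zero {g : SL2Z} (hg : g ∈ Γ2) (hc : g 1 0 = 0) :
    g ∈ Subgroup.closure {-1, T2, U2} := by
  obtain ⟨-, ⟨k, hk⟩, -, -⟩ := (mem_Γ2_iff g).1 hg
  have hdet := g.det_coe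
  rw [Matrix.det_fin_two, hc, mul_zero, sub_zero] at hdet
  rcases Int.mul_eq_one_iff_eq_one_or_neg_one.1 hdet with ⟨ha, hd⟩ | ⟨ha, hd⟩
  · have : g = T2 ^ k := by
      ext i j
      rw [coe_T2_zpow]
      fin_cases i <;> fin_cases j <;> simp [ha, hd, hc, hk, two_mul]
    rw [this]
    exact zpow_mem T2_mem_closure k
  · have : g = -1 * T2 ^ (-k) := by
      ext i j
      rw [neg_one_mul, Matrix.SpecialLinearGroup.coe_neg, coe_T2_zpow]
      fin_cases i <;> fin_cases j <;> simp [ha, hd, hc, hk, two_mul]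
    rw [this]
    exact mul_mem (Subgroup.subset_closure (by simp)) (zpow_mem T2_mem_closure _)

/-- If the first column of `g` is not yet reduced, multiplying on the left by one of
`T2`, `T2⁻¹`, `U2`, `U2⁻¹` makes it smaller. -/
theorem exists_mul_column_lt {g : SL2Z} (hg : g ∈ Γ2) (hc : g 1 0 ≠ 0) :
    ∃ h ∈ Subgroup.closure {-1, T2, U2},
      ((h * g) 0 0).natAbs + ((h * g) 1 0).natAbs < (g 0 0).natAbs + (g 1 0).natAbs := by
  obtain ⟨⟨m, hm⟩, -, ⟨n, hn⟩, -⟩ := (mem_Γ2_iff g).1 hg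
  have hT : (T2 * g) 0 0 = g 0 0 + 2 * g 1 0 ∧ (T2 * g) 1 0 = g 1 0 := by
    rw [Matrix.SpecialLinearGroup.coe_mul]
    simp [T2, Matrix.mul_apply, Fin.sum_univ_two]
  have hT' : (T2⁻¹ * g) 0 0 = g 0 0 - 2 * g 1 0 ∧ (T2⁻¹ * g) 1 0 = g 1 0 := by
    rw [← zpow_neg_one, Matrix.SpecialLinearGroup.coe_mul, coe_T2_zpow]
    simp [Matrix.mul_apply, Fin.sum_univ_two, sub_eq_add_neg]
  have hU : (U2 * g) 0 0 = g 0 0 ∧ (U2 * g) 1 0 = 2 * g 0 0 + g 1 0 := by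
    rw [Matrix.SpecialLinearGroup.coe_mul]
    simp [U2, Matrix.mul_apply, Fin.sum_univ_two]
  have hU' : (U2⁻¹ * g) 0 0 = g 0 0 ∧ (U2⁻¹ * g) 1 0 = -2 * g 0 0 + g 1 0 := by
    rw [Matrix.SpecialLinearGroup.coe_mul, coe_U2_inv]
    simp [Matrix.mul_apply, Fin.sum_univ_two]
  by_contra! H
  have h₁ := H _ T2_mem_closure
  have h₂ := H _ (inv_mem T2_mem_closure)
  have h₃ := H _ U2_mem_closure
  have h₄ := H _ (inv_mem U2_mem_closure)
  rw [hT.1, hT.2] at h₁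
  rw [hT'.1, hT'.2] at h₂
  rw [hU.1, hU.2] at h₃
  rw [hU'.1, hU'.2] at h₄
  omega

theorem Γ2_le_closure : Γ2 ≤ Subgroup.closure {-1, T2, U2} := by
  intro g hg
  induction hs : (g 0 0).natAbs + (g 1 0).natAbs using Nat.strong_induction_on generalizing g with
  | _ s ih =>
    by_cases hc : g 1 0 = 0
    · exact mem_closure_of_lower_left_eq_zero hg hc
    · obtain ⟨h, hh, hlt⟩ := exists_mul_column_lt hg hc
      exact (Subgroup.mul_mem_cancel_left _ hh).1
        (ih _ (hs ▸ hlt) (mul_mem (closure_le_Γ2 hh) hg) rfl)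

/-- (i) reduction mod 2 is surjective; (ii) Γ(2) is a normal subgroup of SL(2,ℤ) of
index 6; (iii) Γ(2) is generated by -1, T² and U². -/
theorem statement7 :
    Function.Surjective redMod2 ∧
    Γ2.Normal ∧ Γ2.index = 6 ∧
    Γ2 = Subgroup.closure {-1, T2, U2} := by
  refine ⟨redMod2_surjective, MonoidHom.normal_ker _, ?_, le_antisymm Γ2_le_closure closure_le_Γ2⟩
  rw [Γ2, Subgroup.index_ker, MonoidHom.range_eq_top.2 redMod2_surjective, Subgroup.card_top,
    card_SL2_zmod_two]

end Statement7
end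

section
/- Let Γ(2) = ker(SL(2,ℤ) → SL(2,ℤ/2ℤ)) and let S ≤ SL(2,ℤ) be the Sanov subgroup generated by T² = !![1,2;0,1] and U² = !![1,0;2,1]. Then Γ(2) is the internal direct product of S and the central subgroup ⟨-1⟩ = {1, -1}: every element A ∈ Γ(2) can be written uniquely as A = ε·B with ε ∈ {1,-1} and B ∈ S. Equivalently, S ∩ ⟨-1⟩ = {1}, every element of S commutes with -1, and S·⟨-1⟩ = Γ(2), so that Γ(2) ≅ S × ℤ/2ℤ. -/
namespace Statement8

abbrev SL2Z := Matrix.SpecialLinearGroup (Fin 2) ℤ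

/-- Reduction modulo 2, SL(2,ℤ) → SL(2,ℤ/2ℤ). -/
def redMod2 : SL2Z →* Matrix.SpecialLinearGroup (Fin 2) (ZMod 2) :=
  Matrix.SpecialLinearGroup.map (Int.castRingHom (ZMod 2))

/-- Γ(2), the principal congruence subgroup of level 2: the kernel of reduction mod 2. -/
def Γ2 : Subgroup SL2Z := redMod2.ker

/-- T² = [[1,2],[0,1]] in SL(2,ℤ). -/
def T2 : SL2Z := ⟨!![1, 2; 0, 1], by decide⟩

/-- U² = [[1,0],[2,1]] in SL(2,ℤ). -/
def U2 : SL2Z := ⟨!![1, 0; 2, 1], by decide⟩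

/-- The Sanov subgroup, generated by T² and U². -/
def Sanov : Subgroup SL2Z := Subgroup.closure {T2, U2}

/-- Matrices congruent to `[[1,0],[0,1]]` modulo `[[4,2],[2,4]]`. -/
def sanovCongruence : Subgroup SL2Z where
  carrier := {A | A 0 0 ≡ 1 [ZMOD 4] ∧ A 1 1 ≡ 1 [ZMOD 4] ∧ 2 ∣ A 0 1 ∧ 2 ∣ A 1 0}
  one_mem' := by simp
  mul_mem' := by
    rintro A B ⟨ha, hd, ⟨b, hb⟩, ⟨c, hc⟩⟩ ⟨ha', hd', ⟨b', hb'⟩, ⟨c', hc'⟩⟩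
    simp only [Set.mem_ofPred_eq, Matrix.SpecialLinearGroup.coe_mul, Matrix.mul_apply,
      Fin.sum_univ_two, hb, hc, hb', hc']
    refine ⟨?_, ?_, ?_, ?_⟩
    · rw [show A 0 0 * B 0 0 + 2 * b * (2 * c') = A 0 0 * B 0 0 + 4 * (b * c') by ring]
      simpa [Int.ModEq] using ha.mul ha'
    · rw [show 2 * c * (2 * b') + A 1 1 * B 1 1 = A 1 1 * B 1 1 + 4 * (c * b') by ring]
      simpa [Int.ModEq] using hd.mul hd'
    · exact ⟨A 0 0 * b' + b * B 1 1, by ring⟩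
    · exact ⟨c * B 0 0 + A 1 1 * c', by ring⟩
  inv_mem' := by
    rintro A ⟨ha, hd, hb, hc⟩
    simp [Matrix.SpecialLinearGroup.coe_inv, Matrix.adjugate_fin_two, ha, hd, hb, hc]

theorem mem_sanovCongruence {A : SL2Z} : A ∈ sanovCongruence ↔
    A 0 0 ≡ 1 [ZMOD 4] ∧ A 1 1 ≡ 1 [ZMOD 4] ∧ 2 ∣ A 0 1 ∧ 2 ∣ A 1 0 :=
  Iff.rfl

theorem T2_coe : (T2 : Matrix (Fin 2) (Fin 2) ℤ) = !![1, 2; 0, 1] := rfl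

theorem U2_coe : (U2 : Matrix (Fin 2) (Fin 2) ℤ) = !![1, 0; 2, 1] := rfl

theorem T2_mem_sanov : T2 ∈ Sanov := Subgroup.subset_closure (by simp)

theorem U2_mem_sanov : U2 ∈ Sanov := Subgroup.subset_closure (by simp)

theorem sanov_le_sanovCongruence : Sanov ≤ sanovCongruence := by
  rw [Sanov, Subgroup.closure_le]
  rintro _ (rfl | rfl) <;> exact mem_sanovCongruence.2 (by decide)

theorem T2_zpow_coe (n : ℤ) : (T2 ^ n : SL2Z).1 = !![1, 2 * n; 0, 1] := by
  have h : T2 = ModularGroup.T ^ (2 : ℤ) := by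
    ext i j
    rw [ModularGroup.coe_T_zpow]
    rfl
  rw [h, ← zpow_mul]
  exact ModularGroup.coe_T_zpow _

theorem det_eq_one (A : SL2Z) : A 0 0 * A 1 1 - A 0 1 * A 1 0 = 1 := by
  rw [← Matrix.det_fin_two, A.det_coe]

/-- Multiplying on the left by a suitable power `T2 ^ ±1` or `U2 ^ ±1` shrinks the first column. -/
theorem exists_sanov_mul_lt {A : SL2Z} (ha : A 0 0 ≡ 1 [ZMOD 4]) (hc : 2 ∣ A 1 0)
    (h0 : A 1 0 ≠ 0) : ∃ g ∈ Sanov,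
      ((g * A) 0 0).natAbs + ((g * A) 1 0).natAbs < (A 0 0).natAbs + (A 1 0).natAbs := by
  rw [Int.ModEq] at ha
  have hT : (T2 * A) 0 0 = A 0 0 + 2 * A 1 0 ∧ (T2 * A) 1 0 = A 1 0 := by
    simp [T2_coe, Matrix.mul_apply, Fin.sum_univ_two]
  have hT' : (T2⁻¹ * A) 0 0 = A 0 0 - 2 * A 1 0 ∧ (T2⁻¹ * A) 1 0 = A 1 0 := by
    simp [T2_coe, Matrix.adjugate_fin_two, Matrix.mul_apply, Fin.sum_univ_two,
      sub_eq_add_neg]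
  have hU : (U2 * A) 0 0 = A 0 0 ∧ (U2 * A) 1 0 = 2 * A 0 0 + A 1 0 := by
    simp [U2_coe, Matrix.mul_apply, Fin.sum_univ_two]
  have hU' : (U2⁻¹ * A) 0 0 = A 0 0 ∧ (U2⁻¹ * A) 1 0 = -(2 * A 0 0) + A 1 0 := by
    simp [U2_coe, Matrix.adjugate_fin_two, Matrix.mul_apply, Fin.sum_univ_two]
  by_contra! h
  have h1 := h _ T2_mem_sanov
  have h2 := h _ (inv_mem T2_mem_sanov)
  have h3 := h _ U2_mem_sanov
  have h4 := h _ (inv_mem U2_mem_sanov)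
  rw [hT.1, hT.2] at h1
  rw [hT'.1, hT'.2] at h2
  rw [hU.1, hU.2] at h3
  rw [hU'.1, hU'.2] at h4
  omega

theorem sanovCongruence_le_sanov : sanovCongruence ≤ Sanov := by
  intro A hA
  induction h : (A 0 0).natAbs + (A 1 0).natAbs using Nat.strong_induction_on generalizing A with
  | _ n ih =>
    obtain ⟨ha, hd, ⟨b, hb⟩, hc⟩ := mem_sanovCongruence.1 hA
    by_cases h0 : A 1 0 = 0
    · have hdet := det_eq_one A
      rw [h0, mul_zero, sub_zero] at hdet
      have hA' : A = T2 ^ b := by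
        have h1 : A 0 0 = 1 ∧ A 1 1 = 1 := by
          rw [Int.ModEq] at ha
          rcases Int.mul_eq_one_iff_eq_one_or_neg_one.1 hdet with h | h <;> omega
        ext i j
        rw [T2_zpow_coe]
        fin_cases i <;> fin_cases j <;> simp [h0, h1, hb]
      exact hA' ▸ zpow_mem T2_mem_sanov b
    · obtain ⟨g, hg, hlt⟩ := exists_sanov_mul_lt ha hc h0
      exact (Subgroup.mul_mem_cancel_left _ hg).1
        (ih _ (h ▸ hlt) (mul_mem (sanov_le_sanovCongruence hg) hA) rfl)

theorem sanov_eq_sanovCongruence : Sanov = sanovCongruence :=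
  le_antisymm sanov_le_sanovCongruence sanovCongruence_le_sanov

theorem mem_Γ2_iff {A : SL2Z} :
    A ∈ Γ2 ↔ A 0 0 ≡ 1 [ZMOD 2] ∧ A 1 1 ≡ 1 [ZMOD 2] ∧ 2 ∣ A 0 1 ∧ 2 ∣ A 1 0 := by
  have h1 (x : ℤ) : (x : ZMod 2) = 1 ↔ x ≡ 1 [ZMOD 2] := by
    exact_mod_cast ZMod.intCast_eq_intCast_iff x 1 2
  have h0 (x : ℤ) : (x : ZMod 2) = 0 ↔ 2 ∣ x := by
    exact_mod_cast ZMod.intCast_zmod_eq_zero_iff_dvd x 2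
  rw [Γ2, MonoidHom.mem_ker, Matrix.SpecialLinearGroup.ext_iff]
  simp [redMod2, Fin.forall_fin_two, h1, h0]
  tauto

theorem neg_one_mem_Γ2 : (-1 : SL2Z) ∈ Γ2 := mem_Γ2_iff.2 (by decide)

theorem sanov_le_Γ2 : Sanov ≤ Γ2 := by
  rw [Sanov, Subgroup.closure_le]
  rintro _ (rfl | rfl) <;> exact mem_Γ2_iff.2 (by decide)

theorem mem_or_neg_mem_sanov {A : SL2Z} (hA : A ∈ Γ2) : A ∈ Sanov ∨ -A ∈ Sanov := by
  obtain ⟨ha, hd, ⟨b, hb⟩, ⟨c, hc⟩⟩ := mem_Γ2_iff.1 hA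
  have hdet := det_eq_one A
  rw [hb, hc] at hdet
  simp only [sanov_eq_sanovCongruence, mem_sanovCongruence, Matrix.SpecialLinearGroup.coe_neg,
    Matrix.neg_apply, hb, hc, Int.ModEq, dvd_neg, dvd_mul_right, and_true] at *
  obtain ⟨x, hx⟩ : ∃ x, A 0 0 = 2 * x + 1 := ⟨A 0 0 / 2, by omega⟩
  obtain ⟨y, hy⟩ : ∃ y, A 1 1 = 2 * y + 1 := ⟨A 1 1 / 2, by omega⟩
  rw [hx, hy] at hdet ⊢
  have : 4 * (x * y - b * c) + 2 * x + 2 * y = 0 := by linarith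
  omega

theorem neg_notMem_sanov {B : SL2Z} (hB : B ∈ Sanov) : -B ∉ Sanov := by
  intro h
  have h1 := (mem_sanovCongruence.1 (sanov_le_sanovCongruence hB)).1
  have h2 := (mem_sanovCongruence.1 (sanov_le_sanovCongruence h)).1
  simp only [Matrix.SpecialLinearGroup.coe_neg, Matrix.neg_apply, Int.ModEq] at h1 h2
  omega

theorem mem_zpowers_neg_one {A : SL2Z} :
    A ∈ Subgroup.zpowers (-1 : SL2Z) ↔ A = 1 ∨ A = -1 := by
  constructor
  · rintro ⟨n, rfl⟩
    rcases n.even_or_odd with h | h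
    · exact .inl h.neg_one_zpow
    · exact .inr h.neg_one_zpow
  · rintro (rfl | rfl)
    · exact one_mem _
    · exact Subgroup.mem_zpowers _

/-- The isomorphism of `ℤ/2ℤ` with `{1, -1}`, as a map to `Γ(2)`. -/
def signHom : Multiplicative (ZMod 2) →* Γ2 where
  toFun x := if x = 1 then 1 else ⟨-1, neg_one_mem_Γ2⟩
  map_one' := if_pos rfl
  map_mul' := by decide

theorem signHom_coe (x : Multiplicative (ZMod 2)) :
    (signHom x : SL2Z) = if x = 1 then 1 else -1 := by
  simp only [signHom, MonoidHom.coe_mk, OneHom.coe_mk]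
  split_ifs <;> rfl

/-- The multiplication map `S × ℤ/2ℤ → Γ(2)`. -/
def sanovProdHom : Sanov × Multiplicative (ZMod 2) →* Γ2 :=
  (Subgroup.inclusion sanov_le_Γ2).noncommCoprod signHom fun B x => by
    rw [commute_iff_eq, Subtype.ext_iff]
    simp only [Subgroup.coe_mul, signHom_coe]
    split_ifs <;> simp

theorem sanovProdHom_coe (p : Sanov × Multiplicative (ZMod 2)) :
    (sanovProdHom p : SL2Z) = if p.2 = 1 then p.1.1 else -p.1.1 := by
  simp only [sanovProdHom, MonoidHom.noncommCoprod_apply, Subgroup.coe_mul, signHom_coe,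
    Subgroup.coe_inclusion]
  split_ifs <;> simp

theorem sanovProdHom_bijective : Function.Bijective sanovProdHom := by
  constructor
  · rw [injective_iff_map_eq_one]
    rintro ⟨⟨B, hB⟩, x⟩ h
    have h' := congrArg Subtype.val h
    rw [sanovProdHom_coe] at h'
    split_ifs at h' with hx
    · exact Prod.ext (Subtype.ext h') hx
    · exact absurd (h' ▸ one_mem Sanov : -B ∈ Sanov) (neg_notMem_sanov hB)
  · rintro ⟨A, hA⟩
    rcases mem_or_neg_mem_sanov hA with h | h
    · exact ⟨(⟨A, h⟩, 1), Subtype.ext (by simp [sanovProdHom_coe])⟩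
    · exact ⟨(⟨-A, h⟩, Multiplicative.ofAdd 1), Subtype.ext (by simp [sanovProdHom_coe])⟩

/-- Γ(2) is the internal direct product of the Sanov subgroup S and the central
subgroup ⟨-1⟩ = {1,-1}: every A ∈ Γ(2) is uniquely A = ε·B with ε ∈ {1,-1} and B ∈ S;
equivalently S ∩ ⟨-1⟩ = {1}, every element of S commutes with -1, and S·⟨-1⟩ = Γ(2),
so that Γ(2) ≅ S × ℤ/2ℤ. -/
theorem statement8 :
    (∀ A : SL2Z, A ∈ Γ2 →
      ∃! p : SL2Z × SL2Z, (p.1 = 1 ∨ p.1 = -1) ∧ p.2 ∈ Sanov ∧ A = p.1 * p.2) ∧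
    Sanov ⊓ Subgroup.zpowers (-1) = ⊥ ∧
    (∀ B ∈ Sanov, Commute B (-1)) ∧
    Sanov ⊔ Subgroup.zpowers (-1) = Γ2 ∧
    Nonempty (Γ2 ≃* Sanov × Multiplicative (ZMod 2)) := by
  refine ⟨fun A hA => ?_, ?_, fun B _ => Commute.neg_one_right B, ?_,
    ⟨(MulEquiv.ofBijective sanovProdHom sanovProdHom_bijective).symm⟩⟩
  · rcases mem_or_neg_mem_sanov hA with h | h
    · refine ⟨(1, A), ⟨.inl rfl, h, (one_mul A).symm⟩, ?_⟩
      rintro ⟨e, B⟩ ⟨rfl | rfl, hB, rfl⟩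
      · simp
      · exact absurd (by simpa using h) (neg_notMem_sanov hB)
    · refine ⟨(-1, -A), ⟨.inr rfl, h, by simp⟩, ?_⟩
      rintro ⟨e, B⟩ ⟨rfl | rfl, hB, rfl⟩
      · exact absurd (by simpa using h) (neg_notMem_sanov hB)
      · simp
  · rw [eq_bot_iff]
    rintro A ⟨hA, hA'⟩
    rcases mem_zpowers_neg_one.1 hA' with rfl | rfl
    · exact one_mem _
    · exact absurd hA (neg_notMem_sanov (one_mem _))
  · refine le_antisymm (sup_le sanov_le_Γ2 (Subgroup.zpowers_le.2 neg_one_mem_Γ2)) fun A hA => ?_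
    rcases mem_or_neg_mem_sanov hA with h | h
    · exact Subgroup.mem_sup_left h
    · simpa using Subgroup.mul_mem_sup h (Subgroup.mem_zpowers (-1 : SL2Z))

end Statement8
end

section
/- Let A be a torsion-free abelian group, let V ≤ A be a subgroup such that n • a ∈ V for all a ∈ A, for some fixed positive integer n, and let π : A → ℤ^m (m a natural number) be a group homomorphism such that the restriction of π to V is injective and π(V) is a direct summand of ℤ^m (i.e., there exists a subgroup W ≤ ℤ^m with ℤ^m = π(V) ⊕ W, meaning π(V) ∩ W = 0 and π(V) + W = ℤ^m). Then π is injective on all of A and V = A. -/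
/-- Let `A` be a torsion-free abelian group, `V ≤ A` a subgroup with `n • a ∈ V` for all
`a ∈ A` (for some fixed positive integer `n`), and `π : A → ℤ^m` a homomorphism whose
restriction to `V` is injective and whose image `π(V)` is a direct summand of `ℤ^m`
(i.e. there is a subgroup `W` with `π(V) ⊓ W = ⊥` and `π(V) ⊔ W = ⊤`).  Then `π` is
injective on all of `A` and `V = A`. -/
theorem statement9 {A : Type*} [AddCommGroup A]
    (htf : ∀ (k : ℕ) (a : A), 0 < k → k • a = 0 → a = 0)
    (V : AddSubgroup A) (n : ℕ) (hn : 0 < n) (hnV : ∀ a : A, n • a ∈ V)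
    {m : ℕ} (π : A →+ (Fin m → ℤ))
    (hinj : Set.InjOn π (V : Set A))
    (hsummand : ∃ W : AddSubgroup (Fin m → ℤ),
      (V.map π) ⊓ W = ⊥ ∧ (V.map π) ⊔ W = ⊤) :
    Function.Injective π ∧ V = ⊤ := by
  have hπ : Function.Injective π := by
    rw [injective_iff_map_eq_zero]
    intro a ha
    refine htf n a hn (hinj (hnV a) V.zero_mem ?_)
    rw [map_nsmul, ha, smul_zero, map_zero]
  refine ⟨hπ, (AddSubgroup.eq_top_iff' V).2 fun a => ?_⟩
  obtain ⟨W, hinf, hsup⟩ := hsummand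
  have hmem : π a ∈ V.map π ⊔ W := hsup ▸ AddSubgroup.mem_top _
  obtain ⟨_, ⟨v, hv, rfl⟩, w, hw, hvw⟩ := AddSubgroup.mem_sup.1 hmem
  have hnw : n • w ∈ V.map π ⊓ W := by
    refine ⟨⟨n • a - n • v, V.sub_mem (hnV a) (hnV v), ?_⟩, W.nsmul_mem hw n⟩
    rw [map_sub, map_nsmul, map_nsmul, ← hvw, smul_add, add_sub_cancel_left]
  rw [hinf, AddSubgroup.mem_bot] at hnw
  have hw0 : w = 0 := (smul_eq_zero.1 hnw).resolve_left hn.ne'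
  rw [hw0, add_zero] at hvw
  exact hπ hvw ▸ hv
end

section
/- Let M be the 17×5 integer matrix whose rows are (1,0,0,0,0), (1,0,0,0,0), (0,1,0,0,0), (0,1,0,0,0), (0,0,1,0,1), (0,0,0,0,0), (0,0,0,1,0), (0,0,0,1,0), (1,-1,0,0,0), (1,-1,0,0,0), (1,-1,0,0,0), (0,0,0,0,0), (0,0,0,0,0), (0,0,0,0,0), (0,0,0,0,0), (-1,0,0,0,0), (-1,0,-1,-1,-1). Consider the group homomorphism f : ℤ⁵ → ℤ¹⁷ given by v ↦ M·v. Then the kernel of f is the cyclic subgroup of ℤ⁵ generated by the vector (0,0,1,0,-1), and the cokernel ℤ¹⁷ / range(f) is a free abelian group of rank 13. -/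
namespace Statement10

/-- The 17×5 integer matrix of the Mayer–Vietoris connecting homomorphism
H₀^𝔉(E̲p2) → H₀^𝔉(E̲p4) ⊕ H₀^𝔉(E̲p6) in the Bredon homology computation for
SA = ℤ² ⋊ SL(2,ℤ). -/
def M : Matrix (Fin 17) (Fin 5) ℤ :=
  !![1, 0, 0, 0, 0;
     1, 0, 0, 0, 0;
     0, 1, 0, 0, 0;
     0, 1, 0, 0, 0;
     0, 0, 1, 0, 1;
     0, 0, 0, 0, 0;
     0, 0, 0, 1, 0;
     0, 0, 0, 1, 0;
     1, -1, 0, 0, 0;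
     1, -1, 0, 0, 0;
     1, -1, 0, 0, 0;
     0, 0, 0, 0, 0;
     0, 0, 0, 0, 0;
     0, 0, 0, 0, 0;
     0, 0, 0, 0, 0;
     -1, 0, 0, 0, 0;
     -1, 0, -1, -1, -1]

theorem M_mulVecLin_apply (v : Fin 5 → ℤ) :
    M.mulVecLin v = ![v 0, v 0, v 1, v 1, v 2 + v 4, 0, v 3, v 3, v 0 - v 1, v 0 - v 1,
      v 0 - v 1, 0, 0, 0, 0, -v 0, -v 0 - v 2 - v 3 - v 4] := by
  ext i
  fin_cases i <;> simp [M, Matrix.mulVec, dotProduct, Fin.sum_univ_succ] <;> first | rfl | ring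

/-- The projection onto the cokernel of `M`: it eliminates the coordinates `0`, `2`, `4`, `6`,
whose rows of `M` generate its row lattice. -/
def cokernelProjection : (Fin 17 → ℤ) →ₗ[ℤ] (Fin 13 → ℤ) where
  toFun y := ![y 1 - y 0, y 3 - y 2, y 5, y 7 - y 6, y 8 - y 0 + y 2, y 9 - y 0 + y 2,
    y 10 - y 0 + y 2, y 11, y 12, y 13, y 14, y 15 + y 0, y 16 + y 0 + y 4 + y 6]
  map_add' x y := by
    ext i
    fin_cases i <;> simp <;> ring
  map_smul' c y := by
    ext i
    fin_cases i <;> simp <;> ring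

theorem cokernelProjection_apply (y : Fin 17 → ℤ) :
    cokernelProjection y = ![y 1 - y 0, y 3 - y 2, y 5, y 7 - y 6, y 8 - y 0 + y 2,
      y 9 - y 0 + y 2, y 10 - y 0 + y 2, y 11, y 12, y 13, y 14, y 15 + y 0,
      y 16 + y 0 + y 4 + y 6] :=
  rfl

theorem cokernelProjection_surjective : Function.Surjective cokernelProjection := by
  intro z
  refine ⟨![0, z 0, 0, z 1, 0, z 2, 0, z 3, z 4, z 5, z 6, z 7, z 8, z 9, z 10, z 11, z 12], ?_⟩
  ext i
  fin_cases i <;> simp [cokernelProjection_apply]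

theorem ker_cokernelProjection :
    LinearMap.ker cokernelProjection = LinearMap.range M.mulVecLin := by
  ext y
  rw [LinearMap.mem_ker, LinearMap.mem_range]
  constructor
  · intro h
    refine ⟨![y 0, y 2, y 4, y 6, 0], ?_⟩
    have hz (i : Fin 13) : cokernelProjection y i = 0 := congrFun h i
    simp only [cokernelProjection_apply, Fin.forall_fin_succ] at hz
    simp at hz
    rw [M_mulVecLin_apply]
    ext i
    fin_cases i <;> simp <;> lia
  · rintro ⟨v, rfl⟩
    ext i
    rw [M_mulVecLin_apply, cokernelProjection_apply]
    fin_cases i <;> simp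
    ring

theorem ker_M_mulVecLin :
    LinearMap.ker M.mulVecLin = Submodule.span ℤ {![0, 0, 1, 0, -1]} := by
  ext v
  rw [LinearMap.mem_ker, Submodule.mem_span_singleton]
  constructor
  · intro h
    rw [M_mulVecLin_apply] at h
    have h0 : v 0 = 0 := congrFun h 0
    have h1 : v 1 = 0 := congrFun h 2
    have h2 : v 2 + v 4 = 0 := congrFun h 4
    have h3 : v 3 = 0 := congrFun h 6
    refine ⟨v 2, ?_⟩
    ext i
    fin_cases i <;> simp <;> lia
  · rintro ⟨a, rfl⟩
    rw [M_mulVecLin_apply]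
    ext i
    fin_cases i <;> simp

/-- The kernel of v ↦ M·v is the cyclic subgroup generated by (0,0,1,0,-1), and the
cokernel ℤ¹⁷/range is free abelian of rank 13. -/
theorem statement10 :
    LinearMap.ker M.mulVecLin = Submodule.span ℤ {![0, 0, 1, 0, -1]} ∧
    Nonempty (((Fin 17 → ℤ) ⧸ LinearMap.range M.mulVecLin) ≃ₗ[ℤ] (Fin 13 → ℤ)) := by
  refine ⟨ker_M_mulVecLin, ⟨?_⟩⟩
  exact (Submodule.quotEquivOfEq _ _ ker_cokernelProjection.symm).trans
    (cokernelProjection.quotKerEquivOfSurjective cokernelProjection_surjective)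

end Statement10
end

section
/- Let M be the 17×6 integer matrix whose rows are (0,0,0,0,0,0), (-2,1,1,0,0,0), (0,0,0,1,0,0), (0,0,0,-1,0,0), (0,0,0,-1,1,0), (1,0,0,1,0,0), (1,0,0,1,0,0), (1,0,0,0,0,1), (1,0,0,0,0,1), (2,-1,-1,0,0,0), (2,-1,-1,0,0,0), (0,0,0,0,0,0), (0,-1,0,0,0,0), (0,-1,0,0,0,0), (-1,1,0,-1,0,0), (-2,1,0,0,-1,-1), (-1,0,0,0,0,-1). Consider the group homomorphism f : ℤ⁶ → ℤ¹⁷ given by v ↦ M·v. Then f is injective and the cokernel ℤ¹⁷ / range(f) is a free abelian group of rank 11. -/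
namespace Statement11

/-- The 17×6 integer matrix of the Mayer–Vietoris connecting homomorphism
H₀^𝔉(E̲cmm) → H₀^𝔉(E̲p4m) ⊕ H₀^𝔉(E̲p6m) in the Bredon homology computation for
GA = ℤ² ⋊ GL(2,ℤ). -/
def M : Matrix (Fin 17) (Fin 6) ℤ :=
  !![0, 0, 0, 0, 0, 0;
     -2, 1, 1, 0, 0, 0;
     0, 0, 0, 1, 0, 0;
     0, 0, 0, -1, 0, 0;
     0, 0, 0, -1, 1, 0;
     1, 0, 0, 1, 0, 0;
     1, 0, 0, 1, 0, 0;
     1, 0, 0, 0, 0, 1;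
     1, 0, 0, 0, 0, 1;
     2, -1, -1, 0, 0, 0;
     2, -1, -1, 0, 0, 0;
     0, 0, 0, 0, 0, 0;
     0, -1, 0, 0, 0, 0;
     0, -1, 0, 0, 0, 0;
     -1, 1, 0, -1, 0, 0;
     -2, 1, 0, 0, -1, -1;
     -1, 0, 0, 0, 0, -1]

/-- A left inverse of `M`. -/
def leftInv : Matrix (Fin 6) (Fin 17) ℤ :=
  !![0, 0, -1, 0, 0, 1, 0, 0, 0, 0, 0, 0, 0, 0, 0, 0, 0;
     0, 0, 0, 0, 0, 0, 0, 0, 0, 0, 0, 0, -1, 0, 0, 0, 0;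
     0, 1, -2, 0, 0, 2, 0, 0, 0, 0, 0, 0, 1, 0, 0, 0, 0;
     0, 0, 1, 0, 0, 0, 0, 0, 0, 0, 0, 0, 0, 0, 0, 0, 0;
     0, 0, 1, 0, 1, 0, 0, 0, 0, 0, 0, 0, 0, 0, 0, 0, 0;
     0, 0, 1, 0, 0, -1, 0, 1, 0, 0, 0, 0, 0, 0, 0, 0, 0]

/-- The coordinates of `ℤ¹⁷` whose basis vectors span a complement of the range of `M`. -/
def complementRows : Fin 11 → Fin 17 := ![0, 3, 6, 8, 9, 10, 11, 13, 14, 15, 16]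

/-- The projection of `ℤ¹⁷` along the range of `M`, read in the complementary coordinates. -/
def cokernelProj : Matrix (Fin 11) (Fin 17) ℤ :=
  (1 - M * leftInv).submatrix complementRows id

/-- The inclusion of the complementary coordinates into `ℤ¹⁷`. -/
def cokernelSection : Matrix (Fin 17) (Fin 11) ℤ :=
  (1 : Matrix (Fin 17) (Fin 17) ℤ).submatrix id complementRows

/-- If `A` has a left inverse `L` and `1 = A L + S P` with `P A = 0` and `P S = 1`, then `P` induces
an isomorphism from the cokernel of `A`. -/
theorem nonempty_cokernel_equiv_of_split {R l m n : Type*} [CommRing R]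
    [Fintype l] [Fintype m] [Fintype n] [DecidableEq l] [DecidableEq m]
    {A : Matrix m n R} {L : Matrix n m R} {P : Matrix l m R} {S : Matrix m l R}
    (hPA : P * A = 0) (hPS : P * S = 1) (hsplit : A * L + S * P = 1) :
    Nonempty (((m → R) ⧸ LinearMap.range A.mulVecLin) ≃ₗ[R] (l → R)) := by
  have hker : LinearMap.range A.mulVecLin = LinearMap.ker P.mulVecLin := by
    ext y
    simp only [LinearMap.mem_range, LinearMap.mem_ker, Matrix.mulVecLin_apply]
    constructor
    · rintro ⟨x, rfl⟩
      rw [Matrix.mulVec_mulVec, hPA, Matrix.zero_mulVec]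
    · intro hy
      refine ⟨L.mulVec y, ?_⟩
      have h := congrArg (fun B => B.mulVec y) hsplit
      simpa [Matrix.add_mulVec, ← Matrix.mulVec_mulVec, hy] using h
  have hsurj : Function.Surjective P.mulVecLin := fun z =>
    ⟨S.mulVec z, by rw [Matrix.mulVecLin_apply, Matrix.mulVec_mulVec, hPS, Matrix.one_mulVec]⟩
  exact ⟨(Submodule.quotEquivOfEq _ _ hker).trans
    (P.mulVecLin.quotKerEquivOfSurjective hsurj)⟩

theorem leftInv_mul : leftInv * M = 1 := by decide +kernel

theorem cokernelProj_mul : cokernelProj * M = 0 := by decide +kernel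

theorem cokernelProj_mul_section : cokernelProj * cokernelSection = 1 := by decide +kernel

theorem mul_leftInv_add_section_mul_proj :
    M * leftInv + cokernelSection * cokernelProj = 1 := by decide +kernel

/-- The map v ↦ M·v is injective and the cokernel ℤ¹⁷/range is free abelian of
rank 11. -/
theorem statement11 :
    Function.Injective M.mulVecLin ∧
    Nonempty (((Fin 17 → ℤ) ⧸ LinearMap.range M.mulVecLin) ≃ₗ[ℤ] (Fin 11 → ℤ)) := by
  refine ⟨fun v w h => ?_, nonempty_cokernel_equiv_of_split cokernelProj_mul
    cokernelProj_mul_section mul_leftInv_add_section_mul_proj⟩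
  have h' := congrArg leftInv.mulVec h
  simpa [Matrix.mulVec_mulVec, leftInv_mul] using h'

end Statement11
end

section
/- Let M be the 17×6 integer matrix whose rows are (1,0,0,0,1,-1), (0,1,0,0,-1,1), (1,0,0,0,1,0), (0,1,0,0,-1,0), (0,0,1,1,0,0), (0,0,0,0,1,0), (0,0,0,0,0,1), (0,0,0,0,1,-1), (0,0,0,0,0,2), (-1,0,0,0,0,1), (0,-1,0,0,0,-1), (0,0,-1,0,0,0), (0,0,0,-1,0,0), (0,0,-1,-1,0,0), (-1,-1,0,0,0,0), (0,0,0,0,0,0), (0,0,0,0,-1,-2). Consider the group homomorphism f : ℤ⁶ → ℤ¹⁷ given by v ↦ M·v. Then f is injective and the cokernel ℤ¹⁷ / range(f) is a free abelian group of rank 11. -/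
namespace Statement12

/-- The 17×6 integer matrix of the middle homomorphism (ι₂⁴, ι₂⁶) :
K₀(C*_r(cmm)) → K₀(C*_r(p4m)) ⊕ K₀(C*_r(p6m)) of the Pimsner six-term exact sequence
for ℤ² ⋊ GL(2,ℤ). -/
def M : Matrix (Fin 17) (Fin 6) ℤ :=
  !![1, 0, 0, 0, 1, -1;
     0, 1, 0, 0, -1, 1;
     1, 0, 0, 0, 1, 0;
     0, 1, 0, 0, -1, 0;
     0, 0, 1, 1, 0, 0;
     0, 0, 0, 0, 1, 0;
     0, 0, 0, 0, 0, 1;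
     0, 0, 0, 0, 1, -1;
     0, 0, 0, 0, 0, 2;
     -1, 0, 0, 0, 0, 1;
     0, -1, 0, 0, 0, -1;
     0, 0, -1, 0, 0, 0;
     0, 0, 0, -1, 0, 0;
     0, 0, -1, -1, 0, 0;
     -1, -1, 0, 0, 0, 0;
     0, 0, 0, 0, 0, 0;
     0, 0, 0, 0, -1, -2]

/-- A linear map `f` with a retraction `l`, together with a complementary split projection
`g` vanishing on the range of `f`, is injective with cokernel the codomain of `g`. -/
theorem injective_and_nonempty_coker_equiv {R A B C : Type*} [Ring R]
    [AddCommGroup A] [AddCommGroup B] [AddCommGroup C] [Module R A] [Module R B] [Module R C]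
    (f : A →ₗ[R] B) (l : B →ₗ[R] A) (g : B →ₗ[R] C) (s : C →ₗ[R] B)
    (hlf : l ∘ₗ f = LinearMap.id) (hgf : g ∘ₗ f = 0) (hgs : g ∘ₗ s = LinearMap.id)
    (hadd : f ∘ₗ l + s ∘ₗ g = LinearMap.id) :
    Function.Injective f ∧ Nonempty ((B ⧸ LinearMap.range f) ≃ₗ[R] C) := by
  have hker : LinearMap.range f = LinearMap.ker g := by
    refine le_antisymm (LinearMap.range_le_ker_iff.2 hgf) fun x hx => ⟨l x, ?_⟩
    simpa [LinearMap.mem_ker.1 hx] using LinearMap.congr_fun hadd x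
  exact ⟨Function.LeftInverse.injective (LinearMap.congr_fun hlf),
    ⟨(Submodule.quotEquivOfEq _ _ hker).trans
      (g.quotKerEquivOfSurjective (Function.RightInverse.surjective (LinearMap.congr_fun hgs)))⟩⟩

/-- A left inverse of `M`, read off from a unimodular set of six rows. -/
def leftInverse : Matrix (Fin 6) (Fin 17) ℤ :=
  !![0, 0, 1, 0, 0, -1, 0, 0, 0, 0, 0, 0, 0, 0, 0, 0, 0;
     0, 0, 0, 1, 0, 1, 0, 0, 0, 0, 0, 0, 0, 0, 0, 0, 0;
     0, 0, 0, 0, 0, 0, 0, 0, 0, 0, 0, -1, 0, 0, 0, 0, 0;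
     0, 0, 0, 0, 0, 0, 0, 0, 0, 0, 0, 0, -1, 0, 0, 0, 0;
     0, 0, 0, 0, 0, 1, 0, 0, 0, 0, 0, 0, 0, 0, 0, 0, 0;
     0, 0, 0, 0, 0, 0, 1, 0, 0, 0, 0, 0, 0, 0, 0, 0, 0]

/-- The projection of `ℤ¹⁷` onto the cokernel of `M`. -/
def cokerProj : Matrix (Fin 11) (Fin 17) ℤ :=
  !![1, 0, -1, 0, 0, 0, 1, 0, 0, 0, 0, 0, 0, 0, 0, 0, 0;
     0, 1, 0, -1, 0, 0, -1, 0, 0, 0, 0, 0, 0, 0, 0, 0, 0;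
     0, 0, 0, 0, 1, 0, 0, 0, 0, 0, 0, 1, 1, 0, 0, 0, 0;
     0, 0, 0, 0, 0, -1, 1, 1, 0, 0, 0, 0, 0, 0, 0, 0, 0;
     0, 0, 0, 0, 0, 0, -2, 0, 1, 0, 0, 0, 0, 0, 0, 0, 0;
     0, 0, 1, 0, 0, -1, -1, 0, 0, 1, 0, 0, 0, 0, 0, 0, 0;
     0, 0, 0, 1, 0, 1, 1, 0, 0, 0, 1, 0, 0, 0, 0, 0, 0;
     0, 0, 0, 0, 0, 0, 0, 0, 0, 0, 0, -1, -1, 1, 0, 0, 0;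
     0, 0, 1, 1, 0, 0, 0, 0, 0, 0, 0, 0, 0, 0, 1, 0, 0;
     0, 0, 0, 0, 0, 0, 0, 0, 0, 0, 0, 0, 0, 0, 0, 1, 0;
     0, 0, 0, 0, 0, 1, 2, 0, 0, 0, 0, 0, 0, 0, 0, 0, 1]

/-- The section of `cokerProj` given by the coordinates complementary to the six rows. -/
def cokerSection : Matrix (Fin 17) (Fin 11) ℤ :=
  (1 : Matrix (Fin 17) (Fin 17) ℤ).submatrix id ![0, 1, 4, 7, 8, 9, 10, 13, 14, 15, 16]

/-- The map v ↦ M·v is injective and the cokernel ℤ¹⁷/range is free abelian of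
rank 11. -/
theorem statement12 :
    Function.Injective M.mulVecLin ∧
    Nonempty (((Fin 17 → ℤ) ⧸ LinearMap.range M.mulVecLin) ≃ₗ[ℤ] (Fin 11 → ℤ)) := by
  have hlf : leftInverse * M = 1 := by decide +kernel
  have hgf : cokerProj * M = 0 := by decide +kernel
  have hgs : cokerProj * cokerSection = 1 := by decide +kernel
  have hadd : M * leftInverse + cokerSection * cokerProj = 1 := by decide +kernel
  refine injective_and_nonempty_coker_equiv _ leftInverse.mulVecLin cokerProj.mulVecLin
    cokerSection.mulVecLin ?_ ?_ ?_ ?_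
  · rw [← Matrix.mulVecLin_mul, hlf, Matrix.mulVecLin_one]
  · rw [← Matrix.mulVecLin_mul, hgf, Matrix.mulVecLin_zero]
  · rw [← Matrix.mulVecLin_mul, hgs, Matrix.mulVecLin_one]
  · rw [← Matrix.mulVecLin_mul, ← Matrix.mulVecLin_mul, ← Matrix.mulVecLin_add, hadd,
      Matrix.mulVecLin_one]

end Statement12
end

section
/- Let M be the 10×6 integer matrix whose rows are (1,0,0,0,1,1), (0,1,0,0,0,1), (0,0,1,0,0,0), (0,0,0,1,0,0), (1,0,0,0,1,0), (0,1,0,0,0,0), (0,0,1,0,0,1), (0,0,0,1,0,1), (1,1,0,0,0,1), (0,0,1,1,1,1). Consider the group homomorphism f : ℤ⁶ → ℤ¹⁰ given by v ↦ M·v. Then f is injective and its image is a direct summand of ℤ¹⁰; equivalently, the cokernel ℤ¹⁰ / range(f) is a free abelian group of rank 4 (the Smith normal form of M has all six invariant factors equal to 1). -/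
namespace Statement13

/-- The 10×6 integer matrix recording the coordinates of the classes of the six
projections p₁,…,p₆ of the wallpaper group cmm = ℤ² ⋊ D₂ under the three evaluation
homomorphisms in K₀. -/
def M : Matrix (Fin 10) (Fin 6) ℤ :=
  !![1, 0, 0, 0, 1, 1;
     0, 1, 0, 0, 0, 1;
     0, 0, 1, 0, 0, 0;
     0, 0, 0, 1, 0, 0;
     1, 0, 0, 0, 1, 0;
     0, 1, 0, 0, 0, 0;
     0, 0, 1, 0, 0, 1;
     0, 0, 0, 1, 0, 1;
     1, 1, 0, 0, 0, 1;
     0, 0, 1, 1, 1, 1]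

/-- A left inverse of `M`. -/
def leftInv : Matrix (Fin 6) (Fin 10) ℤ :=
  !![0, -1, 0, 0, 0, 0, 0, 0, 1, 0;
     0, 0, 0, 0, 0, 1, 0, 0, 0, 0;
     0, 0, 1, 0, 0, 0, 0, 0, 0, 0;
     0, 0, 0, 1, 0, 0, 0, 0, 0, 0;
     0, 1, 0, 0, 1, 0, 0, 0, -1, 0;
     0, 1, 0, 0, 0, -1, 0, 0, 0, 0]

/-- The relations cutting out the range of `M`. -/
def relations : Matrix (Fin 4) (Fin 10) ℤ :=
  !![1, -1, 0, 0, -1, 1, 0, 0, 0, 0;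
     0, -1, -1, 0, 0, 1, 1, 0, 0, 0;
     0, -1, 0, -1, 0, 1, 0, 1, 0, 0;
     0, -2, -1, -1, -1, 1, 0, 0, 1, 1]

/-- A right inverse of `relations`, inserting the coordinates that `leftInv` ignores. -/
def relationsSection : Matrix (Fin 10) (Fin 4) ℤ :=
  !![1, 0, 0, 0;
     0, 0, 0, 0;
     0, 0, 0, 0;
     0, 0, 0, 0;
     0, 0, 0, 0;
     0, 0, 0, 0;
     0, 1, 0, 0;
     0, 0, 1, 0;
     0, 0, 0, 0;
     0, 0, 0, 1]

theorem leftInv_mul_M : leftInv * M = 1 := by decide +kernel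

theorem relations_mul_M : relations * M = 0 := by decide +kernel

theorem relations_mul_section : relations * relationsSection = 1 := by decide +kernel

theorem M_mul_leftInv_add : M * leftInv + relationsSection * relations = 1 := by
  decide +kernel

theorem leftInv_mulVec_M (v : Fin 6 → ℤ) : leftInv.mulVec (M.mulVec v) = v := by
  rw [Matrix.mulVec_mulVec, leftInv_mul_M, Matrix.one_mulVec]

theorem exact_M_relations : Function.Exact M.mulVecLin relations.mulVecLin := by
  intro y
  simp only [Matrix.mulVecLin_apply, Set.mem_range]
  constructor
  · intro hy
    refine ⟨leftInv.mulVec y, ?_⟩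
    have h := congrArg (fun A => A.mulVec y) M_mul_leftInv_add
    simpa [Matrix.add_mulVec, ← Matrix.mulVec_mulVec, hy] using h
  · rintro ⟨v, rfl⟩
    rw [Matrix.mulVec_mulVec, relations_mul_M, Matrix.zero_mulVec]

theorem relations_surjective : Function.Surjective relations.mulVecLin := fun w =>
  ⟨relationsSection.mulVec w, by
    rw [Matrix.mulVecLin_apply, Matrix.mulVec_mulVec, relations_mul_section,
      Matrix.one_mulVec]⟩

theorem isCompl_range_M_ker_leftInv :
    IsCompl (LinearMap.range M.mulVecLin) (LinearMap.ker leftInv.mulVecLin) := by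
  refine ⟨Submodule.disjoint_def.2 ?_, codisjoint_iff.2 (eq_top_iff.2 fun y _ => ?_)⟩
  · rintro _ ⟨v, rfl⟩ hv
    have hv' : leftInv.mulVec (M.mulVec v) = 0 := hv
    rw [leftInv_mulVec_M] at hv'
    rw [hv', map_zero]
  · refine Submodule.mem_sup.2 ⟨M.mulVec (leftInv.mulVec y), ⟨_, rfl⟩,
      y - M.mulVec (leftInv.mulVec y), ?_, add_sub_cancel _ _⟩
    rw [LinearMap.mem_ker, Matrix.mulVecLin_apply, Matrix.mulVec_sub, leftInv_mulVec_M, sub_self]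

/-- The map v ↦ M·v is injective, its image is a direct summand of ℤ¹⁰, and the
cokernel ℤ¹⁰/range is free abelian of rank 4 (all six invariant factors of the Smith
normal form of M are 1). -/
theorem statement13 :
    Function.Injective M.mulVecLin ∧
    (∃ W : Submodule ℤ (Fin 10 → ℤ), IsCompl (LinearMap.range M.mulVecLin) W) ∧
    Nonempty (((Fin 10 → ℤ) ⧸ LinearMap.range M.mulVecLin) ≃ₗ[ℤ] (Fin 4 → ℤ)) := by
  refine ⟨Function.LeftInverse.injective leftInv_mulVec_M, ⟨_, isCompl_range_M_ker_leftInv⟩,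
    ⟨exact_M_relations.linearEquivOfSurjective relations_surjective⟩⟩

end Statement13
end

section
/- Let M be the 14×9 integer matrix whose rows are (1,0,0,0,0,0,0,0,1), (0,1,0,0,0,1,0,0,0), (0,0,1,0,0,0,1,0,0), (0,0,0,1,0,0,0,1,1), (0,0,0,0,1,0,0,0,0), (1,0,0,0,0,0,1,0,0), (0,1,0,0,0,0,0,1,0), (0,0,1,0,0,0,0,0,0), (0,0,0,1,0,1,0,0,0), (0,0,0,0,1,0,0,0,1), (1,0,0,1,0,0,0,0,1), (0,1,1,0,0,0,0,0,0), (0,0,0,0,1,0,0,1,0), (0,0,0,0,1,1,1,0,1). Consider the group homomorphism f : ℤ⁹ → ℤ¹⁴ given by v ↦ M·v. Then f is injective and its image is a direct summand of ℤ¹⁴; equivalently, the cokernel ℤ¹⁴ / range(f) is a free abelian group of rank 5 (the Smith normal form of M has all nine invariant factors equal to 1). -/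
namespace Statement14

/-- The 14×9 integer matrix recording the coordinates of the classes of the nine
projections p₁,…,p₉ of the wallpaper group p4m = ℤ² ⋊ D₄ under the three evaluation
homomorphisms in K₀. -/
def M : Matrix (Fin 14) (Fin 9) ℤ :=
  !![1, 0, 0, 0, 0, 0, 0, 0, 1;
     0, 1, 0, 0, 0, 1, 0, 0, 0;
     0, 0, 1, 0, 0, 0, 1, 0, 0;
     0, 0, 0, 1, 0, 0, 0, 1, 1;
     0, 0, 0, 0, 1, 0, 0, 0, 0;
     1, 0, 0, 0, 0, 0, 1, 0, 0;
     0, 1, 0, 0, 0, 0, 0, 1, 0;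
     0, 0, 1, 0, 0, 0, 0, 0, 0;
     0, 0, 0, 1, 0, 1, 0, 0, 0;
     0, 0, 0, 0, 1, 0, 0, 0, 1;
     1, 0, 0, 1, 0, 0, 0, 0, 1;
     0, 1, 1, 0, 0, 0, 0, 0, 0;
     0, 0, 0, 0, 1, 0, 0, 1, 0;
     0, 0, 0, 0, 1, 1, 1, 0, 1]

/-- A left inverse of `M`. -/
def leftInverse : Matrix (Fin 9) (Fin 14) ℤ :=
  !![1, 0, 0, 0, 1, 0, 0, 0, 0, -1, 0, 0, 0, 0;
     0, 0, 0, 0, 0, 0, 0, -1, 0, 0, 0, 1, 0, 0;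
     0, 0, 0, 0, 0, 0, 0, 1, 0, 0, 0, 0, 0, 0;
     -1, 0, 0, 0, 0, 0, 0, 0, 0, 0, 1, 0, 0, 0;
     0, 0, 0, 0, 1, 0, 0, 0, 0, 0, 0, 0, 0, 0;
     0, 1, 0, 0, 0, 0, 0, 1, 0, 0, 0, -1, 0, 0;
     0, 0, 1, 0, 0, 0, 0, -1, 0, 0, 0, 0, 0, 0;
     0, 0, 0, 0, -1, 0, 0, 0, 0, 0, 0, 0, 1, 0;
     0, 0, 0, 0, -1, 0, 0, 0, 0, 1, 0, 0, 0, 0]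

/-- A matrix whose kernel is the range of `M`. -/
def cokernelProjection : Matrix (Fin 5) (Fin 14) ℤ :=
  !![1, 0, 0, 1, 2, 0, 0, 0, 0, -1, -1, 0, -1, 0;
     -1, 0, -1, 0, -1, 1, 0, 1, 0, 1, 0, 0, 0, 0;
     0, 0, 0, 0, 1, 0, 1, 1, 0, 0, 0, -1, -1, 0;
     1, -1, 0, 0, 0, 0, 0, -1, 1, 0, -1, 1, 0, 0;
     0, -1, -1, 0, 0, 0, 0, 0, 0, -1, 0, 1, 0, 1]

/-- A section of `cokernelProjection`, spanning a complement of the range of `M`. -/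
def cokernelSection : Matrix (Fin 14) (Fin 5) ℤ :=
  !![0, 0, 0, 0, 0;
     0, 0, 0, 0, 0;
     0, 0, 0, 0, 0;
     1, 0, 0, 0, 0;
     0, 0, 0, 0, 0;
     0, 1, 0, 0, 0;
     0, 0, 1, 0, 0;
     0, 0, 0, 0, 0;
     0, 0, 0, 1, 0;
     0, 0, 0, 0, 0;
     0, 0, 0, 0, 0;
     0, 0, 0, 0, 0;
     0, 0, 0, 0, 0;
     0, 0, 0, 0, 1]

theorem leftInverse_mul_M : leftInverse * M = 1 := by
  decide +kernel

theorem cokernelProjection_mul_M : cokernelProjection * M = 0 := by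
  decide +kernel

theorem cokernelProjection_mul_cokernelSection :
    cokernelProjection * cokernelSection = 1 := by
  decide +kernel

theorem M_mul_leftInverse_add :
    M * leftInverse + cokernelSection * cokernelProjection = 1 := by
  decide +kernel

theorem leftInverse_comp_M :
    leftInverse.mulVecLin ∘ₗ M.mulVecLin = LinearMap.id := by
  rw [← Matrix.mulVecLin_mul, leftInverse_mul_M, Matrix.mulVecLin_one]

theorem range_M_eq_ker :
    LinearMap.range M.mulVecLin = LinearMap.ker cokernelProjection.mulVecLin := by
  apply le_antisymm
  · rw [LinearMap.range_le_ker_iff, ← Matrix.mulVecLin_mul, cokernelProjection_mul_M,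
      Matrix.mulVecLin_zero]
  · intro x hx
    have hx' : cokernelProjection.mulVec x = 0 := hx
    refine ⟨leftInverse.mulVec x, ?_⟩
    have h := congrArg (fun A => A.mulVec x) M_mul_leftInverse_add
    simpa [Matrix.add_mulVec, ← Matrix.mulVec_mulVec, hx'] using h

theorem cokernelProjection_surjective :
    Function.Surjective cokernelProjection.mulVecLin := fun y =>
  ⟨cokernelSection.mulVec y, by
    rw [Matrix.mulVecLin_apply, Matrix.mulVec_mulVec, cokernelProjection_mul_cokernelSection,
      Matrix.one_mulVec]⟩

/-- The map v ↦ M·v is injective, its image is a direct summand of ℤ¹⁴, and the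
cokernel ℤ¹⁴/range is free abelian of rank 5 (all nine invariant factors of the Smith
normal form of M are 1). -/
theorem statement14 :
    Function.Injective M.mulVecLin ∧
    (∃ W : Submodule ℤ (Fin 14 → ℤ), IsCompl (LinearMap.range M.mulVecLin) W) ∧
    Nonempty (((Fin 14 → ℤ) ⧸ LinearMap.range M.mulVecLin) ≃ₗ[ℤ] (Fin 5 → ℤ)) := by
  have hinj : Function.LeftInverse leftInverse.mulVecLin M.mulVecLin :=
    LinearMap.congr_fun leftInverse_comp_M
  refine ⟨hinj.injective, ⟨LinearMap.ker leftInverse.mulVecLin, ?_⟩, ?_⟩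
  · refine ⟨Submodule.disjoint_def.2 ?_, codisjoint_iff.2 (eq_top_iff.2 fun x _ => ?_)⟩
    · rintro _ ⟨v, rfl⟩ hv
      rw [LinearMap.mem_ker, hinj v] at hv
      rw [hv, map_zero]
    · refine Submodule.mem_sup.2 ⟨_, ⟨leftInverse.mulVecLin x, rfl⟩,
        x - M.mulVecLin (leftInverse.mulVecLin x), ?_, add_sub_cancel _ _⟩
      rw [LinearMap.mem_ker, map_sub, hinj, sub_self]
  · exact ⟨(Submodule.quotEquivOfEq _ _ range_M_eq_ker).trans
      (cokernelProjection.mulVecLin.quotKerEquivOfSurjective cokernelProjection_surjective)⟩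

end Statement14
end

section
/- Let M be the 13×8 integer matrix whose rows are (1,0,0,0,0,0,1,1), (0,1,0,0,0,0,0,0), (0,0,1,0,0,0,0,0), (0,0,0,1,0,0,1,0), (0,0,0,0,1,0,0,0), (0,0,0,0,0,1,0,1), (1,0,0,1,0,0,0,1), (0,1,1,0,0,0,0,0), (0,0,0,0,1,1,1,1), (2,-1,0,0,0,1,1,1), (-1,2,0,0,0,1,0,0), (0,0,2,-1,1,0,0,1), (0,0,-1,2,1,0,1,1). Consider the group homomorphism f : ℤ⁸ → ℤ¹³ given by v ↦ M·v. Then f is injective and its image is a direct summand of ℤ¹³; equivalently, the cokernel ℤ¹³ / range(f) is a free abelian group of rank 5 (the Smith normal form of M has all eight invariant factors equal to 1). -/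
namespace Statement15

/-- The 13×8 integer matrix recording the coordinates of the classes of the eight
projections p₁,…,p₈ of the wallpaper group p6m = ℤ² ⋊ D₆ under the three evaluation
homomorphisms in K₀. -/
def M : Matrix (Fin 13) (Fin 8) ℤ :=
  !![1, 0, 0, 0, 0, 0, 1, 1;
     0, 1, 0, 0, 0, 0, 0, 0;
     0, 0, 1, 0, 0, 0, 0, 0;
     0, 0, 0, 1, 0, 0, 1, 0;
     0, 0, 0, 0, 1, 0, 0, 0;
     0, 0, 0, 0, 0, 1, 0, 1;
     1, 0, 0, 1, 0, 0, 0, 1;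
     0, 1, 1, 0, 0, 0, 0, 0;
     0, 0, 0, 0, 1, 1, 1, 1;
     2, -1, 0, 0, 0, 1, 1, 1;
     -1, 2, 0, 0, 0, 1, 0, 0;
     0, 0, 2, -1, 1, 0, 0, 1;
     0, 0, -1, 2, 1, 0, 1, 1]

/-- A left inverse of `M`. -/
def retraction : Matrix (Fin 8) (Fin 13) ℤ :=
  !![1, 0, 2, -1, 1, 0, 0, 0, 0, 0, 0, -1, 0;
     0, 1, 0, 0, 0, 0, 0, 0, 0, 0, 0, 0, 0;
     0, 0, 1, 0, 0, 0, 0, 0, 0, 0, 0, 0, 0;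
     0, 0, 0, 1, 1, 1, 0, 0, -1, 0, 0, 0, 0;
     0, 0, 0, 0, 1, 0, 0, 0, 0, 0, 0, 0, 0;
     0, 0, 2, -1, 0, 0, 0, 0, 1, 0, 0, -1, 0;
     0, 0, 0, 0, -1, -1, 0, 0, 1, 0, 0, 0, 0;
     0, 0, -2, 1, 0, 1, 0, 0, -1, 0, 0, 1, 0]

/-- A matrix presenting the cokernel of `M`. -/
def cokernelMap : Matrix (Fin 5) (Fin 13) ℤ :=
  !![-1, 0, 0, -1, -2, -2, 1, 0, 2, 0, 0, 0, 0;
     0, -1, -1, 0, 0, 0, 0, 1, 0, 0, 0, 0, 0;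
     -2, 1, -4, 2, -1, 0, 0, 0, -1, 1, 0, 2, 0;
     1, -2, 0, 0, 1, 0, 0, 0, -1, 0, 1, 0, 0;
     0, 0, 3, -3, -2, -2, 0, 0, 2, 0, 0, -1, 1]

/-- A right inverse of `cokernelMap`; its columns span a complement of the range of `M`. -/
def cokernelSection : Matrix (Fin 13) (Fin 5) ℤ :=
  !![0, 0, 0, 0, 0;
     0, 0, 0, 0, 0;
     0, 0, 0, 0, 0;
     0, 0, 0, 0, 0;
     0, 0, 0, 0, 0;
     0, 0, 0, 0, 0;
     1, 0, 0, 0, 0;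
     0, 1, 0, 0, 0;
     0, 0, 0, 0, 0;
     0, 0, 1, 0, 0;
     0, 0, 0, 1, 0;
     0, 0, 0, 0, 0;
     0, 0, 0, 0, 1]

/-- If matrices `A`, `L`, `N`, `C` exhibit `m → R` as a biproduct of `n → R` and `k → R`, then `A`
is injective, its range is complemented, and its cokernel is free on `k`. -/
theorem split_injective_of_biproduct {R m n k : Type*} [CommRing R] [Fintype m] [DecidableEq m]
    [Fintype n] [DecidableEq n] [Fintype k] [DecidableEq k]
    {A : Matrix m n R} {L : Matrix n m R} {N : Matrix m k R} {C : Matrix k m R}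
    (hLA : L * A = 1) (hCA : C * A = 0) (hCN : C * N = 1) (hsum : A * L + N * C = 1) :
    Function.Injective A.mulVecLin ∧
    (∃ W : Submodule R (m → R), IsCompl (LinearMap.range A.mulVecLin) W) ∧
    Nonempty (((m → R) ⧸ LinearMap.range A.mulVecLin) ≃ₗ[R] (k → R)) := by
  have hLA' : L.mulVecLin ∘ₗ A.mulVecLin = LinearMap.id := by
    rw [← Matrix.mulVecLin_mul, hLA, Matrix.mulVecLin_one]
  have hC : Function.Surjective C.mulVecLin := fun w =>
    ⟨N.mulVec w, by simp [Matrix.mulVec_mulVec, hCN]⟩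
  have hrange : LinearMap.range A.mulVecLin = LinearMap.ker C.mulVecLin := by
    ext v
    simp only [LinearMap.mem_range, LinearMap.mem_ker, Matrix.mulVecLin_apply]
    constructor
    · rintro ⟨u, rfl⟩
      simp [Matrix.mulVec_mulVec, hCA]
    · intro hv
      refine ⟨L.mulVec v, ?_⟩
      have h := congrArg (fun B => B.mulVec v) hsum
      simpa [Matrix.add_mulVec, ← Matrix.mulVec_mulVec, hv] using h
  refine ⟨LinearMap.injective_of_comp_eq_id _ _ hLA',
    ⟨LinearMap.ker L.mulVecLin, ?_⟩, ?_⟩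
  · constructor
    · rw [Submodule.disjoint_def]
      rintro _ ⟨u, rfl⟩ hu
      have h : u = 0 := (LinearMap.congr_fun hLA' u).symm.trans hu
      simp [h]
    · rw [codisjoint_iff, Submodule.eq_top_iff']
      intro v
      refine Submodule.mem_sup.2 ⟨A.mulVecLin (L.mulVecLin v), ⟨_, rfl⟩,
        v - A.mulVecLin (L.mulVecLin v), ?_, by simp⟩
      rw [LinearMap.mem_ker, map_sub, sub_eq_zero]
      exact (LinearMap.congr_fun hLA' (L.mulVecLin v)).symm
  · rw [hrange]
    exact ⟨C.mulVecLin.quotKerEquivOfSurjective hC⟩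

/-- The map v ↦ M·v is injective, its image is a direct summand of ℤ¹³, and the
cokernel ℤ¹³/range is free abelian of rank 5 (all eight invariant factors of the Smith
normal form of M are 1). -/
theorem statement15 :
    Function.Injective M.mulVecLin ∧
    (∃ W : Submodule ℤ (Fin 13 → ℤ), IsCompl (LinearMap.range M.mulVecLin) W) ∧
    Nonempty (((Fin 13 → ℤ) ⧸ LinearMap.range M.mulVecLin) ≃ₗ[ℤ] (Fin 5 → ℤ)) :=
  split_injective_of_biproduct (L := retraction) (N := cokernelSection) (C := cokernelMap)
    (by decide) (by decide) (by decide) (by decide)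

end Statement15
end

section
/- Let p2 = ℤ² ⋊ ⟨-1⟩ be the semidirect product of ℤ² by the order-2 subgroup of SL(2,ℤ) generated by -1 (which acts on ℤ² by negation). Then every element of order 2 in p2 is conjugate in p2 to exactly one of the four elements ((0,0), -1), ((1,0), -1), ((0,1), -1), ((1,1), -1); in particular these four involutions are pairwise non-conjugate in p2, and every involution of p2 is conjugate to one of them. -/
namespace Statement16

abbrev SL2Z := Matrix.SpecialLinearGroup (Fin 2) ℤ

/-- ℤ², written multiplicatively so that it can be used in `SemidirectProduct`. -/
abbrev Z2 := Multiplicative (Fin 2 → ℤ)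

/-- A linear automorphism of ℤ² gives an automorphism of the (multiplicatively written)
group ℤ². -/
def linToMulAut : ((Fin 2 → ℤ) ≃ₗ[ℤ] (Fin 2 → ℤ)) →* MulAut Z2 where
  toFun e := AddEquiv.toMultiplicative e.toAddEquiv
  map_one' := by ext x; rfl
  map_mul' e f := by ext x; rfl

/-- The natural (matrix-times-column-vector) action of SL(2,ℤ) on ℤ². -/
def φ : SL2Z →* MulAut Z2 :=
  linToMulAut.comp Matrix.SpecialLinearGroup.toLin'

/-- The order-2 subgroup ⟨-1⟩ of SL(2,ℤ). -/
def C2 : Subgroup SL2Z := Subgroup.zpowers (-1)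

/-- p2 = ℤ² ⋊ ⟨-1⟩, where -1 acts on ℤ² by negation. -/
abbrev p2 := Z2 ⋊[φ.comp C2.subtype] C2

/-- The element ((m₁,m₂), -1) of p2. -/
def e (m : Fin 2 → ℤ) : p2 :=
  ⟨Multiplicative.ofAdd m, ⟨-1, Subgroup.mem_zpowers _⟩⟩

/-- The four involutions ((0,0),-1), ((1,0),-1), ((0,1),-1), ((1,1),-1) of p2. -/
def reps : Fin 4 → p2 :=
  ![e ![0, 0], e ![1, 0], e ![0, 1], e ![1, 1]]

/-- The nontrivial element of `C2`. -/
def negOne : C2 := ⟨-1, Subgroup.mem_zpowers _⟩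

lemma negOne_mul_self : negOne * negOne = 1 := Subtype.ext (by simp [negOne])

lemma negOne_inv : negOne⁻¹ = negOne := inv_eq_of_mul_eq_one_left negOne_mul_self

lemma negOne_ne_one : negOne ≠ 1 := by
  intro h
  have h' := congrArg (fun g : C2 => (g : SL2Z) 0 0) h
  simp [negOne] at h'

lemma eq_one_or_eq_negOne (c : C2) : c = 1 ∨ c = negOne := by
  obtain ⟨c, n, rfl⟩ := c
  rcases Int.even_or_odd n with h | h
  · left
    ext1
    simp [h.neg_one_zpow]
  · right
    ext1
    simp [h.neg_one_zpow, negOne]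

lemma action_negOne (v : Z2) : (φ.comp C2.subtype) negOne v = v⁻¹ := by
  change Multiplicative.ofAdd (Matrix.SpecialLinearGroup.toLin' (-1 : SL2Z) v.toAdd) = v⁻¹
  rw [Matrix.SpecialLinearGroup.toLin'_apply]
  simp

lemma e_left (m : Fin 2 → ℤ) : (e m).left = Multiplicative.ofAdd m := rfl

lemma e_right (m : Fin 2 → ℤ) : (e m).right = negOne := rfl

lemma orderOf_e (m : Fin 2 → ℤ) : orderOf (e m) = 2 := by
  refine orderOf_eq_prime ?_ fun h => negOne_ne_one (congrArg SemidirectProduct.right h)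
  rw [pow_two]
  ext1
  · simp only [SemidirectProduct.mul_left, e_left, e_right, action_negOne,
      SemidirectProduct.one_left, mul_inv_cancel]
  · exact negOne_mul_self

lemma exists_eq_e_of_orderOf_eq_two {x : p2} (hx : orderOf x = 2) : ∃ m, x = e m := by
  obtain ⟨v, c⟩ := x
  rcases eq_one_or_eq_negOne c with rfl | rfl
  · exfalso
    have h := pow_orderOf_eq_one (⟨v, 1⟩ : p2)
    rw [hx, pow_two] at h
    have hv : v * v = 1 := by simpa using congrArg SemidirectProduct.left h
    have hv1 : v = 1 := by
      apply Multiplicative.toAdd.injective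
      funext i
      have := congrFun (congrArg Multiplicative.toAdd hv) i
      simp only [toAdd_mul, toAdd_one, Pi.add_apply, Pi.zero_apply] at this ⊢
      omega
    subst hv1
    have : orderOf (⟨1, 1⟩ : p2) = 1 := orderOf_one
    omega
  · exact ⟨v.toAdd, rfl⟩

/-- Conjugating `(m, -1)` by `(w, ±1)` gives `(2w ± m, -1)`, so the conjugacy class of `(m, -1)`
is determined by `m` modulo 2. -/
lemma isConj_e_iff (m n : Fin 2 → ℤ) : IsConj (e m) (e n) ↔ ∀ i, m i % 2 = n i % 2 := by
  rw [isConj_iff]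
  constructor
  · rintro ⟨⟨w, c⟩, h⟩ i
    rw [mul_inv_eq_iff_eq_mul] at h
    have h' := congrFun (congrArg (fun x : p2 => x.left.toAdd) h) i
    rcases eq_one_or_eq_negOne c with rfl | rfl <;>
    · simp only [SemidirectProduct.mul_left, e_left, e_right, action_negOne, map_one,
        MulAut.one_apply, toAdd_mul, toAdd_inv, toAdd_ofAdd, Pi.add_apply, Pi.neg_apply] at h'
      omega
  · intro h
    refine ⟨⟨Multiplicative.ofAdd fun i => (n i - m i) / 2, 1⟩, ?_⟩
    rw [mul_inv_eq_iff_eq_mul]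
    ext1
    · apply Multiplicative.toAdd.injective
      funext i
      have := h i
      simp only [SemidirectProduct.mul_left, e_left, e_right, action_negOne, map_one,
        MulAut.one_apply, toAdd_mul, toAdd_inv, toAdd_ofAdd, Pi.add_apply, Pi.neg_apply]
      omega
    · simp [e_right]

/-- The listed elements are involutions, and every element of order 2 in p2 is
conjugate in p2 to exactly one of them; in particular they are pairwise non-conjugate
and every involution is conjugate to one of them. -/
theorem statement16 :
    (∀ i : Fin 4, orderOf (reps i) = 2) ∧
    (∀ x : p2, orderOf x = 2 → ∃! i : Fin 4, IsConj x (reps i)) := by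
  refine ⟨fun i => by fin_cases i <;> exact orderOf_e _, fun x hx => ?_⟩
  obtain ⟨m, rfl⟩ := exists_eq_e_of_orderOf_eq_two hx
  have key : ∀ i : Fin 4, IsConj (e m) (reps i) ↔
      m 0 % 2 = (![0, 1, 0, 1] : Fin 4 → ℤ) i ∧ m 1 % 2 = (![0, 0, 1, 1] : Fin 4 → ℤ) i := by
    intro i
    fin_cases i <;> exact (isConj_e_iff _ _).trans Fin.forall_fin_two
  simp only [key]
  rcases Int.emod_two_eq_zero_or_one (m 0) with h0 | h0 <;>
    rcases Int.emod_two_eq_zero_or_one (m 1) with h1 | h1 <;>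
    simp only [h0, h1, ExistsUnique] <;> decide

end Statement16
end

section
/- Let S = !![0,-1;1,0] ∈ SL(2,ℤ) and let p4 = ℤ² ⋊ ⟨S⟩ be the semidirect product of ℤ² by the cyclic group of order 4 generated by S (acting on ℤ² by matrix multiplication). Write u = ((1,0), 1) and identify S with ((0,0), S). Then: (i) the elements S and uS both have order 4 and are not conjugate in p4; (ii) the element uS² has order 2 and is conjugate in p4 neither to S² nor to (uS)² = ((1,1), S²). -/
namespace Statement17

abbrev SL2Z := Matrix.SpecialLinearGroup (Fin 2) ℤ

/-- ℤ², written multiplicatively so that it can be used in `SemidirectProduct`. -/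
abbrev Z2 := Multiplicative (Fin 2 → ℤ)

/-- A linear automorphism of ℤ² gives an automorphism of the (multiplicatively written)
group ℤ². -/
def linToMulAut : ((Fin 2 → ℤ) ≃ₗ[ℤ] (Fin 2 → ℤ)) →* MulAut Z2 where
  toFun e := AddEquiv.toMultiplicative e.toAddEquiv
  map_one' := by ext x; rfl
  map_mul' e f := by ext x; rfl

/-- The natural (matrix-times-column-vector) action of SL(2,ℤ) on ℤ². -/
def φ : SL2Z →* MulAut Z2 :=
  linToMulAut.comp Matrix.SpecialLinearGroup.toLin'

/-- S = [[0,-1],[1,0]] in SL(2,ℤ), of order 4. -/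
def Smat : SL2Z := ⟨!![0, -1; 1, 0], by decide⟩

/-- The cyclic subgroup ⟨S⟩ of SL(2,ℤ). -/
def C4 : Subgroup SL2Z := Subgroup.zpowers Smat

/-- p4 = ℤ² ⋊ ⟨S⟩, where S acts on ℤ² by matrix multiplication. -/
abbrev p4 := Z2 ⋊[φ.comp C4.subtype] C4

/-- u = ((1,0), 1) in p4. -/
def u : p4 := ⟨Multiplicative.ofAdd ![1, 0], 1⟩

/-- S viewed as the element ((0,0), S) of p4. -/
def S : p4 := ⟨1, ⟨Smat, Subgroup.mem_zpowers _⟩⟩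

/-- The homomorphism ℤ² → ℤ/2 sending a vector to the sum of its coordinates mod 2. -/
def parityZ2 : Z2 →* Multiplicative (ZMod 2) :=
  AddMonoidHom.toMultiplicative
    { toFun := fun m => ((m 0 + m 1 : ℤ) : ZMod 2)
      map_zero' := by simp
      map_add' := fun a b => by
        simp only [Pi.add_apply]
        push_cast
        ring }

lemma parityZ2_apply (m : Z2) :
    parityZ2 m = Multiplicative.ofAdd ((m.toAdd 0 + m.toAdd 1 : ℤ) : ZMod 2) := rfl

lemma φ_Smat_apply (m : Z2) :
    φ Smat m = Multiplicative.ofAdd ![-m.toAdd 1, m.toAdd 0] := by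
  change Multiplicative.ofAdd (Matrix.mulVec !![0, -1; 1, 0] m.toAdd) = _
  congr 1
  ext i
  fin_cases i <;> simp [Matrix.mulVec, dotProduct, Fin.sum_univ_two]

lemma parityZ2_φ_Smat (m : Z2) : parityZ2 (φ Smat m) = parityZ2 m := by
  rw [φ_Smat_apply, parityZ2_apply, parityZ2_apply]
  congr 1
  simp [CharTwo.neg_eq, add_comm]

lemma parityZ2_φ_of_mem_C4 {g : SL2Z} (hg : g ∈ C4) (m : Z2) :
    parityZ2 (φ g m) = parityZ2 m := by
  rw [C4, Subgroup.zpowers_eq_closure] at hg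
  induction hg using Subgroup.closure_induction generalizing m with
  | mem x hx => rw [Set.mem_singleton_iff.mp hx, parityZ2_φ_Smat]
  | one => simp
  | mul x y _ _ hx hy => rw [map_mul, MulAut.mul_apply, hx, hy]
  | inv x _ hx => rw [← hx, ← MulAut.mul_apply, ← map_mul, mul_inv_cancel, map_one,
      MulAut.one_apply]

/-- The parity of the translation part is a homomorphism on p4, since ⟨S⟩ preserves parity. -/
def parity : p4 →* Multiplicative (ZMod 2) :=
  SemidirectProduct.lift parityZ2 1 fun g => by
    refine MonoidHom.ext fun m => ?_
    simpa using parityZ2_φ_of_mem_C4 g.2 m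

lemma parity_apply (x : p4) : parity x = parityZ2 x.left := by
  simp [parity, SemidirectProduct.lift]

lemma parity_S : parity S = 1 := by
  rw [parity_apply]
  exact map_one _

lemma parity_u : parity u = Multiplicative.ofAdd 1 := by
  rw [parity_apply, parityZ2_apply]
  simp [u]

lemma not_isConj_of_parity_ne {x y : p4} (h : parity x ≠ parity y) : ¬ IsConj x y :=
  fun hc => h (isConj_iff_eq.mp (parity.map_isConj hc))

lemma S_mul_inl (m : Z2) :
    S * SemidirectProduct.inl m =
      SemidirectProduct.inl (Multiplicative.ofAdd ![-m.toAdd 1, m.toAdd 0]) * S := by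
  ext1
  · simp [S, ← φ_Smat_apply]
  · simp

lemma u_eq_inl : u = SemidirectProduct.inl (Multiplicative.ofAdd ![1, 0]) := rfl

lemma S_eq_inr : S = SemidirectProduct.inr ⟨Smat, Subgroup.mem_zpowers _⟩ := rfl

lemma S_pow_four : S ^ 4 = 1 := by
  rw [S_eq_inr, ← map_pow]
  have : (⟨Smat, Subgroup.mem_zpowers _⟩ : C4) ^ 4 = 1 := Subtype.ext (by decide)
  rw [this, map_one]

lemma Smat_sq_ne_one : Smat ^ 2 ≠ 1 := by decide

lemma u_mul_S_sq : (u * S) ^ 2 =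
    SemidirectProduct.inl (Multiplicative.ofAdd ![1, 1]) * S ^ 2 := by
  rw [sq, mul_assoc, ← mul_assoc S, u_eq_inl, S_mul_inl, mul_assoc, ← mul_assoc, ← map_mul,
    ← ofAdd_add, ← sq]
  simp

lemma inl_mul_S_sq_sq (m : Z2) : (SemidirectProduct.inl m * S ^ 2) ^ 2 = 1 := by
  have h : S ^ 2 * SemidirectProduct.inl m = SemidirectProduct.inl m⁻¹ * S ^ 2 := by
    rw [sq, mul_assoc, S_mul_inl, ← mul_assoc, S_mul_inl, mul_assoc]
    congr 2
    apply Multiplicative.toAdd.injective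
    ext i
    fin_cases i <;> simp
  rw [sq, mul_assoc, ← mul_assoc (S ^ 2), h, mul_assoc, ← mul_assoc, ← map_mul,
    mul_inv_cancel, map_one, one_mul, ← pow_add, S_pow_four]

lemma sq_ne_one_of_right_eq_Smat {x : p4} (hx : (x.right : SL2Z) = Smat) : x ^ 2 ≠ 1 := by
  intro h
  apply Smat_sq_ne_one
  have := congrArg (fun y : p4 => (y.right : SL2Z)) h
  simpa [sq, hx] using this

/-- (i) S and uS have order 4 and are not conjugate in p4; (ii) uS² has order 2 and is
conjugate in p4 neither to S² nor to (uS)². -/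
theorem statement17 :
    orderOf S = 4 ∧ orderOf (u * S) = 4 ∧ ¬ IsConj S (u * S) ∧
    orderOf (u * S ^ 2) = 2 ∧ ¬ IsConj (u * S ^ 2) (S ^ 2) ∧
    ¬ IsConj (u * S ^ 2) ((u * S) ^ 2) := by
  have hS : parity (u * S) = Multiplicative.ofAdd 1 := by
    rw [map_mul, parity_u, parity_S, mul_one]
  have hS2 : parity (u * S ^ 2) = Multiplicative.ofAdd 1 := by
    rw [map_mul, map_pow, parity_u, parity_S, one_pow, mul_one]
  refine ⟨?_, ?_, ?_, ?_, ?_, ?_⟩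
  · exact orderOf_eq_prime_pow (p := 2) (n := 1)
      (sq_ne_one_of_right_eq_Smat rfl) S_pow_four
  · refine orderOf_eq_prime_pow (p := 2) (n := 1)
      (sq_ne_one_of_right_eq_Smat (by simp [u, S])) ?_
    rw [pow_succ, pow_mul, pow_one, u_mul_S_sq, inl_mul_S_sq_sq]
  · apply not_isConj_of_parity_ne
    rw [hS, parity_S]
    decide
  · refine orderOf_eq_prime (inl_mul_S_sq_sq _) fun h => ?_
    rw [h, map_one] at hS2
    exact absurd hS2 (by decide)
  · apply not_isConj_of_parity_ne
    rw [hS2, map_pow, parity_S]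
    decide
  · apply not_isConj_of_parity_ne
    rw [hS2, map_pow, hS]
    decide

end Statement17
end

section
/- Let R = !![0,-1;1,1] ∈ SL(2,ℤ) and let p6 = ℤ² ⋊ ⟨R⟩ be the semidirect product of ℤ² by the cyclic group of order 6 generated by R (acting on ℤ² by matrix multiplication). Write u = ((1,0), 1) and identify R with ((0,0), R). Then: (i) the element uR² has order 3 and is not conjugate in p6 to R²; (ii) the element uR³ has order 2 and is not conjugate in p6 to R³. -/
namespace Statement18

abbrev SL2Z := Matrix.SpecialLinearGroup (Fin 2) ℤ

/-- ℤ², written multiplicatively so that it can be used in `SemidirectProduct`. -/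
abbrev Z2 := Multiplicative (Fin 2 → ℤ)

/-- A linear automorphism of ℤ² gives an automorphism of the (multiplicatively written)
group ℤ². -/
def linToMulAut : ((Fin 2 → ℤ) ≃ₗ[ℤ] (Fin 2 → ℤ)) →* MulAut Z2 where
  toFun e := AddEquiv.toMultiplicative e.toAddEquiv
  map_one' := by ext x; rfl
  map_mul' e f := by ext x; rfl

/-- The natural (matrix-times-column-vector) action of SL(2,ℤ) on ℤ². -/
def φ : SL2Z →* MulAut Z2 :=
  linToMulAut.comp Matrix.SpecialLinearGroup.toLin'

/-- R = [[0,-1],[1,1]] in SL(2,ℤ), of order 6. -/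
def Rmat : SL2Z := ⟨!![0, -1; 1, 1], by decide⟩

/-- The cyclic subgroup ⟨R⟩ of SL(2,ℤ). -/
def C6 : Subgroup SL2Z := Subgroup.zpowers Rmat

/-- p6 = ℤ² ⋊ ⟨R⟩, where R acts on ℤ² by matrix multiplication. -/
abbrev p6 := Z2 ⋊[φ.comp C6.subtype] C6

/-- u = ((1,0), 1) in p6. -/
def u : p6 := ⟨Multiplicative.ofAdd ![1, 0], 1⟩

/-- R viewed as the element ((0,0), R) of p6. -/
def R : p6 := ⟨1, ⟨Rmat, Subgroup.mem_zpowers _⟩⟩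

theorem Rmat_pow_six : Rmat ^ 6 = 1 := by decide

theorem exists_pow_of_mem_C6 {g : SL2Z} (hg : g ∈ C6) : ∃ n < 6, Rmat ^ n = g := by
  have hord : IsOfFinOrder Rmat := isOfFinOrder_iff_pow_eq_one.2 ⟨6, by norm_num, Rmat_pow_six⟩
  obtain ⟨n, rfl⟩ := hord.mem_powers_iff_mem_zpowers.2 hg
  exact ⟨n % 6, Nat.mod_lt _ (by norm_num), (pow_eq_pow_mod n Rmat_pow_six).symm⟩

theorem R_pow (n : ℕ) :
    R ^ n = ⟨1, ⟨Rmat ^ n, Subgroup.pow_mem _ (Subgroup.mem_zpowers _) n⟩⟩ :=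
  (map_pow (SemidirectProduct.inr : C6 →* p6) ⟨Rmat, Subgroup.mem_zpowers _⟩ n).symm

theorem u_mul_R_pow (n : ℕ) :
    u * R ^ n = ⟨Multiplicative.ofAdd ![1, 0],
      ⟨Rmat ^ n, Subgroup.pow_mem _ (Subgroup.mem_zpowers _) n⟩⟩ := by
  rw [R_pow]
  ext <;> simp [u]

theorem u_mul_R_pow_ne_one (n : ℕ) : u * R ^ n ≠ 1 := by
  intro h
  rw [u_mul_R_pow] at h
  have := congrFun (congrArg (fun x : p6 => x.left.toAdd) h) 0
  simp at this

/-- If `u * R ^ n` is conjugate to `R ^ n`, then some vector in the `⟨R⟩`-orbit of `(1, 0)` lies in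
the image of `R ^ n - 1`. -/
theorem exists_mulVec_of_isConj {n : ℕ} (h : IsConj (u * R ^ n) (R ^ n)) :
    ∃ k < 6, ∃ m : Fin 2 → ℤ,
      m + (Rmat ^ k).1.mulVec ![1, 0] = (Rmat ^ n).1.mulVec m := by
  obtain ⟨c, hc⟩ := isConj_iff.1 h
  rw [mul_inv_eq_iff_eq_mul, u_mul_R_pow, R_pow] at hc
  obtain ⟨k, hk, hg⟩ := exists_pow_of_mem_C6 c.right.2
  refine ⟨k, hk, c.left.toAdd, ?_⟩
  have hleft := congrArg SemidirectProduct.left hc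
  rw [SemidirectProduct.mul_left, SemidirectProduct.mul_left, one_mul] at hleft
  rw [hg]
  exact congrArg Multiplicative.toAdd hleft

theorem orderOf_u_mul_R_sq : orderOf (u * R ^ 2) = 3 := by
  have : Fact (Nat.Prime 3) := ⟨Nat.prime_three⟩
  refine orderOf_eq_prime ?_ (u_mul_R_pow_ne_one 2)
  rw [u_mul_R_pow, pow_three']
  refine SemidirectProduct.ext ?_ (Subtype.ext ?_)
  · exact (by decide : (![1, 0] + (Rmat ^ 2).1.mulVec ![1, 0] +
      ((Rmat ^ 2) * (Rmat ^ 2)).1.mulVec ![1, 0] : Fin 2 → ℤ) = 0)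
  · exact (by decide : Rmat ^ 2 * Rmat ^ 2 * Rmat ^ 2 = 1)

theorem orderOf_u_mul_R_cube : orderOf (u * R ^ 3) = 2 := by
  refine orderOf_eq_prime ?_ (u_mul_R_pow_ne_one 3)
  rw [u_mul_R_pow, pow_two]
  refine SemidirectProduct.ext ?_ (Subtype.ext ?_)
  · exact (by decide : (![1, 0] + (Rmat ^ 3).1.mulVec ![1, 0] : Fin 2 → ℤ) = 0)
  · exact (by decide : Rmat ^ 3 * Rmat ^ 3 = 1)

theorem not_isConj_u_mul_R_sq : ¬ IsConj (u * R ^ 2) (R ^ 2) := by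
  intro h
  obtain ⟨k, hk, m, hm⟩ := exists_mulVec_of_isConj h
  have hsq : (Rmat ^ 2).1 = !![-1, -1; 1, 0] := by decide
  have hcol : ¬ (3 : ℤ) ∣ (Rmat ^ k).1 0 0 - (Rmat ^ k).1 1 0 := by
    clear hm
    revert k
    decide
  rw [hsq] at hm
  have h0 := congrFun hm 0
  have h1 := congrFun hm 1
  simp only [Pi.add_apply, Matrix.mulVec, dotProduct, Fin.sum_univ_two, Matrix.of_apply,
    Matrix.cons_val_zero, Matrix.cons_val_one] at h0 h1
  omega

theorem not_isConj_u_mul_R_cube : ¬ IsConj (u * R ^ 3) (R ^ 3) := by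
  intro h
  obtain ⟨k, hk, m, hm⟩ := exists_mulVec_of_isConj h
  have hcube : (Rmat ^ 3).1 = !![-1, 0; 0, -1] := by decide
  have hcol : ¬ ((2 : ℤ) ∣ (Rmat ^ k).1 0 0 ∧ (2 : ℤ) ∣ (Rmat ^ k).1 1 0) := by
    clear hm
    revert k
    decide
  rw [hcube] at hm
  have h0 := congrFun hm 0
  have h1 := congrFun hm 1
  simp only [Pi.add_apply, Matrix.mulVec, dotProduct, Fin.sum_univ_two, Matrix.of_apply,
    Matrix.cons_val_zero, Matrix.cons_val_one] at h0 h1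
  omega

/-- (i) uR² has order 3 and is not conjugate in p6 to R²; (ii) uR³ has order 2 and is
not conjugate in p6 to R³. -/
theorem statement18 :
    orderOf (u * R ^ 2) = 3 ∧ ¬ IsConj (u * R ^ 2) (R ^ 2) ∧
    orderOf (u * R ^ 3) = 2 ∧ ¬ IsConj (u * R ^ 3) (R ^ 3) := by
  exact ⟨orderOf_u_mul_R_sq, not_isConj_u_mul_R_sq,
    orderOf_u_mul_R_cube, not_isConj_u_mul_R_cube⟩

end Statement18
end

section
/- Let σ = !![0,1;1,0] and let D₂ ≤ GL(2,ℤ) be the subgroup {1, -1, σ, -σ}, and let cmm = ℤ² ⋊ D₂ be the semidirect product for the action of D₂ on ℤ² by matrix multiplication. Then every element of finite order in cmm other than the identity is conjugate in cmm to exactly one of the five elements ((0,0), -1), ((0,0), σ), ((0,0), -σ), ((0,-1), -1), ((1,-1), -1). In particular, cmm has exactly six conjugacy classes of elements of finite order (including the identity), with these elements as representatives. -/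
namespace Statement19

abbrev GL2Z := GL (Fin 2) ℤ

/-- ℤ², written multiplicatively so that it can be used in `SemidirectProduct`. -/
abbrev Z2 := Multiplicative (Fin 2 → ℤ)

/-- A linear automorphism of ℤ² gives an automorphism of the (multiplicatively written)
group ℤ². -/
def linToMulAut : ((Fin 2 → ℤ) ≃ₗ[ℤ] (Fin 2 → ℤ)) →* MulAut Z2 where
  toFun e := AddEquiv.toMultiplicative e.toAddEquiv
  map_one' := by ext x; rfl
  map_mul' e f := by ext x; rfl

/-- The natural (matrix-times-column-vector) action of GL(2,ℤ) on ℤ². -/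
def φ : GL2Z →* MulAut Z2 :=
  linToMulAut.comp
    (((LinearMap.GeneralLinearGroup.generalLinearEquiv ℤ (Fin 2 → ℤ)).toMonoidHom).comp
      (Matrix.GeneralLinearGroup.toLin : GL2Z ≃* _).toMonoidHom)

/-- σ = [[0,1],[1,0]] in GL(2,ℤ). -/
def σ : GL2Z := ⟨!![0, 1; 1, 0], !![0, 1; 1, 0], by decide, by decide⟩

/-- D₂ = {1, -1, σ, -σ}, the subgroup of GL(2,ℤ) generated by -1 and σ. -/
def D2 : Subgroup GL2Z := Subgroup.closure {-1, σ}

theorem neg_one_mem : (-1 : GL2Z) ∈ D2 :=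
  Subgroup.subset_closure (Set.mem_insert _ _)

theorem sigma_mem : σ ∈ D2 :=
  Subgroup.subset_closure (Set.mem_insert_of_mem _ rfl)

theorem neg_sigma_mem : -σ ∈ D2 := by
  simpa using mul_mem neg_one_mem sigma_mem

/-- cmm = ℤ² ⋊ D₂, where D₂ acts on ℤ² by matrix multiplication. -/
abbrev cmm := Z2 ⋊[φ.comp D2.subtype] D2

/-- The five representatives ((0,0),-1), ((0,0),σ), ((0,0),-σ), ((0,-1),-1),
((1,-1),-1) of the nonidentity conjugacy classes of finite-order elements of cmm. -/
def reps : Fin 5 → cmm :=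
  ![⟨1, ⟨-1, neg_one_mem⟩⟩,
    ⟨1, ⟨σ, sigma_mem⟩⟩,
    ⟨1, ⟨-σ, neg_sigma_mem⟩⟩,
    ⟨Multiplicative.ofAdd ![0, -1], ⟨-1, neg_one_mem⟩⟩,
    ⟨Multiplicative.ofAdd ![1, -1], ⟨-1, neg_one_mem⟩⟩]

theorem toAdd_φ (g : GL2Z) (v : Z2) : (φ g v).toAdd = g.val.mulVec v.toAdd := rfl

theorem σ_val : σ.val = !![0, 1; 1, 0] := rfl

theorem coe_D2 : (D2 : Set GL2Z) = {1, -1, σ, -σ} := by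
  have hσ : σ * σ = 1 := by ext i j; fin_cases i <;> fin_cases j <;> rfl
  apply Set.Subset.antisymm
  · intro x hx
    induction hx using Subgroup.closure_induction with
    | mem x hx => rcases hx with rfl | rfl <;> simp
    | one => simp
    | mul x y _ _ hx hy =>
      rcases hx with rfl | rfl | rfl | rfl <;> rcases hy with rfl | rfl | rfl | rfl <;> simp [hσ]
    | inv x _ hx =>
      have hσ' : σ⁻¹ = σ := inv_eq_of_mul_eq_one_left hσ
      rcases hx with rfl | rfl | rfl | rfl <;> simp [hσ', inv_neg]
  · rintro x (rfl | rfl | rfl | rfl)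
    exacts [one_mem _, neg_one_mem, sigma_mem, neg_sigma_mem]

theorem mem_D2_iff {g : GL2Z} : g ∈ D2 ↔ g = 1 ∨ g = -1 ∨ g = σ ∨ g = -σ := by
  rw [← SetLike.mem_coe, coe_D2]; rfl

theorem D2_mul_self (g : D2) : g * g = 1 := by
  obtain ⟨g, hg⟩ := g
  apply Subtype.ext
  rcases mem_D2_iff.1 hg with rfl | rfl | rfl | rfl <;> ext i j <;>
    fin_cases i <;> fin_cases j <;> rfl

theorem D2_mul_comm (g h : D2) : g * h = h * g := by
  have inv_eq (k : D2) : k⁻¹ = k := inv_eq_of_mul_eq_one_left (D2_mul_self k)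
  rw [← inv_eq (g * h), mul_inv_rev, inv_eq, inv_eq]

/-- Conjugacy in `cmm`, written additively on the translation parts. -/
theorem isConj_iff_exists {x y : cmm} : IsConj x y ↔ x.right = y.right ∧
    ∃ n : Fin 2 → ℤ, ∃ g ∈ D2,
      n + g.val.mulVec x.left.toAdd = y.left.toAdd + y.right.val.val.mulVec n := by
  rw [isConj_iff]
  simp_rw [mul_inv_eq_iff_eq_mul, SemidirectProduct.ext_iff]
  constructor
  · rintro ⟨c, hl, hr⟩
    refine ⟨mul_left_cancel (hr.trans (D2_mul_comm _ _)), c.left.toAdd, c.right, c.right.2, hl⟩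
  · rintro ⟨hr, n, g, hg, hl⟩
    refine ⟨⟨Multiplicative.ofAdd n, ⟨g, hg⟩⟩, hl, ?_⟩
    simp only [SemidirectProduct.mul_right, hr]
    exact D2_mul_comm _ _

theorem eq_one_of_right_eq_one {x : cmm} (hx : IsOfFinOrder x) (hr : x.right = 1) : x = 1 := by
  obtain ⟨v, g⟩ := x
  obtain rfl : g = 1 := hr
  have hv : IsOfFinOrder v :=
    (SemidirectProduct.inl_injective (φ := φ.comp D2.subtype)).isOfFinOrder_iff.1 hx
  rw [(isOfFinOrder_iff_eq_one v).1 hv]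
  rfl

theorem mul_self_eq_one_of_isOfFinOrder {x : cmm} (hx : IsOfFinOrder x) : x * x = 1 :=
  eq_one_of_right_eq_one (pow_two x ▸ hx.pow) (D2_mul_self x.right)

theorem left_add_mulVec_left {x : cmm} (hx : IsOfFinOrder x) :
    x.left.toAdd + x.right.val.val.mulVec x.left.toAdd = 0 :=
  congrArg SemidirectProduct.left (mul_self_eq_one_of_isOfFinOrder hx)

theorem neg_one_ne_σ : (-1 : GL2Z) ≠ σ := fun h => by
  have := congrArg (fun g : GL2Z => g.val 0 0) h
  simp [σ_val] at this

theorem neg_one_ne_neg_σ : (-1 : GL2Z) ≠ -σ := fun h => by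
  have := congrArg (fun g : GL2Z => g.val 0 0) h
  simp [σ_val] at this

theorem σ_ne_neg_σ : σ ≠ -σ := fun h => by
  have := congrArg (fun g : GL2Z => g.val 0 1) h
  simp [σ_val] at this

theorem reps_ne_one (i : Fin 5) : reps i ≠ 1 := by
  intro h
  have := congrArg (fun x : cmm => x.right.val.val 0) h
  fin_cases i <;> simp [reps, σ_val, funext_iff, Fin.forall_fin_two] at this

theorem reps_isOfFinOrder (i : Fin 5) : IsOfFinOrder (reps i) := by
  refine isOfFinOrder_iff_pow_eq_one.2 ⟨2, two_pos, ?_⟩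
  rw [pow_two]
  refine SemidirectProduct.ext ?_ (D2_mul_self _)
  apply Multiplicative.toAdd.injective
  simp only [SemidirectProduct.mul_left, toAdd_mul, MonoidHom.comp_apply, toAdd_φ,
    Subgroup.subtype_apply]
  fin_cases i <;> simp [reps]

theorem reps_injective_of_isConj {i j : Fin 5} (h : IsConj (reps i) (reps j)) : i = j := by
  obtain ⟨hr, n, g, hg, hl⟩ := isConj_iff_exists.1 h
  have hr' := congrArg Subtype.val hr
  have h0 := congrFun hl 0
  have h1 := congrFun hl 1
  clear hl hr h
  fin_cases i <;> fin_cases j <;> first | rfl | exfalso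
  all_goals
    simp only [reps] at hr' h0 h1
    first
    | exact neg_one_ne_σ hr'
    | exact neg_one_ne_neg_σ hr'
    | exact σ_ne_neg_σ hr'
    | exact neg_one_ne_σ hr'.symm
    | exact neg_one_ne_neg_σ hr'.symm
    | exact σ_ne_neg_σ hr'.symm
    | rcases mem_D2_iff.1 hg with rfl | rfl | rfl | rfl <;>
        simp [σ_val] at h0 h1 <;> omega

theorem exists_isConj_reps {x : cmm} (hx1 : x ≠ 1) (hx : IsOfFinOrder x) :
    ∃ i, IsConj x (reps i) := by
  have hz := left_add_mulVec_left hx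
  have hr1 : x.right ≠ 1 := fun h => hx1 (eq_one_of_right_eq_one hx h)
  obtain ⟨v, g, hg⟩ := x
  obtain ⟨v, rfl⟩ := Multiplicative.ofAdd.surjective v
  have h0 := congrFun hz 0
  have h1 := congrFun hz 1
  simp_rw [isConj_iff_exists]
  rcases mem_D2_iff.1 hg with rfl | rfl | rfl | rfl
  · exact absurd rfl hr1
  · obtain ⟨p, hp | hp⟩ := (v 0).even_or_odd' <;>
      obtain ⟨q, hq | hq⟩ := (v 1).even_or_odd'
    · refine ⟨0, rfl, ![-p, -q], 1, one_mem _, ?_⟩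
      ext k; fin_cases k <;> simp [reps] <;> omega
    · refine ⟨3, rfl, ![-p, -q - 1], 1, one_mem _, ?_⟩
      ext k; fin_cases k <;> simp [reps] <;> omega
    · refine ⟨3, rfl, ![-q, -p - 1], σ, sigma_mem, ?_⟩
      ext k; fin_cases k <;> simp [reps, σ_val, dotProduct] <;> omega
    · refine ⟨4, rfl, ![-p, -q - 1], 1, one_mem _, ?_⟩
      ext k; fin_cases k <;> simp [reps] <;> omega
  · refine ⟨1, rfl, ![-v 0, 0], 1, one_mem _, ?_⟩
    simp [σ_val, dotProduct] at h0 h1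
    ext k; fin_cases k <;> simp [reps, σ_val]; omega
  · refine ⟨2, rfl, ![-v 0, 0], 1, one_mem _, ?_⟩
    simp [σ_val, dotProduct] at h0 h1
    ext k; fin_cases k <;> simp [reps, σ_val]; omega

/-- D₂ really is the four-element set {1, -1, σ, -σ}; the five listed elements are
nonidentity elements of finite order; and every nonidentity element of finite order in
cmm is conjugate in cmm to exactly one of them.  In particular cmm has exactly six
conjugacy classes of elements of finite order (including the identity). -/
theorem statement19 :
    (D2 : Set GL2Z) = {1, -1, σ, -σ} ∧
    (∀ i : Fin 5, reps i ≠ 1 ∧ IsOfFinOrder (reps i)) ∧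
    (∀ x : cmm, x ≠ 1 → IsOfFinOrder x → ∃! i : Fin 5, IsConj x (reps i)) := by
  refine ⟨coe_D2, fun i => ⟨reps_ne_one i, reps_isOfFinOrder i⟩, fun x hx1 hx => ?_⟩
  obtain ⟨i, hi⟩ := exists_isConj_reps hx1 hx
  exact ⟨i, hi, fun j hj => reps_injective_of_isConj (hj.symm.trans hi)⟩

end Statement19
end
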